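/- arXiv:1712.00248 — 4 statements merged into one kernel-verified Lean document; each statement's English description precedes it below -/
import Mathlib

section
/- Let $p$ be a prime, let $G = \mathbb{F}_p^n$, and let $A \subseteq G \times G$ be a set of density $c > 0$ (i.e. $|A| = c|G|^2$). Define $A^{(1)} = \bigcup_{x \in G} \{x\} \times (A_{x\cdot} - A_{x\cdot})$, then $A^{(2)} = \bigcup_{y \in G} (A^{(1)}_{\cdot y} + A^{(1)}_{\cdot y} - A^{(1)}_{\cdot y} - A^{(1)}_{\cdot y}) \times \{y\}$, and then $A^{(3)} = \bigcup_{x \in G} \{x\} \times (A^{(2)}_{x\cdot} + A^{(2)}_{x\cdot} - A^{(2)}_{x\cdot} - A^{(2)}_{x\cdot})$. Then there exist absolute constants $C, C' > 0$ such that $A^{(3)}$ contains a set of the form $(U \times V) \cap \mathbf{B}$, where $U, V \leq G$ are subspaces and $\mathbf{B} = \{(x,y) \in G \times G : \beta(x,y) = 0\}$ for some bilinear map $\beta \colon G \times G \to W$ into an $\mathbb{F}_p$-vector space $W$, satisfying $\operatorname{codim} U, \operatorname{codim} V, \dim W \leq p^{\exp(C(1 + \log c^{-1})^{C'})}$. 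-/
/-- Convolve once in the `y`-direction: `A⁽¹⁾ = ⋃ₓ {x} × (A_{x·} - A_{x·})`. -/
def rowDiff {p n : ℕ} (A : Set ((Fin n → ZMod p) × (Fin n → ZMod p))) :
    Set ((Fin n → ZMod p) × (Fin n → ZMod p)) :=
  {xy | ∃ y₁ y₂, (xy.1, y₁) ∈ A ∧ (xy.1, y₂) ∈ A ∧ xy.2 = y₁ - y₂}

/-- Convolve twice in the `x`-direction:
`A⁽²⁾ = ⋃_y (A⁽¹⁾_{·y} + A⁽¹⁾_{·y} - A⁽¹⁾_{·y} - A⁽¹⁾_{·y}) × {y}`. -/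
def colQuad {p n : ℕ} (A : Set ((Fin n → ZMod p) × (Fin n → ZMod p))) :
    Set ((Fin n → ZMod p) × (Fin n → ZMod p)) :=
  {xy | ∃ x₁ x₂ x₃ x₄, (x₁, xy.2) ∈ A ∧ (x₂, xy.2) ∈ A ∧ (x₃, xy.2) ∈ A ∧ (x₄, xy.2) ∈ A ∧
    xy.1 = x₁ + x₂ - x₃ - x₄}

/-- Convolve twice in the `y`-direction:
`A⁽³⁾ = ⋃ₓ {x} × (A⁽²⁾_{x·} + A⁽²⁾_{x·} - A⁽²⁾_{x·} - A⁽²⁾_{x·})`. -/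
def rowQuad {p n : ℕ} (A : Set ((Fin n → ZMod p) × (Fin n → ZMod p))) :
    Set ((Fin n → ZMod p) × (Fin n → ZMod p)) :=
  {xy | ∃ y₁ y₂ y₃ y₄, (xy.1, y₁) ∈ A ∧ (xy.1, y₂) ∈ A ∧ (xy.1, y₃) ∈ A ∧ (xy.1, y₄) ∈ A ∧
    xy.2 = y₁ + y₂ - y₃ - y₄}

set_option maxHeartbeats 400000 in
open Finset in
lemma bsg_graph {H : Type*} [DecidableEq H] (S : Finset H) (r : H → H → Prop) [DecidableRel r]
    (N η M ρ : ℝ) (hN : 0 < N) (hη : 0 < η) (hM : 0 < M) (hρ : ρ = η ^ 2 / (32 * M ^ 3))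
    (hS : (#S : ℝ) ≤ M * N) (hE : η * N ^ 2 ≤ ∑ v ∈ S, (#{a ∈ S | r a v} : ℝ)) :
    ∃ S' ⊆ S, ∃ T ⊆ S, η * N / (4 * M) ≤ #S' ∧ η * N / (2 * M) ≤ #T ∧
      ∀ a ∈ S', ∀ b ∈ S', (#T : ℝ) / 2 ≤
        #{u ∈ T | ρ * N ≤ #{w ∈ S | r a w ∧ r u w} ∧ ρ * N ≤ #{w ∈ S | r b w ∧ r u w}} := by
  classical
  have hρ0 : 0 < ρ := by rw [hρ]; positivity
  set T : H → Finset H := fun v => {a ∈ S | r a v} with hT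
  set cn : H → H → ℝ := fun a b => (#{w ∈ S | r a w ∧ r b w} : ℝ) with hcn
  set bad : H → Finset (H × H) := fun v => {q ∈ T v ×ˢ T v | cn q.1 q.2 < ρ * N} with hbad
  -- sum of bad
  have h1 : ∑ v ∈ S, (#(bad v) : ℝ) ≤ ρ * M ^ 2 * N ^ 3 := by
    have e1 : ∑ v ∈ S, (#(bad v) : ℝ) =
        ∑ q ∈ {q ∈ S ×ˢ S | cn q.1 q.2 < ρ * N}, cn q.1 q.2 := by
      have := Finset.sum_card_bipartiteAbove_eq_sum_card_bipartiteBelow (s := S)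
        (t := {q ∈ S ×ˢ S | cn q.1 q.2 < ρ * N}) (fun v (q : H × H) => r q.1 v ∧ r q.2 v)
      simp only [bipartiteAbove, bipartiteBelow] at this
      rw [hcn]
      simp only
      rw [← Nat.cast_sum, ← Nat.cast_sum]
      rw [← this]
      congr 1
      apply Finset.sum_congr rfl
      intro v hv
      congr 1
      ext q
      simp only [hbad, hT, mem_filter, mem_product]
      tauto
    rw [e1]
    calc _ ≤ ∑ q ∈ {q ∈ S ×ˢ S | cn q.1 q.2 < ρ * N}, ρ * N := by
          apply Finset.sum_le_sum
          intro q hq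
          exact (mem_filter.1 hq).2.le
      _ = #{q ∈ S ×ˢ S | cn q.1 q.2 < ρ * N} * (ρ * N) := by simp
      _ ≤ (#(S ×ˢ S) : ℕ) * (ρ * N) := by
          gcongr
          exact filter_subset _ _
      _ = (#S : ℝ) ^ 2 * (ρ * N) := by rw [card_product]; push_cast; ring
      _ ≤ (M * N) ^ 2 * (ρ * N) := by gcongr
      _ = _ := by ring
  have h2 : η ^ 2 / M * N ^ 3 ≤ ∑ v ∈ S, (#(T v) : ℝ) ^ 2 := by
    have h := sq_sum_le_card_mul_sum_sq (s := S) (f := fun v => (#(T v) : ℝ))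
    have h' : (η * N ^ 2) ^ 2 ≤ M * N * ∑ v ∈ S, (#(T v) : ℝ) ^ 2 := by
      calc (η * N ^ 2) ^ 2 ≤ (∑ v ∈ S, (#(T v) : ℝ)) ^ 2 := by gcongr
        _ ≤ _ := h
        _ ≤ _ := mul_le_mul_of_nonneg_right hS (Finset.sum_nonneg fun _ _ => sq_nonneg _)
    have h3 : 0 < M * N := by positivity
    rw [show η ^ 2 / M * N ^ 3 = (η * N ^ 2) ^ 2 / (M * N) by field_simp]
    rw [div_le_iff₀ h3]; linarith
  obtain ⟨v, hv, hv2⟩ : ∃ v ∈ S, η ^ 2 / (2 * M ^ 2) * N ^ 2 ≤ (#(T v) : ℝ) ^ 2 - 16 * #(bad v) := by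
    by_contra! hcon
    have hne : S.Nonempty := by
      rw [nonempty_iff_ne_empty]; rintro rfl
      simp at hE
      have : 0 < η * N ^ 2 := by positivity
      linarith
    have := Finset.sum_lt_sum_of_nonempty hne hcon
    rw [Finset.sum_sub_distrib, ← Finset.mul_sum, sum_const, nsmul_eq_mul] at this
    have h4 : (#S : ℝ) * (η ^ 2 / (2 * M ^ 2) * N ^ 2) ≤ M * N * (η ^ 2 / (2 * M ^ 2) * N ^ 2) := by
      gcongr
    have h5 : M * N * (η ^ 2 / (2 * M ^ 2) * N ^ 2) = η ^ 2 / M * N ^ 3 / 2 := by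
      field_simp
    have h6 : 16 * (ρ * M ^ 2 * N ^ 3) = η ^ 2 / M * N ^ 3 / 2 := by
      rw [hρ]; field_simp; ring
    linarith
  set t : ℝ := (#(T v) : ℝ) with ht
  have ht0 : η * N / (2 * M) ≤ t := by
    have hb : (0:ℝ) ≤ #(bad v) := by positivity
    apply le_of_sq_le_sq _ (by positivity) 
    calc (η * N / (2 * M)) ^ 2 = (η ^ 2 / (2 * M ^ 2) * N ^ 2) / 2 := by field_simp
      _ ≤ η ^ 2 / (2 * M ^ 2) * N ^ 2 := by
        have : 0 < η ^ 2 / (2 * M ^ 2) * N ^ 2 := by positivity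
        linarith
      _ ≤ _ := by linarith
  have htpos : 0 < t := lt_of_lt_of_le (by positivity) ht0
  have hbadt : (#(bad v) : ℝ) ≤ t ^ 2 / 16 := by
    have : 0 < η ^ 2 / (2 * M ^ 2) * N ^ 2 := by positivity
    linarith
  set bd : H → Finset H := fun a => {u ∈ T v | cn a u < ρ * N} with hbd
  have hsumbd : (#(bad v) : ℝ) = ∑ a ∈ T v, (#(bd a) : ℝ) := by
    rw [← Nat.cast_sum]
    congr 1
    rw [hbad]
    simp only
    rw [Finset.card_filter, Finset.sum_product]
    apply Finset.sum_congr rfl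
    intro a ha
    rw [hbd]; simp only
    rw [Finset.card_filter]
  set S' : Finset H := {a ∈ T v | (#(bd a) : ℝ) ≤ t / 4} with hS'
  have hTS : T v ⊆ S := filter_subset _ _
  refine ⟨S', (filter_subset _ _).trans hTS, T v, hTS, ?_, ht0, ?_⟩
  · have hc : (#S' : ℝ) + #{a ∈ T v | ¬ (#(bd a) : ℝ) ≤ t / 4} = t := by
      rw [ht, hS']; norm_cast
      exact card_filter_add_card_filter_not _
    have hx : (#{a ∈ T v | ¬ (#(bd a) : ℝ) ≤ t / 4} : ℝ) * (t / 4) ≤ t ^ 2 / 16 := by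
      calc _ = ∑ a ∈ {a ∈ T v | ¬ (#(bd a) : ℝ) ≤ t / 4}, t / 4 := by simp
        _ ≤ ∑ a ∈ {a ∈ T v | ¬ (#(bd a) : ℝ) ≤ t / 4}, (#(bd a) : ℝ) := by
            apply Finset.sum_le_sum
            intro a ha
            exact (not_le.1 (mem_filter.1 ha).2).le
        _ ≤ ∑ a ∈ T v, (#(bd a) : ℝ) := by
            apply Finset.sum_le_sum_of_subset_of_nonneg (filter_subset _ _)
            intros; positivity
        _ ≤ _ := by rw [← hsumbd]; exact hbadt
    have hx2 : (#{a ∈ T v | ¬ (#(bd a) : ℝ) ≤ t / 4} : ℝ) ≤ t / 4 := by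
      apply le_of_mul_le_mul_right _ (show 0 < t / 4 by positivity)
      refine hx.trans (le_of_eq (by ring))
    have : η * N / (4 * M) = η * N / (2 * M) / 2 := by field_simp; ring
    rw [this]
    linarith
  · intro a ha b hb
    have ha' := (mem_filter.1 ha).2
    have hb' := (mem_filter.1 hb).2
    have hsub : T v ⊆ {u ∈ T v | ρ * N ≤ cn a u ∧ ρ * N ≤ cn b u} ∪ bd a ∪ bd b := by
      intro u hu
      simp only [hbd, mem_union, mem_filter, hu, true_and]
      rcases lt_or_ge (cn a u) (ρ * N) with h | h
      · tauto
      · rcases lt_or_ge (cn b u) (ρ * N) with h' | h' <;> tauto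
    have hcard : t ≤ #{u ∈ T v | ρ * N ≤ cn a u ∧ ρ * N ≤ cn b u} + #(bd a) + #(bd b) := by
      rw [ht]; norm_cast
      exact (card_le_card hsub).trans ((card_union_le _ _).trans (by gcongr; exact card_union_le _ _))
    linarith

set_option maxHeartbeats 400000 in
open Finset Pointwise in
lemma bsg_count {H : Type*} [DecidableEq H] [AddCommGroup H] (S D S' T : Finset H) (ρ : ℝ) (hρ : 0 < ρ)
    (h : ∀ a ∈ S', ∀ b ∈ S', (#T : ℝ) / 2 ≤
        #{u ∈ T | ρ ≤ #{w ∈ S | a - w ∈ D ∧ u - w ∈ D} ∧ ρ ≤ #{w ∈ S | b - w ∈ D ∧ u - w ∈ D}}) :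
    (#(S' - S') : ℝ) * (#T / 2 * ρ ^ 2) ≤ (#D : ℝ) ^ 4 := by
  classical
  have hex : ∀ d ∈ S' - S', ∃ q : H × H, q.1 ∈ S' ∧ q.2 ∈ S' ∧ q.1 - q.2 = d := by
    intro d hd
    obtain ⟨a, ha, b, hb, rfl⟩ := mem_sub.1 hd
    exact ⟨(a, b), ha, hb, rfl⟩
  choose! q hq1 hq2 hq3 using hex
  set F : H → Finset (H × H × H) := fun d =>
    {z ∈ T ×ˢ S ×ˢ S | ((q d).1 - z.2.1 ∈ D ∧ z.1 - z.2.1 ∈ D) ∧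
      ((q d).2 - z.2.2 ∈ D ∧ z.1 - z.2.2 ∈ D)} with hF
  have hFc : ∀ d ∈ S' - S', (#T : ℝ) / 2 * ρ ^ 2 ≤ #(F d) := by
    intro d hd
    have h1 := h _ (hq1 d hd) _ (hq2 d hd)
    set T' := {u ∈ T | ρ ≤ #{w ∈ S | (q d).1 - w ∈ D ∧ u - w ∈ D} ∧
      ρ ≤ #{w ∈ S | (q d).2 - w ∈ D ∧ u - w ∈ D}} with hT'
    have h2 : (#(F d) : ℝ) = ∑ u ∈ T, (#{w ∈ S | (q d).1 - w ∈ D ∧ u - w ∈ D} : ℝ) *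
        #{w ∈ S | (q d).2 - w ∈ D ∧ u - w ∈ D} := by
      have : #(F d) = ∑ u ∈ T, #{w ∈ S | (q d).1 - w ∈ D ∧ u - w ∈ D} *
        #{w ∈ S | (q d).2 - w ∈ D ∧ u - w ∈ D} := by
        rw [hF]; simp only
        rw [Finset.card_filter, Finset.sum_product]
        apply Finset.sum_congr rfl
        intro u hu
        rw [← Finset.card_product, ← Finset.card_filter]
        congr 1
        ext ⟨w, w'⟩
        simp only [mem_filter, mem_product]
        tauto
      rw [this]; push_cast; rfl
    rw [h2]
    calc (#T : ℝ) / 2 * ρ ^ 2 ≤ #T' * ρ ^ 2 := by gcongr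
      _ = ∑ u ∈ T', ρ * ρ := by simp [sq]
      _ ≤ ∑ u ∈ T', (#{w ∈ S | (q d).1 - w ∈ D ∧ u - w ∈ D} : ℝ) *
        #{w ∈ S | (q d).2 - w ∈ D ∧ u - w ∈ D} := by
          apply Finset.sum_le_sum
          intro u hu
          have := (mem_filter.1 hu).2
          exact mul_le_mul this.1 this.2 hρ.le (by positivity)
      _ ≤ _ := by
          apply Finset.sum_le_sum_of_subset_of_nonneg (filter_subset _ _)
          intros; positivity
  have hinj : #((S' - S').sigma F) ≤ #(D ×ˢ D ×ˢ D ×ˢ D) := by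
    apply Finset.card_le_card_of_injOn
      (fun z => ((q z.1).1 - z.2.2.1, z.2.1 - z.2.2.1, z.2.1 - z.2.2.2, (q z.1).2 - z.2.2.2))
    · rintro ⟨d, u, w, w'⟩ hz
      simp only [hF, mem_coe, mem_sigma, mem_filter, mem_product] at hz ⊢
      tauto
    · rintro ⟨d, u, w, w'⟩ hz ⟨d', u', x, x'⟩ hz' heq
      simp only [mem_coe, mem_sigma] at hz hz'
      simp only [Prod.mk.injEq] at heq
      obtain ⟨e1, e2, e3, e4⟩ := heq
      have hd : d = d' := by
        rw [← hq3 d hz.1, ← hq3 d' hz'.1]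
        calc (q d).1 - (q d).2 = ((q d).1 - w) - (u - w) + (u - w') - ((q d).2 - w') := by abel
          _ = _ := by rw [e1, e2, e3, e4]; abel
      subst hd
      have hw : w = x := by simpa using e1
      have hw' : w' = x' := by simpa using e4
      subst hw hw'
      have hu : u = u' := by simpa using e2
      subst hu
      rfl
  have hs : (#(S' - S') : ℝ) * (#T / 2 * ρ ^ 2) ≤ #((S' - S').sigma F) := by
    rw [card_sigma]; push_cast
    calc _ = ∑ d ∈ S' - S', (#T / 2 * ρ ^ 2 : ℝ) := by simp
      _ ≤ _ := Finset.sum_le_sum hFc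
  refine hs.trans ?_
  calc (#((S' - S').sigma F) : ℝ) ≤ #(D ×ˢ D ×ˢ D ×ˢ D) := by exact_mod_cast hinj
    _ = _ := by simp only [card_product]; push_cast; ring

set_option maxHeartbeats 400000 in
open Finset Pointwise in
lemma bsg {H : Type*} [DecidableEq H] [AddCommGroup H] [Fintype H] (S : Finset H) (N R : ℝ) (a : ℕ)
    (hN : 0 < N) (hR : 2 ≤ R) (hS : (#S : ℝ) ≤ R * N)
    (hE : N ^ 3 / R ^ a ≤ ∑ d : H, (#{q ∈ S ×ˢ S | q.1 - q.2 = d} : ℝ) ^ 2) :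
    ∃ S' ⊆ S, N / R ^ (a + 5) ≤ #S' ∧ (#(S' - S') : ℝ) ≤ R ^ (9 * a + 49) * N := by
  classical
  have hR0 : 0 < R := by linarith
  set nn : H → ℝ := fun d => (#{q ∈ S ×ˢ S | q.1 - q.2 = d} : ℝ) with hnn
  have hnn0 : ∀ d, 0 ≤ nn d := fun d => by rw [hnn]; positivity
  have hsum : ∑ d, nn d = (#S : ℝ) ^ 2 := by
    rw [hnn, ← Nat.cast_sum, ← Finset.card_eq_sum_card_fiberwise (fun _ _ => by simp), card_product]
    push_cast; ring
  have hnnS : ∀ d, nn d ≤ R * N := by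
    intro d
    refine le_trans ?_ hS
    rw [hnn]; simp only [Nat.cast_le]
    apply Finset.card_le_card_of_injOn (fun q => q.1)
    · intro q hq
      simp only [coe_filter, mem_product, Set.mem_setOf_eq] at hq
      exact hq.1.1
    · rintro ⟨x, y⟩ hq ⟨x', y'⟩ hq' h
      simp only [coe_filter, mem_product, Set.mem_setOf_eq] at hq hq' h
      subst h
      have : y = y' := by
        have := hq.2.trans hq'.2.symm
        simpa using this
      rw [this]
  set τ : ℝ := 1 / R ^ (a + 3) with hτ
  have hτ0 : 0 < τ := by positivity
  set D : Finset H := {d | τ * N ≤ nn d} with hD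
  have hS2 : (#S : ℝ) ^ 2 ≤ (R * N) ^ 2 := by gcongr
  have hDc : (#D : ℝ) ≤ R ^ (a + 5) * N := by
    have h1 : (#D : ℝ) * (τ * N) ≤ (R * N) ^ 2 := by
      calc (#D : ℝ) * (τ * N) = ∑ d ∈ D, τ * N := by simp
        _ ≤ ∑ d ∈ D, nn d := Finset.sum_le_sum fun d hd => (mem_filter.1 hd).2
        _ ≤ ∑ d, nn d := Finset.sum_le_sum_of_subset_of_nonneg (subset_univ _) fun d _ _ => hnn0 d
        _ ≤ _ := by rw [hsum]; exact hS2
    apply le_of_mul_le_mul_right _ (show 0 < τ * N by positivity)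
    refine h1.trans (le_of_eq ?_)
    rw [hτ]; field_simp
    ring
  have hedge : 1 / R ^ (a + 2) * N ^ 2 ≤ ∑ d ∈ D, nn d := by
    have h1 : ∑ d, nn d ^ 2 ≤ (R * N) * ∑ d ∈ D, nn d + τ * N * (R * N) ^ 2 := by
      rw [← Finset.sum_filter_add_sum_filter_not univ (fun d => τ * N ≤ nn d)]
      apply add_le_add
      · rw [mul_sum]
        apply Finset.sum_le_sum
        intro d _
        rw [sq]
        exact mul_le_mul_of_nonneg_right (hnnS d) (hnn0 d)
      · calc _ ≤ ∑ d ∈ {d | ¬ τ * N ≤ nn d}, τ * N * nn d := by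
              apply Finset.sum_le_sum
              intro d hd
              rw [sq]
              exact mul_le_mul_of_nonneg_right (not_le.1 (mem_filter.1 hd).2).le (hnn0 d)
          _ ≤ ∑ d, τ * N * nn d := Finset.sum_le_sum_of_subset_of_nonneg (subset_univ _)
              fun d _ _ => mul_nonneg (by positivity) (hnn0 d)
          _ = τ * N * (#S : ℝ) ^ 2 := by rw [← mul_sum, hsum]
          _ ≤ _ := by gcongr
    have h2 : τ * N * (R * N) ^ 2 ≤ N ^ 3 / R ^ a / 2 := by
      have : τ * N * (R * N) ^ 2 = N ^ 3 / R ^ a / R := by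
        rw [hτ]; field_simp; ring
      rw [this]
      gcongr
    have h3 : N ^ 3 / R ^ a / 2 ≤ (R * N) * ∑ d ∈ D, nn d := by
      have := hE.trans h1
      linarith
    have h4 : N ^ 3 / R ^ a / R ≤ (R * N) * ∑ d ∈ D, nn d := by
      refine le_trans ?_ h3
      gcongr
    apply le_of_mul_le_mul_left _ (show 0 < R * N by positivity)
    refine le_trans (le_of_eq ?_) h4
    field_simp; ring
  have hedge' : 1 / R ^ (a + 2) * N ^ 2 ≤ ∑ v ∈ S, (#{x ∈ S | x - v ∈ D} : ℝ) := by
    refine hedge.trans (le_of_eq ?_)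
    rw [hnn, ← Nat.cast_sum, ← Nat.cast_sum]
    congr 1
    calc _ = #{q ∈ S ×ˢ S | q.1 - q.2 ∈ D} := by
          rw [Finset.card_eq_sum_card_fiberwise (s := {q ∈ S ×ˢ S | q.1 - q.2 ∈ D}) (t := D)
            (f := fun q => q.1 - q.2) (fun q hq => by simpa using (mem_filter.1 hq).2)]
          apply Finset.sum_congr rfl
          intro d hd
          congr 1
          ext q
          simp only [mem_filter]
          constructor
          · rintro ⟨h, rfl⟩; exact ⟨⟨h, hd⟩, rfl⟩
          · rintro ⟨⟨h, _⟩, h'⟩; exact ⟨h, h'⟩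
      _ = _ := by
          rw [Finset.card_filter, Finset.sum_product_right]
          apply Finset.sum_congr rfl
          intro v _
          rw [Finset.card_filter]
  obtain ⟨S', hS', T, hT, h1, h2, h3⟩ := bsg_graph S (fun x v => x - v ∈ D) N (1 / R ^ (a + 2)) R _ hN
    (by positivity) hR0 rfl hS hedge'
  refine ⟨S', hS', ?_, ?_⟩
  · refine le_trans ?_ h1
    rw [show 1 / R ^ (a + 2) * N / (4 * R) = N / (R ^ (a + 3) * 2 ^ 2) by field_simp; ring,
      show R ^ (a + 5) = R ^ (a + 3) * R ^ 2 by ring]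
    gcongr
  · set ρ : ℝ := (1 / R ^ (a + 2)) ^ 2 / (32 * R ^ 3) with hρ
    have hρ0 : 0 < ρ := by positivity
    have h4 := bsg_count S D S' T (ρ * N) (by positivity) h3
    have hρ1 : 1 / R ^ (2 * a + 12) ≤ ρ := by
      rw [hρ, show (1 / R ^ (a + 2)) ^ 2 / (32 * R ^ 3) = 1 / (R ^ (2 * a + 7) * 2 ^ 5) by
        field_simp; ring, show R ^ (2 * a + 12) = R ^ (2 * a + 7) * R ^ 5 by ring]
      gcongr
    have hT1 : N / R ^ (a + 5) ≤ (#T : ℝ) / 2 := by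
      have : (1 / R ^ (a + 2) * N / (2 * R)) / 2 ≤ (#T : ℝ) / 2 := by gcongr
      refine le_trans ?_ this
      rw [show 1 / R ^ (a + 2) * N / (2 * R) / 2 = N / (R ^ (a + 3) * 2 ^ 2) by field_simp; ring,
        show R ^ (a + 5) = R ^ (a + 3) * R ^ 2 by ring]
      gcongr
    have h5 : (#(S' - S') : ℝ) * (N / R ^ (a + 5) * (1 / R ^ (2 * a + 12) * N) ^ 2) ≤
        (R ^ (a + 5) * N) ^ 4 := by
      refine le_trans ?_ (h4.trans ?_) <;> gcongr
    have h6 : (R ^ (a + 5) * N) ^ 4 = (R ^ (9 * a + 49) * N) *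
        (N / R ^ (a + 5) * (1 / R ^ (2 * a + 12) * N) ^ 2) := by
      field_simp; ring
    rw [h6] at h5
    exact le_of_mul_le_mul_right h5 (by positivity)

open Finset Pointwise in
lemma freiman {p : ℕ} [Fact p.Prime] {H : Type*} [DecidableEq H] [AddCommGroup H] [Fintype H]
    [Module (ZMod p) H] (A : Finset H) (hA : A.Nonempty) (K : ℝ)
    (hK : (#(A - A) : ℝ) ≤ K * #A) :
    ∃ (H' : Submodule (ZMod p) H) (k : ℕ), (k : ℝ) ≤ K ^ 5 ∧ (∀ a ∈ A, ∀ b ∈ A, a - b ∈ H') ∧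
      (Nat.card H' : ℝ) ≤ (p : ℝ) ^ k * #(A - A) := by
  classical
  have hA0 : (0 : ℝ) < #A := by exact_mod_cast hA.card_pos
  have h1 : (#((3 • A) - (2 • A)) : ℝ) ≤ K ^ 5 * #A := by
    have := Finset.pluennecke_ruzsa_inequality_nsmul_sub_nsmul_sub hA A 3 2
    have h2 : (#((3 • A) - (2 • A)) : ℝ) ≤ ((#(A - A) : ℝ) / #A) ^ (3 + 2) * #A := by
      have h3 := (NNRat.cast_le (K := ℝ)).2 this
      push_cast at h3
      exact h3
    refine h2.trans ?_
    gcongr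
    rwa [div_le_iff₀ hA0]
  have he : (2 • A - 2 • A) + A = 3 • A - 2 • A := by
    rw [sub_add_eq_add_sub, ← succ_nsmul]
  rw [← he] at h1
  obtain ⟨F, -, hF, hcov⟩ := Finset.ruzsa_covering_add hA h1
  set P := Submodule.span (ZMod p) (F : Set H) with hP
  let L : AddSubgroup H :=
    { carrier := {z | ∃ u ∈ P, ∃ d ∈ A - A, z = u + d}
      zero_mem' := by
        obtain ⟨a, ha⟩ := hA
        exact ⟨0, P.zero_mem, 0, mem_sub.2 ⟨a, ha, a, ha, sub_self a⟩, by simp⟩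
      add_mem' := by
        rintro _ _ ⟨u, hu, d, hd, rfl⟩ ⟨u', hu', d', hd', rfl⟩
        have : d + d' ∈ 2 • A - 2 • A := by
          obtain ⟨a, ha, b, hb, rfl⟩ := mem_sub.1 hd
          obtain ⟨a', ha', b', hb', rfl⟩ := mem_sub.1 hd'
          rw [two_nsmul]
          exact mem_sub.2 ⟨a + a', add_mem_add ha ha', b + b', add_mem_add hb hb', by abel⟩
        obtain ⟨f, hf, e, he, hfe⟩ := mem_add.1 (hcov this)
        refine ⟨u + u' + f, P.add_mem (P.add_mem hu hu') (Submodule.subset_span hf), e, he, ?_⟩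
        rw [add_assoc (u + u'), hfe]; abel
      neg_mem' := by
        rintro _ ⟨u, hu, d, hd, rfl⟩
        obtain ⟨a, ha, b, hb, rfl⟩ := mem_sub.1 hd
        exact ⟨-u, P.neg_mem hu, b - a, mem_sub.2 ⟨b, hb, a, ha, rfl⟩, by abel⟩ }
  refine ⟨AddSubgroup.toZModSubmodule p L, #F, hF, ?_, ?_⟩
  · intro a ha b hb
    exact ⟨0, P.zero_mem, a - b, mem_sub.2 ⟨a, ha, b, hb, rfl⟩, by simp⟩
  · have hc : Nat.card (AddSubgroup.toZModSubmodule p L) ≤ Nat.card (P × (A - A : Finset H)) := by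
      apply Nat.card_le_card_of_surjective
        (fun q => (⟨q.1.1 + q.2.1, ⟨q.1.1, q.1.2, q.2.1, q.2.2, rfl⟩⟩ : AddSubgroup.toZModSubmodule p L))
      rintro ⟨_, u, hu, d, hd, rfl⟩
      exact ⟨(⟨u, hu⟩, ⟨d, hd⟩), rfl⟩
    rw [Nat.card_prod] at hc
    have hcP : Nat.card P ≤ p ^ #F := by
      rw [Module.natCard_eq_pow_finrank (K := ZMod p), Nat.card_zmod]
      exact Nat.pow_le_pow_right (Fact.out : p.Prime).pos (finrank_span_finset_le_card F)
    have : Nat.card (A - A : Finset H) = #(A - A) := by simp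
    rw [this] at hc
    calc (Nat.card (AddSubgroup.toZModSubmodule p L) : ℝ) ≤ (Nat.card P * #(A - A) : ℕ) := by exact_mod_cast hc
      _ ≤ (p ^ #F * #(A - A) : ℕ) := by exact_mod_cast Nat.mul_le_mul_right _ hcP
      _ = _ := by push_cast; rfl

set_option maxHeartbeats 400000 in
open Finset Pointwise in
lemma inv_aux {p : ℕ} [Fact p.Prime] {G : Type*} [DecidableEq G] [AddCommGroup G] [Fintype G]
    [Module (ZMod p) G] (S : Finset (G × G)) (H' : Submodule (ZMod p) (G × G)) (M α B N : ℝ)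
    (hM : 0 < M) (hα : 0 < α) (hB : 0 < B) (hN : 0 < N)
    (hfib : ∀ x, (#{s ∈ S | s.1 = x} : ℝ) ≤ M) (hS : α * N ≤ #S)
    (hH : (Nat.card H' : ℝ) ≤ B * N) (hSH : ∀ a ∈ S, ∀ b ∈ S, a - b ∈ H') :
    ∃ (L : G →ₗ[ZMod p] G) (b : G), α ^ 2 / (B * M) * N ≤ #{s ∈ S | s.2 = L s.1 + b} := by
  classical
  have hne : S.Nonempty := by
    rw [nonempty_iff_ne_empty]; rintro rfl
    simp at hS
    have : 0 < α * N := by positivity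
    linarith
  obtain ⟨s0, hs0⟩ := hne
  -- the domain
  set D : Submodule (ZMod p) G := H'.map (LinearMap.fst (ZMod p) G G) with hD
  obtain ⟨σ, hσ⟩ := LinearMap.exists_rightInverse_of_surjective
    ((LinearMap.fst (ZMod p) G G).submoduleMap H')
    (LinearMap.range_eq_top.2 (LinearMap.submoduleMap_surjective _ _))
  obtain ⟨L, hL⟩ := LinearMap.exists_extend ((LinearMap.snd (ZMod p) G G) ∘ₗ H'.subtype ∘ₗ σ)
  have hLD : ∀ d ∈ D, (d, L d) ∈ H' := by
    intro d hd
    have h1 : (σ ⟨d, hd⟩ : G × G) ∈ H' := (σ ⟨d, hd⟩).2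
    have h2 : (σ ⟨d, hd⟩ : G × G).1 = d := by
      have := LinearMap.congr_fun hσ ⟨d, hd⟩
      exact congrArg Subtype.val this
    have h3 : (σ ⟨d, hd⟩ : G × G).2 = L d := by
      have := LinearMap.congr_fun hL ⟨d, hd⟩
      exact this.symm
    have h4 : (d, L d) = (σ ⟨d, hd⟩ : G × G) := Prod.ext h2.symm h3.symm
    rw [h4]
    exact h1
  set Z : Finset G := univ.filter (fun h => ((0 : G), h) ∈ H') with hZ
  have hZ0 : (0 : G) ∈ Z := by rw [hZ, mem_filter]; exact ⟨mem_univ _, H'.zero_mem⟩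
  set DS : Finset G := S.image Prod.fst with hDS
  have hDSc : (#S : ℝ) ≤ M * #DS := by
    rw [Finset.card_eq_sum_card_image Prod.fst S]
    push_cast
    calc _ ≤ ∑ x ∈ DS, M := Finset.sum_le_sum fun x _ => hfib x
      _ = _ := by simp [mul_comm]
  have hinj : #DS * #Z ≤ Nat.card H' := by
    rw [← card_product, Nat.card_eq_fintype_card, ← Finset.card_univ]
    have hm : ∀ x ∈ DS, ∀ h ∈ Z, (x - s0.1, L (x - s0.1) + h) ∈ H' := by
      intro x hx h hh
      obtain ⟨s, hs, rfl⟩ := mem_image.1 hx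
      have h1 : s.1 - s0.1 ∈ D := ⟨s - s0, hSH s hs s0 hs0, rfl⟩
      have := H'.add_mem (hLD _ h1) (mem_filter.1 hh).2
      simpa using this
    apply Finset.card_le_card_of_injOn
      (fun q => if h : (q.1 - s0.1, L (q.1 - s0.1) + q.2) ∈ H' then ⟨_, h⟩ else 0)
    · intro _ _; simp
    · rintro ⟨x, h⟩ hq ⟨x', h'⟩ hq' heq
      simp only [mem_coe, mem_product] at hq hq'
      simp only [dif_pos (hm _ hq.1 _ hq.2), dif_pos (hm _ hq'.1 _ hq'.2)] at heq
      have := congrArg Subtype.val heq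
      simp only [Prod.mk.injEq, sub_left_inj] at this
      obtain ⟨rfl, h2⟩ := this
      simpa using h2
  have hZc : (#Z : ℝ) * (α ^ 2 / (B * M) * N) ≤ #S := by
    have h1 : (#DS : ℝ) * #Z ≤ B * N := le_trans (by exact_mod_cast hinj) hH
    have h2 : α * N / M ≤ #DS := by
      rw [div_le_iff₀ hM]; linarith
    have h3 : α * N / M * #Z ≤ B * N := le_trans (by gcongr) h1
    have h4 : (#Z : ℝ) ≤ B * M / α := by
      rw [le_div_iff₀ hα]
      have h5 : α * N / M * #Z * M = (#Z * α) * N := by field_simp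
      have h6 : α * N / M * #Z * M ≤ B * N * M := by gcongr
      apply le_of_mul_le_mul_right _ hN
      rw [← h5]; linarith
    calc (#Z : ℝ) * (α ^ 2 / (B * M) * N) ≤ B * M / α * (α ^ 2 / (B * M) * N) := by gcongr
      _ = α * N := by field_simp
      _ ≤ _ := hS
  obtain ⟨h, hh, hcount⟩ := Finset.exists_le_card_fiber_of_nsmul_le_card_of_maps_to (s := S) (t := Z)
    (f := fun s => (s.2 - s0.2) - L (s.1 - s0.1)) (b := α ^ 2 / (B * M) * N) (by
      intro s hs
      rw [hZ, mem_filter]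
      refine ⟨mem_univ _, ?_⟩
      have h0 := hSH s hs s0 hs0
      have h1 : s.1 - s0.1 ∈ D := ⟨s - s0, h0, rfl⟩
      have := H'.sub_mem h0 (hLD _ h1)
      have e : (s - s0) - (s.1 - s0.1, L (s.1 - s0.1)) = (0, (s.2 - s0.2) - L (s.1 - s0.1)) := by
        ext <;> simp
      rwa [e] at this) ⟨0, hZ0⟩ (by rw [nsmul_eq_mul]; exact hZc)
  refine ⟨L, s0.2 - L s0.1 + h, hcount.trans ?_⟩
  norm_cast
  apply card_le_card
  intro s hs
  rw [mem_filter] at hs ⊢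
  refine ⟨hs.1, ?_⟩
  rw [← hs.2, map_sub]; abel

open Finset Pointwise in
lemma inv_thm {p : ℕ} [Fact p.Prime] {G : Type*} [DecidableEq G] [AddCommGroup G] [Fintype G]
    [Module (ZMod p) G] (S : Finset (G × G)) (R : ℝ) (a : ℕ) (hR : 2 ≤ R)
    (hfib : ∀ x, (#{s ∈ S | s.1 = x} : ℝ) ≤ R)
    (hE : (Fintype.card G : ℝ) ^ 3 / R ^ a ≤ ∑ d : G × G, (#{q ∈ S ×ˢ S | q.1 - q.2 = d} : ℝ) ^ 2) :
    ∃ (L : G →ₗ[ZMod p] G) (b : G),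
      1 / (R ^ (11 * a + 60) * (p : ℝ) ^ (R ^ (50 * a + 270))) * (Fintype.card G : ℝ) ≤
        #{s ∈ S | s.2 = L s.1 + b} := by
  classical
  have hR0 : 0 < R := by linarith
  have hp : 1 < (p : ℝ) := by exact_mod_cast (Fact.out : p.Prime).one_lt
  set N : ℝ := (Fintype.card G : ℝ) with hN
  have hN0 : 0 < N := by rw [hN]; exact_mod_cast Fintype.card_pos
  have hS : (#S : ℝ) ≤ R * N := by
    rw [Finset.card_eq_sum_card_fiberwise (s := S) (t := univ) (f := Prod.fst) (fun _ _ => by simp)]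
    push_cast
    calc _ ≤ ∑ x : G, R := Finset.sum_le_sum fun x _ => hfib x
      _ = _ := by simp [hN, mul_comm]
  obtain ⟨S', hS'S, h1, h2⟩ := bsg S N R a hN0 hR hS hE
  have hS'0 : (0 : ℝ) < #S' := lt_of_lt_of_le (by positivity) h1
  have hne : S'.Nonempty := by
    rw [← Finset.card_pos]; exact_mod_cast hS'0
  have hK : (#(S' - S') : ℝ) ≤ R ^ (10 * a + 54) * #S' := by
    refine h2.trans ?_
    calc R ^ (9 * a + 49) * N = R ^ (10 * a + 54) * (N / R ^ (a + 5)) := by field_simp; ring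
      _ ≤ _ := by gcongr
  obtain ⟨H', k, hk, hH1, hH2⟩ := freiman (p := p) S' hne _ hK
  have hpk : (p : ℝ) ^ k ≤ (p : ℝ) ^ (R ^ (50 * a + 270)) := by
    rw [← Real.rpow_natCast]
    apply Real.rpow_le_rpow_of_exponent_le hp.le
    refine hk.trans (le_of_eq ?_)
    rw [← pow_mul]; congr 1; ring
  obtain ⟨L, b, hLb⟩ := inv_aux S' H' R (1 / R ^ (a + 5))
    ((p : ℝ) ^ (R ^ (50 * a + 270)) * R ^ (9 * a + 49)) N hR0 (by positivity) (by positivity) hN0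
    (by
      intro x
      refine le_trans ?_ (hfib x)
      norm_cast
      exact card_le_card (filter_subset_filter _ hS'S))
    (by rw [one_div_mul_eq_div]; exact h1)
    (by
      refine hH2.trans ?_
      rw [mul_assoc]
      gcongr) hH1
  refine ⟨L, b, ?_⟩
  have hle : (#{s ∈ S' | s.2 = L s.1 + b} : ℝ) ≤ #{s ∈ S | s.2 = L s.1 + b} := by
    norm_cast
    exact card_le_card (filter_subset_filter _ hS'S)
  refine le_trans (le_of_eq ?_) (hLb.trans hle)
  congr 1
  field_simp
  ring


noncomputable def cor {H : Type*} [AddCommGroup H] [Fintype H] (f g : H → ℝ) (t : H) : ℝ :=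
  ∑ b, f (t + b) * g b

noncomputable def rep4 {H : Type*} [AddCommGroup H] [Fintype H] (f1 f2 f3 f4 : H → ℝ) (s : H) : ℝ :=
  ∑ s1, ∑ s2, ∑ s3, f1 s1 * f2 s2 * f3 s3 * f4 (s1 + s2 - s3 - s)

lemma sum_shift {H : Type*} [AddCommGroup H] [Fintype H] (F : H → ℝ) (s : H) :
    ∑ t, F (t - s) = ∑ t, F t := Equiv.sum_comp (Equiv.subRight s) F

lemma rep4_eq_cor {H : Type*} [AddCommGroup H] [Fintype H] (f1 f2 f3 f4 : H → ℝ) (s : H) :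
    rep4 f1 f2 f3 f4 s = ∑ t, cor f1 f3 t * cor f4 f2 (t - s) := by
  unfold rep4 cor
  calc _ = ∑ s3, ∑ s2, ∑ s1, f1 s1 * f2 s2 * f3 s3 * f4 (s1 + s2 - s3 - s) := by
        rw [Finset.sum_comm_cycle]
        apply Finset.sum_congr rfl; intro s3 _
        rw [Finset.sum_comm]
    _ = ∑ s3, ∑ s2, ∑ t, f1 (t + s3) * f2 s2 * f3 s3 * f4 (t - s + s2) := by
        apply Finset.sum_congr rfl; intro s3 _
        apply Finset.sum_congr rfl; intro s2 _
        rw [← Equiv.sum_comp (Equiv.addRight s3)]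
        apply Finset.sum_congr rfl; intro t _
        simp only [Equiv.coe_addRight]
        congr 2; abel
    _ = ∑ t, ∑ s3, ∑ s2, f1 (t + s3) * f2 s2 * f3 s3 * f4 (t - s + s2) := by
        rw [Finset.sum_comm_cycle]
    _ = _ := by
        apply Finset.sum_congr rfl; intro t _
        rw [Finset.sum_mul_sum]
        apply Finset.sum_congr rfl; intro s3 _
        apply Finset.sum_congr rfl; intro s2 _
        ring

lemma sum_cor {H : Type*} [AddCommGroup H] [Fintype H] (f g : H → ℝ) :
    ∑ t, cor f g t = (∑ t, f t) * ∑ t, g t := by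
  unfold cor
  rw [Finset.sum_comm, Finset.sum_mul_sum, Finset.sum_comm]
  rw [Finset.sum_comm]
  rw [Finset.sum_comm (s := Finset.univ) (t := Finset.univ) (f := fun i j => f i * g j)]
  apply Finset.sum_congr rfl; intro b _
  exact Equiv.sum_comp (Equiv.addRight b) (fun t => f t * g b)

lemma cor_one_left {H : Type*} [AddCommGroup H] [Fintype H] (c : ℝ) (g : H → ℝ) (t : H) :
    cor (fun _ => c) g t = c * ∑ t, g t := by
  unfold cor
  rw [Finset.mul_sum]

lemma cor_one_right {H : Type*} [AddCommGroup H] [Fintype H] (c : ℝ) (f : H → ℝ) (t : H) :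
    cor f (fun _ => c) t = c * ∑ t, f t := by
  unfold cor
  rw [Finset.mul_sum, ← Equiv.sum_comp (Equiv.addLeft t) (fun b => c * f b)]
  apply Finset.sum_congr rfl; intro b _
  simp [mul_comm]

lemma rep4_const1 {H : Type*} [AddCommGroup H] [Fintype H] (c : ℝ) (f : H → ℝ) (s : H) :
    rep4 (fun _ => c) f f f s = c * (∑ t, f t) ^ 3 := by
  rw [rep4_eq_cor]
  simp only [cor_one_left]
  rw [← Finset.mul_sum, sum_shift (fun t => cor f f t), sum_cor]; ring

lemma rep4_const2 {H : Type*} [AddCommGroup H] [Fintype H] (c : ℝ) (f : H → ℝ) (s : H) :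
    rep4 f (fun _ => c) f f s = c * (∑ t, f t) ^ 3 := by
  rw [rep4_eq_cor]
  simp only [cor_one_right]
  rw [← Finset.sum_mul, sum_cor]; ring

lemma rep4_const3 {H : Type*} [AddCommGroup H] [Fintype H] (c : ℝ) (f : H → ℝ) (s : H) :
    rep4 f f (fun _ => c) f s = c * (∑ t, f t) ^ 3 := by
  rw [rep4_eq_cor]
  simp only [cor_one_right]
  rw [← Finset.mul_sum, sum_shift (fun t => cor f f t), sum_cor]; ring

lemma rep4_const4 {H : Type*} [AddCommGroup H] [Fintype H] (c : ℝ) (f : H → ℝ) (s : H) :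
    rep4 f f f (fun _ => c) s = c * (∑ t, f t) ^ 3 := by
  rw [rep4_eq_cor]
  simp only [cor_one_left]
  rw [← Finset.sum_mul, sum_cor]; ring

lemma sum_cor_sq {H : Type*} [AddCommGroup H] [Fintype H] (f g : H → ℝ) :
    ∑ t, cor f g t ^ 2 = ∑ t, cor f f t * cor g g t := by
  unfold cor
  calc _ = ∑ t, ∑ b, ∑ u, (f (t + b) * g b) * (f (t + (u + b)) * g (u + b)) := by
        apply Finset.sum_congr rfl; intro t _
        rw [sq, Finset.sum_mul_sum]
        apply Finset.sum_congr rfl; intro b _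
        rw [← Equiv.sum_comp (Equiv.addRight b)]
        rfl
    _ = ∑ u, ∑ b, ∑ t, (f (t + b) * g b) * (f (t + (u + b)) * g (u + b)) := by
        rw [Finset.sum_comm_cycle]
        apply Finset.sum_congr rfl; intro u _
        rw [Finset.sum_comm]
    _ = ∑ u, ∑ b, ∑ a, (f a * g b) * (f (u + a) * g (u + b)) := by
        apply Finset.sum_congr rfl; intro u _
        apply Finset.sum_congr rfl; intro b _
        rw [← Equiv.sum_comp (Equiv.addRight b) (fun a => (f a * g b) * (f (u + a) * g (u + b)))]
        apply Finset.sum_congr rfl; intro t _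
        simp only [Equiv.coe_addRight]
        rw [show t + (u + b) = u + (t + b) by abel]
    _ = _ := by
        apply Finset.sum_congr rfl; intro u _
        rw [Finset.sum_mul_sum, Finset.sum_comm]
        apply Finset.sum_congr rfl; intro b _
        apply Finset.sum_congr rfl; intro a _
        ring

lemma rep4_pow_four {H : Type*} [AddCommGroup H] [Fintype H] (f1 f2 f3 f4 : H → ℝ) (s : H) :
    rep4 f1 f2 f3 f4 s ^ 4 ≤ (∑ t, cor f1 f1 t ^ 2) * (∑ t, cor f2 f2 t ^ 2) *
      (∑ t, cor f3 f3 t ^ 2) * (∑ t, cor f4 f4 t ^ 2) := by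
  have h1 : rep4 f1 f2 f3 f4 s ^ 2 ≤ (∑ t, cor f1 f3 t ^ 2) * ∑ t, cor f4 f2 t ^ 2 := by
    rw [rep4_eq_cor]
    refine (Finset.sum_mul_sq_le_sq_mul_sq _ _ _).trans (le_of_eq ?_)
    rw [sum_shift (fun t => cor f4 f2 t ^ 2)]
  have h2 : ∀ f g : H → ℝ, (∑ t, cor f g t ^ 2) ^ 2 ≤ (∑ t, cor f f t ^ 2) * ∑ t, cor g g t ^ 2 := by
    intro f g
    rw [sum_cor_sq]
    exact Finset.sum_mul_sq_le_sq_mul_sq _ _ _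
  have h0 : ∀ f g : H → ℝ, 0 ≤ ∑ t, cor f g t ^ 2 :=
    fun f g => Finset.sum_nonneg fun _ _ => sq_nonneg _
  calc rep4 f1 f2 f3 f4 s ^ 4 = (rep4 f1 f2 f3 f4 s ^ 2) ^ 2 := by ring
    _ ≤ ((∑ t, cor f1 f3 t ^ 2) * ∑ t, cor f4 f2 t ^ 2) ^ 2 := by gcongr
    _ = (∑ t, cor f1 f3 t ^ 2) ^ 2 * (∑ t, cor f4 f2 t ^ 2) ^ 2 := by ring
    _ ≤ ((∑ t, cor f1 f1 t ^ 2) * ∑ t, cor f3 f3 t ^ 2) *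
      ((∑ t, cor f4 f4 t ^ 2) * ∑ t, cor f2 f2 t ^ 2) :=
        mul_le_mul (h2 _ _) (h2 _ _) (sq_nonneg _) (mul_nonneg (h0 _ _) (h0 _ _))
    _ = _ := by ring

lemma rep4_telescope {H : Type*} [AddCommGroup H] [Fintype H] (f g h : H → ℝ) (hf : ∀ x, f x = g x + h x)
    (s : H) : rep4 f f f f s = rep4 g g g g s + rep4 h f f f s + rep4 g h f f s +
      rep4 g g h f s + rep4 g g g h s := by
  unfold rep4
  simp only [← Finset.sum_add_distrib]
  apply Finset.sum_congr rfl; intro s1 _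
  apply Finset.sum_congr rfl; intro s2 _
  apply Finset.sum_congr rfl; intro s3 _
  simp only [hf]; ring

lemma rep4_mono {H : Type*} [AddCommGroup H] [Fintype H] {f1 f2 f3 f4 g1 g2 g3 g4 : H → ℝ}
    (h1 : ∀ x, 0 ≤ f1 x) (h2 : ∀ x, 0 ≤ f2 x) (h3 : ∀ x, 0 ≤ f3 x) (h4 : ∀ x, 0 ≤ f4 x)
    (k1 : ∀ x, f1 x ≤ g1 x) (k2 : ∀ x, f2 x ≤ g2 x) (k3 : ∀ x, f3 x ≤ g3 x) (k4 : ∀ x, f4 x ≤ g4 x)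
    (s : H) : rep4 f1 f2 f3 f4 s ≤ rep4 g1 g2 g3 g4 s := by
  unfold rep4
  apply Finset.sum_le_sum; intro s1 _
  apply Finset.sum_le_sum; intro s2 _
  apply Finset.sum_le_sum; intro s3 _
  have a1 := (h1 s1).trans (k1 s1)
  have a2 := (h2 s2).trans (k2 s2)
  have a3 := (h3 s3).trans (k3 s3)
  refine mul_le_mul (mul_le_mul (mul_le_mul (k1 _) (k2 _) (h2 _) a1) (k3 _) (h3 _) (by positivity))
    (k4 _) (h4 _) (by positivity)

/-- indicator function -/
noncomputable def ind {H : Type*} [DecidableEq H] (S : Finset H) (x : H) : ℝ := if x ∈ S then 1 else 0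

open Finset in
lemma cor_ind {H : Type*} [DecidableEq H] [AddCommGroup H] [Fintype H] (S : Finset H) (d : H) :
    cor (ind S) (ind S) d = #{q ∈ S ×ˢ S | q.1 - q.2 = d} := by
  unfold cor ind
  have : ∀ b, ((if d + b ∈ S then (1:ℝ) else 0) * if b ∈ S then 1 else 0) =
      if (d + b ∈ S ∧ b ∈ S) then 1 else 0 := by
    intro b; split_ifs <;> simp_all
  simp only [this]
  rw [Finset.sum_boole]
  congr 1
  apply Finset.card_bij (fun b _ => (d + b, b))
  · intro b hb; simpa using hb
  · intro a _ b _ h; simpa using h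
  · rintro ⟨x, y⟩ hq
    simp only [mem_filter, mem_product] at hq
    obtain ⟨⟨hx, hy⟩, rfl⟩ := hq
    exact ⟨y, by simp [hx, hy], by simp⟩

open Finset in
lemma energy_le {H : Type*} [DecidableEq H] [AddCommGroup H] [Fintype H] (S : Finset H) :
    ∑ t, cor (ind S) (ind S) t ^ 2 ≤ (#S : ℝ) ^ 3 := by
  have h0 : ∀ t, 0 ≤ ind S t := fun t => by unfold ind; split_ifs <;> simp
  have h1 : ∀ t, ind S t ≤ 1 := fun t => by unfold ind; split_ifs <;> simp
  have hs : ∑ t, ind S t = #S := by unfold ind; simp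
  have hc0 : ∀ t, 0 ≤ cor (ind S) (ind S) t :=
    fun t => Finset.sum_nonneg fun b _ => mul_nonneg (h0 _) (h0 _)
  have hc : ∀ t, cor (ind S) (ind S) t ≤ #S := by
    intro t
    rw [← hs]
    apply Finset.sum_le_sum
    intro b _
    exact mul_le_of_le_one_left (h0 _) (h1 _)
  calc _ ≤ ∑ t, (#S : ℝ) * cor (ind S) (ind S) t := by
        apply Finset.sum_le_sum; intro t _
        rw [sq]; exact mul_le_mul_of_nonneg_right (hc t) (hc0 t)
    _ = _ := by rw [← Finset.mul_sum, sum_cor, hs]; ring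

open Finset in
lemma rep4_ind {H : Type*} [DecidableEq H] [AddCommGroup H] [Fintype H] (S : Finset H) (s : H) :
    rep4 (ind S) (ind S) (ind S) (ind S) s =
      #{q ∈ S ×ˢ S ×ˢ S | q.1 + q.2.1 - q.2.2 - s ∈ S} := by
  unfold rep4 ind
  rw [Finset.card_filter]
  push_cast
  rw [Finset.sum_product]
  simp only [Finset.sum_product]
  rw [← Finset.sum_filter_add_sum_filter_not univ (fun x => x ∈ S)]
  have hz : ∀ (F : H → H → H → ℝ), ∑ s1 with s1 ∉ S, ∑ s2, ∑ s3,
     (if s1 ∈ S then (1:ℝ) else 0) * (if s2 ∈ S then 1 else 0) * (if s3 ∈ S then 1 else 0) *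
      (if s1 + s2 - s3 - s ∈ S then 1 else 0) = 0 := by
    intro F
    apply Finset.sum_eq_zero
    intro x hx
    simp [(mem_filter.1 hx).2]
  rw [hz (fun _ _ _ => 0), add_zero]
  have hf : (univ.filter (fun x => x ∈ S)) = S := by ext; simp
  rw [hf]
  apply Finset.sum_congr rfl; intro s1 h1
  simp only [h1, if_true, one_mul]
  simp only [ite_mul, mul_ite, one_mul, zero_mul, mul_one, mul_zero]
  rw [← hf, Finset.sum_filter]
  apply Finset.sum_congr rfl; intro s2 _
  simp only [hf]
  split_ifs with h2
  · rw [← hf, Finset.sum_filter]; simp only [hf]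
    apply Finset.sum_congr rfl; intro s3 _
    by_cases h3 : s3 ∈ S <;> simp [h3]
  · simp


lemma ind_nonneg {H : Type*} [DecidableEq H] (S : Finset H) (x : H) : 0 ≤ ind S x := by
  unfold ind; split_ifs <;> simp

set_option maxHeartbeats 400000 in
open Finset in
lemma key_sets {p : ℕ} [Fact p.Prime] {G : Type*} [DecidableEq G] [AddCommGroup G] [Fintype G]
    [Module (ZMod p) G] (S : Finset (G × G)) (R κ : ℝ) (hR : 2 ≤ R)
    (hκ : κ = 1 / (R ^ (203) * (p : ℝ) ^ (R ^ (920))))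
    (hfib : ∀ x, (#{s ∈ S | s.1 = x} : ℝ) ≤ R) :
    ∃ Φ : Finset ((G →ₗ[ZMod p] G) × G), (#Φ : ℝ) ≤ 2 * R / κ ∧
      ∀ s : G × G, 8 * (Fintype.card G : ℝ) ^ 3 / R ≤ rep4 (ind S) (ind S) (ind S) (ind S) s →
        ∃ f1 ∈ Φ, ∃ f2 ∈ Φ, ∃ f3 ∈ Φ, ∃ f4 ∈ Φ, 
          4 * (Fintype.card G : ℝ) ^ 3 / R ≤ (#Φ : ℝ) ^ 4 *
            #{x : G × G × G | (f1.1 x.1 + f1.2) + (f2.1 x.2.1 + f2.2) - (f3.1 x.2.2 + f3.2) -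
              (f4.1 (x.1 + x.2.1 - x.2.2 - s.1) + f4.2) = s.2} := by
  classical
  have hR0 : 0 < R := by linarith
  have hp : 0 < (p : ℝ) := by exact_mod_cast (Fact.out : p.Prime).pos
  set N : ℝ := (Fintype.card G : ℝ) with hN
  have hN0 : 0 < N := by rw [hN]; exact_mod_cast Fintype.card_pos
  have hκ0 : 0 < κ := by rw [hκ]; positivity
  have hS : (#S : ℝ) ≤ R * N := by
    rw [Finset.card_eq_sum_card_fiberwise (s := S) (t := univ) (f := Prod.fst) (fun _ _ => by simp)]
    push_cast
    calc _ ≤ ∑ x : G, R := Finset.sum_le_sum fun x _ => hfib x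
      _ = _ := by simp [hN, mul_comm]
  haveI : Finite (G →ₗ[ZMod p] G) := DFunLike.finite _
  set cap : Finset ((G →ₗ[ZMod p] G) × G) → Finset (G × G) :=
    fun Φ => {s ∈ S | ∃ f ∈ Φ, s.2 = f.1 s.1 + f.2} with hcap
  obtain ⟨Φ, hΦ⟩ := Finite.exists_max (fun Φ : Finset ((G →ₗ[ZMod p] G) × G) =>
    (#(cap Φ) : ℝ) - κ / 2 * N * #Φ)
  set S1 := cap Φ with hS1
  set S2 := S \ S1 with hS2
  have hS1S : S1 ⊆ S := filter_subset _ _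
  have hS2S : S2 ⊆ S := sdiff_subset
  have hΦc : (#Φ : ℝ) ≤ 2 * R / κ := by
    have h1 := hΦ ∅
    have h2 : (#S1 : ℝ) ≤ #S := by exact_mod_cast card_le_card hS1S
    have h3 : (0:ℝ) ≤ #(cap ∅) := by positivity
    rw [card_empty] at h1
    rw [le_div_iff₀ hκ0]
    apply le_of_mul_le_mul_right _ hN0
    push_cast at h1
    nlinarith
  have hE : ∑ t, cor (ind S2) (ind S2) t ^ 2 < N ^ 3 / R ^ 13 := by
    by_contra! hcon
    simp only [cor_ind] at hcon
    obtain ⟨L, b, hLb⟩ := inv_thm (p := p) S2 R 13 hR (by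
      intro x
      refine le_trans ?_ (hfib x)
      norm_cast
      exact card_le_card (filter_subset_filter _ hS2S)) hcon
    norm_num only at hLb
    rw [← hκ] at hLb
    have h1 := hΦ (insert (L, b) Φ)
    have h2 : (#(insert (L, b) Φ) : ℝ) ≤ #Φ + 1 := by exact_mod_cast card_insert_le _ _
    have h3 : (#S1 : ℝ) + #{s ∈ S2 | s.2 = L s.1 + b} ≤ #(cap (insert (L, b) Φ)) := by
      norm_cast
      rw [← card_union_of_disjoint]
      · apply card_le_card
        intro s hs
        simp only [hcap, mem_filter, mem_union, mem_insert, hS2, hS1, mem_sdiff] at hs ⊢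
        rcases hs with ⟨hs, f, hf, h⟩ | ⟨⟨hs, _⟩, h⟩
        · exact ⟨hs, f, Or.inr hf, h⟩
        · exact ⟨hs, (L, b), Or.inl rfl, h⟩
      · refine Disjoint.mono_right (filter_subset _ _) ?_
        exact disjoint_sdiff
    have h4 : 0 < κ * N := by positivity
    have h5 : κ / 2 * N * (#(insert (L, b) Φ) : ℝ) ≤ κ / 2 * N * (#Φ + 1) := by gcongr
    nlinarith
  have hsplit : ∀ x, ind S x = ind S1 x + ind S2 x := by
    intro x
    unfold ind
    by_cases h1 : x ∈ S1
    · simp [hS2, h1, hS1S h1]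
    · by_cases h2 : x ∈ S <;> simp [hS2, h1, h2]
  have hES : ∑ t, cor (ind S) (ind S) t ^ 2 ≤ (R * N) ^ 3 :=
    (energy_le S).trans (by gcongr)
  have hES1 : ∑ t, cor (ind S1) (ind S1) t ^ 2 ≤ (R * N) ^ 3 :=
    (energy_le S1).trans (by
      have : (#S1 : ℝ) ≤ #S := by exact_mod_cast card_le_card hS1S
      gcongr; linarith)
  have hroot : ∀ X : ℝ, X ^ 4 ≤ N ^ 3 / R ^ 13 * (R * N) ^ 3 * (R * N) ^ 3 * (R * N) ^ 3 →
      X ≤ N ^ 3 / R := by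
    intro X hX
    apply le_of_pow_le_pow_left₀ (n := 4) (by norm_num) (by positivity)
    refine hX.trans (le_of_eq ?_)
    field_simp
  have h0 : ∀ f : G × G → ℝ, 0 ≤ ∑ t, cor f f t ^ 2 :=
    fun f => Finset.sum_nonneg fun _ _ => sq_nonneg _
  refine ⟨Φ, hΦc, fun s hs => ?_⟩
  have hrep : 4 * N ^ 3 / R ≤ rep4 (ind S1) (ind S1) (ind S1) (ind S1) s := by
    rw [rep4_telescope _ _ _ hsplit] at hs
    have t1 : rep4 (ind S2) (ind S) (ind S) (ind S) s ≤ N ^ 3 / R := by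
      apply hroot
      refine (rep4_pow_four _ _ _ _ _).trans ?_
      gcongr <;> first | exact h0 _ | exact hE.le | exact hES | exact hES1
    have t2 : rep4 (ind S1) (ind S2) (ind S) (ind S) s ≤ N ^ 3 / R := by
      apply hroot
      refine (rep4_pow_four _ _ _ _ _).trans ?_
      rw [mul_comm (∑ t, cor (ind S1) (ind S1) t ^ 2)]
      gcongr <;> first | exact h0 _ | exact hE.le | exact hES | exact hES1
    have t3 : rep4 (ind S1) (ind S1) (ind S2) (ind S) s ≤ N ^ 3 / R := by
      apply hroot
      refine (rep4_pow_four _ _ _ _ _).trans ?_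
      rw [mul_comm _ (∑ t, cor (ind S2) (ind S2) t ^ 2), ← mul_assoc]
      gcongr <;> first | exact h0 _ | exact hE.le | exact hES | exact hES1
    have t4 : rep4 (ind S1) (ind S1) (ind S1) (ind S2) s ≤ N ^ 3 / R := by
      apply hroot
      refine (rep4_pow_four _ _ _ _ _).trans ?_
      rw [mul_comm _ (∑ t, cor (ind S2) (ind S2) t ^ 2), ← mul_assoc, ← mul_assoc]
      gcongr <;> first | exact h0 _ | exact hE.le | exact hES | exact hES1
    have e8 : 8 * N ^ 3 / R = 8 * (N ^ 3 / R) := by ring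
    have e4 : 4 * N ^ 3 / R = 4 * (N ^ 3 / R) := by ring
    rw [e8] at hs
    rw [e4]
    linarith
  rw [rep4_ind] at hrep
  by_contra! hcon
  set X : ((G →ₗ[ZMod p] G) × G) × ((G →ₗ[ZMod p] G) × G) × ((G →ₗ[ZMod p] G) × G) ×
    ((G →ₗ[ZMod p] G) × G) → Finset (G × G × G) := fun f =>
      {x : G × G × G | (f.1.1 x.1 + f.1.2) + (f.2.1.1 x.2.1 + f.2.1.2) - (f.2.2.1.1 x.2.2 + f.2.2.1.2) -
              (f.2.2.2.1 (x.1 + x.2.1 - x.2.2 - s.1) + f.2.2.2.2) = s.2} with hX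
  have hcov : {q ∈ S1 ×ˢ S1 ×ˢ S1 | q.1 + q.2.1 - q.2.2 - s ∈ S1} ⊆
      (Φ ×ˢ Φ ×ˢ Φ ×ˢ Φ).biUnion (fun f => (X f).image (fun x =>
        ((x.1, f.1.1 x.1 + f.1.2), (x.2.1, f.2.1.1 x.2.1 + f.2.1.2),
          (x.2.2, f.2.2.1.1 x.2.2 + f.2.2.1.2)))) := by
    rintro ⟨⟨x1, k1⟩, ⟨x2, k2⟩, ⟨x3, k3⟩⟩ hq
    simp only [hS1, hcap, mem_filter, mem_product] at hq
    obtain ⟨⟨⟨-, f1, hf1, e1⟩, ⟨-, f2, hf2, e2⟩, ⟨-, f3, hf3, e3⟩⟩, -, f4, hf4, e4⟩ := hq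
    simp only [Prod.fst_sub, Prod.fst_add, Prod.snd_sub, Prod.snd_add] at e4
    simp only [mem_biUnion, mem_image, mem_product]
    refine ⟨(f1, f2, f3, f4), ⟨hf1, hf2, hf3, hf4⟩, (x1, x2, x3), ?_, ?_⟩
    · simp only [hX, mem_filter, mem_univ, true_and]
      rw [← e4, ← e1, ← e2, ← e3]; abel
    · simp [e1, e2, e3]
  have hle : (#{q ∈ S1 ×ˢ S1 ×ˢ S1 | q.1 + q.2.1 - q.2.2 - s ∈ S1} : ℝ) ≤
      ∑ f ∈ Φ ×ˢ Φ ×ˢ Φ ×ˢ Φ, (#(X f) : ℝ) := by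
    rw [← Nat.cast_sum]
    norm_cast
    exact (card_le_card hcov).trans (card_biUnion_le.trans (Finset.sum_le_sum fun f _ => card_image_le))
  have hpos : 0 < 4 * N ^ 3 / R := by positivity
  rcases Φ.eq_empty_or_nonempty with h | h
  · rw [h] at hle
    simp only [empty_product, sum_empty] at hle
    linarith
  · have hc0 : (0:ℝ) < #Φ := by exact_mod_cast h.card_pos
    have : ∑ f ∈ Φ ×ˢ Φ ×ˢ Φ ×ˢ Φ, (#(X f) : ℝ) < ∑ f ∈ Φ ×ˢ Φ ×ˢ Φ ×ˢ Φ, (4 * N ^ 3 / R) / (#Φ : ℝ) ^ 4 := by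
      apply Finset.sum_lt_sum_of_nonempty
      · exact h.product (h.product (h.product h))
      · rintro ⟨f1, f2, f3, f4⟩ hf
        simp only [mem_product] at hf
        rw [lt_div_iff₀ (by positivity), mul_comm]
        exact hcon f1 hf.1 f2 hf.2.1 f3 hf.2.2.1 f4 hf.2.2.2
    rw [sum_const, nsmul_eq_mul] at this
    simp only [card_product] at this
    push_cast at this
    have e : (#Φ : ℝ) * (#Φ * (#Φ * #Φ)) * (4 * N ^ 3 / R / (#Φ : ℝ) ^ 4) = 4 * N ^ 3 / R := by
      field_simp
    rw [e] at this
    linarith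


open Finset in
lemma fiber_mul_range {A B : Type*} [AddCommGroup A] [AddCommGroup B] [Fintype A] [DecidableEq B]
    (T : A →+ B) (t : B) : #{x : A | T x = t} * #(univ.image T) ≤ Fintype.card A := by
  classical
  rw [← Finset.card_univ (α := A), Finset.card_eq_sum_card_image T univ, mul_comm]
  rw [← smul_eq_mul]
  apply Finset.card_nsmul_le_sum
  intro b hb
  obtain ⟨z, -, rfl⟩ := mem_image.1 hb
  rcases Finset.eq_empty_or_nonempty {x : A | T x = t} with h | ⟨x0, h0⟩
  · rw [h]; simp
  · simp only [mem_filter, mem_univ, true_and] at h0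
    apply Finset.card_le_card_of_injOn (fun x => x - x0 + z)
    · intro x hx
      simp at hx
      simp [hx, h0]
    · intro x _ y _ h
      simpa using h

set_option maxHeartbeats 400000 in
open Finset in
lemma key_fun {p : ℕ} [Fact p.Prime] {G : Type*} [DecidableEq G] [AddCommGroup G] [Fintype G]
    [Module (ZMod p) G] (g : G × G → ℝ) (θ R κ : ℝ) (hθ : 0 < θ) (hθ1 : θ ≤ 1) (hRθ : R = 16 / θ)
    (hκ : κ = 1 / (R ^ (203) * (p : ℝ) ^ (R ^ (920))))
    (hg0 : ∀ s, 0 ≤ g s) (hg1 : ∀ s, g s ≤ 1) (hgs : ∀ x, ∑ k, g (x, k) ≤ 1) :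
    ∃ (J : Finset (G →ₗ[ZMod p] G)) (K : Submodule (ZMod p) G), (#J : ℝ) ≤ 2 * R / κ ∧
      (Module.finrank (ZMod p) K : ℝ) ≤ (2 * R / κ) ^ 4 * (R * (2 * R / κ) ^ 4 / 4 + 1) ∧
      ∀ x k, θ * (Fintype.card G : ℝ) ^ 3 ≤ rep4 g g g g (x, k) → ∃ L ∈ J, k - L x ∈ K := by
  classical
  set N : ℝ := (Fintype.card G : ℝ) with hN
  have hN0 : 0 < N := by rw [hN]; exact_mod_cast Fintype.card_pos
  have hR : 2 ≤ R := by rw [hRθ, le_div_iff₀ hθ]; linarith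
  have hR0 : 0 < R := by linarith
  have hp : 0 < (p : ℝ) := by exact_mod_cast (Fact.out : p.Prime).pos
  have hκ0 : 0 < κ := by rw [hκ]; positivity
  have hθR : θ * R = 16 := by rw [hRθ]; field_simp
  set S : Finset (G × G) := {s | θ / 8 ≤ g s} with hS
  have hfib : ∀ x, (#{s ∈ S | s.1 = x} : ℝ) ≤ R := by
    intro x
    have h1 : #{s ∈ S | s.1 = x} ≤ #{k : G | θ / 8 ≤ g (x, k)} := by
      apply Finset.card_le_card_of_injOn Prod.snd
      · rintro ⟨a, b⟩ h
        simp [hS] at h ⊢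
        rw [← h.2]; exact h.1
      · rintro ⟨a, b⟩ h ⟨a', b'⟩ h' e
        simp [hS] at h h' e ⊢
        exact ⟨h.2.trans h'.2.symm, e⟩
    have h2 : (#{k : G | θ / 8 ≤ g (x, k)} : ℝ) * (θ / 8) ≤ 1 := by
      refine le_trans ?_ (hgs x)
      rw [← nsmul_eq_mul]
      refine (Finset.card_nsmul_le_sum _ (fun k => g (x, k)) _ (fun k hk => (mem_filter.1 hk).2)).trans ?_
      exact Finset.sum_le_sum_of_subset_of_nonneg (filter_subset _ _) fun _ _ _ => hg0 _
    have h3 : (#{s ∈ S | s.1 = x} : ℝ) ≤ #{k : G | θ / 8 ≤ g (x, k)} := by exact_mod_cast h1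
    refine h3.trans ?_
    rw [hRθ, le_div_iff₀ hθ]; linarith
  obtain ⟨Φ, hΦ, hmain⟩ := key_sets (p := p) S R κ hR hκ hfib
  set m : ℝ := 2 * R / κ with hm
  have hm0 : 0 < m := by positivity
  let T : ((G →ₗ[ZMod p] G) × G) × ((G →ₗ[ZMod p] G) × G) × ((G →ₗ[ZMod p] G) × G) ×
    ((G →ₗ[ZMod p] G) × G) → (G × G × G →+ G) := fun f =>
      AddMonoidHom.mk' (fun x => (f.1.1 x.1 - f.2.2.2.1 x.1) + (f.2.1.1 x.2.1 - f.2.2.2.1 x.2.1)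
        - (f.2.2.1.1 x.2.2 - f.2.2.2.1 x.2.2)) (by intro a b; simp; abel)
  have hT : ∀ f x, T f x = (f.1.1 x.1 - f.2.2.2.1 x.1) + (f.2.1.1 x.2.1 - f.2.2.2.1 x.2.1)
        - (f.2.2.1.1 x.2.2 - f.2.2.2.1 x.2.2) := fun f x => rfl
  let E : Finset G := {f ∈ Φ ×ˢ Φ ×ˢ Φ ×ˢ Φ | (#(univ.image (T f)) : ℝ) ≤ R * m ^ 4 / 4}.biUnion
    (fun f => insert (f.1.2 + f.2.1.2 - f.2.2.1.2 - f.2.2.2.2) (univ.image (T f)))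
  have hE : (#E : ℝ) ≤ m ^ 4 * (R * m ^ 4 / 4 + 1) := by
    have h1 : (#E : ℝ) ≤ ∑ f ∈ {f ∈ Φ ×ˢ Φ ×ˢ Φ ×ˢ Φ | (#(univ.image (T f)) : ℝ) ≤ R * m ^ 4 / 4},
        (R * m ^ 4 / 4 + 1) := by
      refine le_trans (Nat.cast_le.2 card_biUnion_le) ?_
      push_cast
      apply Finset.sum_le_sum
      intro f hf
      have h2 : (#(insert (f.1.2 + f.2.1.2 - f.2.2.1.2 - f.2.2.2.2) (univ.image (T f))) : ℝ) ≤
        #(univ.image (T f)) + 1 := by exact_mod_cast card_insert_le _ _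
      linarith [(mem_filter.1 hf).2]
    refine h1.trans ?_
    rw [sum_const, nsmul_eq_mul]
    have h3 : (#{f ∈ Φ ×ˢ Φ ×ˢ Φ ×ˢ Φ | (#(univ.image (T f)) : ℝ) ≤ R * m ^ 4 / 4} : ℝ) ≤ (#Φ : ℝ) ^ 4 := by
      have := card_filter_le (Φ ×ˢ Φ ×ˢ Φ ×ˢ Φ) (fun f => (#(univ.image (T f)) : ℝ) ≤ R * m ^ 4 / 4)
      simp only [card_product] at this
      have h4 : #Φ * (#Φ * (#Φ * #Φ)) = #Φ ^ 4 := by ring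
      rw [h4] at this
      exact_mod_cast this
    have h5 : (#Φ : ℝ) ^ 4 ≤ m ^ 4 := by gcongr
    gcongr
    exact h3.trans h5
  refine ⟨Φ.image Prod.fst, Submodule.span (ZMod p) (E : Set G), ?_, ?_, ?_⟩
  · refine le_trans ?_ hΦ
    exact_mod_cast card_image_le
  · refine le_trans ?_ hE
    exact_mod_cast finrank_span_finset_le_card E
  · intro x k hxk
    have hsum : ∑ t, g t ≤ N := by
      rw [Fintype.sum_prod_type]
      calc _ ≤ ∑ x : G, (1:ℝ) := Finset.sum_le_sum fun x _ => hgs x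
        _ = N := by simp [hN]
    have hsum0 : 0 ≤ ∑ t, g t := Finset.sum_nonneg fun _ _ => hg0 _
    have hc : θ / 8 * (∑ t, g t) ^ 3 ≤ θ / 8 * N ^ 3 := by gcongr
    set g1 : G × G → ℝ := fun s => if s ∈ S then g s else 0 with hg1d
    set g2 : G × G → ℝ := fun s => if s ∈ S then 0 else g s with hg2d
    have a1 : ∀ s, 0 ≤ g1 s := fun s => by simp only [hg1d]; split_ifs <;> simp [hg0]
    have a2 : ∀ s, 0 ≤ g2 s := fun s => by simp only [hg2d]; split_ifs <;> simp [hg0]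
    have a3 : ∀ s, g1 s ≤ g s := fun s => by simp only [hg1d]; split_ifs <;> simp [hg0]
    have a4 : ∀ s, g2 s ≤ θ / 8 := fun s => by
      simp only [hg2d]
      split_ifs with h
      · positivity
      · simp [hS] at h; exact h.le
    have a5 : ∀ s, g1 s ≤ ind S s := fun s => by
      simp only [hg1d, ind]; split_ifs <;> simp [hg1]
    have hsplit : ∀ s, g s = g1 s + g2 s := fun s => by
      simp only [hg1d, hg2d]; split_ifs <;> simp
    have a6 : ∀ s, g s ≤ g s := fun s => le_rfl
    rw [rep4_telescope g g1 g2 hsplit] at hxk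
    have t0 := rep4_mono a1 a1 a1 a1 a5 a5 a5 a5 (x, k)
    have t1 := rep4_mono a2 hg0 hg0 hg0 a4 a6 a6 a6 (x, k)
    have t2 := rep4_mono a1 a2 hg0 hg0 a3 a4 a6 a6 (x, k)
    have t3 := rep4_mono a1 a1 a2 hg0 a3 a3 a4 a6 (x, k)
    have t4 := rep4_mono a1 a1 a1 a2 a3 a3 a3 a4 (x, k)
    rw [rep4_const1] at t1
    rw [rep4_const2] at t2
    rw [rep4_const3] at t3
    rw [rep4_const4] at t4
    obtain ⟨f1, h1, f2, h2, f3, h3, f4, h4, hcnt⟩ := hmain (x, k) (by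
      have : 8 * N ^ 3 / R = θ / 2 * N ^ 3 := by rw [hRθ]; field_simp; ring
      rw [this]; linarith)
    refine ⟨f4.1, mem_image_of_mem _ h4, ?_⟩
    have hset : ∀ x1 : G × G × G, (f1.1 x1.1 + f1.2) + (f2.1 x1.2.1 + f2.2) - (f3.1 x1.2.2 + f3.2) -
              (f4.1 (x1.1 + x1.2.1 - x1.2.2 - x) + f4.2) = k ↔
              T (f1, f2, f3, f4) x1 = k - f4.1 x - (f1.2 + f2.2 - f3.2 - f4.2) := by
      intro x1
      rw [hT, eq_sub_iff_add_eq, eq_sub_iff_add_eq]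
      simp only [map_sub, map_add]
      constructor <;> (intro h; rw [← h]; abel)
    simp only [hset] at hcnt
    have hfr := fiber_mul_range (T (f1, f2, f3, f4)) (k - f4.1 x - (f1.2 + f2.2 - f3.2 - f4.2))
    set F : Finset (G × G × G) := {x1 | T (f1, f2, f3, f4) x1 = k - f4.1 x - (f1.2 + f2.2 - f3.2 - f4.2)} with hF
    have hfr' : (#F : ℝ) * #(univ.image (T (f1, f2, f3, f4))) ≤ N ^ 3 := by
      have e : (Fintype.card (G × G × G) : ℝ) = N ^ 3 := by
        simp [Fintype.card_prod, hN]; ring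
      rw [← e]; exact_mod_cast hfr
    have hΦ4 : (#Φ : ℝ) ^ 4 ≤ m ^ 4 := pow_le_pow_left₀ (Nat.cast_nonneg _) hΦ 4
    have hF0 : 4 * N ^ 3 / R ≤ m ^ 4 * #F := 
      hcnt.trans (mul_le_mul_of_nonneg_right hΦ4 (Nat.cast_nonneg _))
    have hgood : (#(univ.image (T (f1, f2, f3, f4))) : ℝ) ≤ R * m ^ 4 / 4 := by
      set q : ℝ := (#(univ.image (T (f1, f2, f3, f4))) : ℝ) with hq
      have hq0 : 0 ≤ q := Nat.cast_nonneg _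
      have : 4 * N ^ 3 / R * q ≤ m ^ 4 * N ^ 3 := by
        calc _ ≤ m ^ 4 * #F * q := mul_le_mul_of_nonneg_right hF0 hq0
          _ = m ^ 4 * (#F * q) := mul_assoc _ _ _
          _ ≤ _ := mul_le_mul_of_nonneg_left hfr' (pow_nonneg hm0.le 4)
      rw [div_mul_eq_mul_div, div_le_iff₀ hR0] at this
      apply le_of_mul_le_mul_left _ (show 0 < 4 * N ^ 3 by positivity)
      linarith
    have hmemf : (f1, f2, f3, f4) ∈ ({f ∈ Φ ×ˢ Φ ×ˢ Φ ×ˢ Φ | (#(univ.image (T f)) : ℝ) ≤ R * m ^ 4 / 4} : Finset _) := by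
      simp only [mem_filter, mem_product]
      exact ⟨⟨h1, h2, h3, h4⟩, hgood⟩
    have hFpos : 0 < (#F : ℝ) := by
      have : 0 < m ^ 4 * #F := lt_of_lt_of_le (by positivity) hF0
      exact pos_of_mul_pos_right this (by positivity)
    obtain ⟨x1, hx1⟩ := card_pos.1 (by exact_mod_cast hFpos : 0 < #F)
    have hx1' := (mem_filter.1 hx1).2
    have e : k - f4.1 x = T (f1, f2, f3, f4) x1 + (f1.2 + f2.2 - f3.2 - f4.2) := by
      rw [hx1']; abel
    rw [e]
    apply Submodule.add_mem <;> apply Submodule.subset_span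
    · exact mem_coe.2 (mem_biUnion.2 ⟨_, hmemf, mem_insert_of_mem (mem_image_of_mem _ (mem_univ _))⟩)
    · exact mem_coe.2 (mem_biUnion.2 ⟨_, hmemf, mem_insert_self _ _⟩)


noncomputable def ch {p n : ℕ} [Fact p.Prime] (k x : Fin n → ZMod p) : ℂ :=
  ZMod.stdAddChar (k ⬝ᵥ x)

section
variable {p n : ℕ} [Fact p.Prime]

lemma ch_add_right (k x y : Fin n → ZMod p) : ch k (x + y) = ch k x * ch k y := by
  unfold ch; rw [dotProduct_add, AddChar.map_add_eq_mul]

lemma ch_comm (k x : Fin n → ZMod p) : ch k x = ch x k := by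
  unfold ch; rw [dotProduct_comm]

lemma ch_add_left (k l x : Fin n → ZMod p) : ch (k + l) x = ch k x * ch l x := by
  rw [ch_comm, ch_add_right, ch_comm x k, ch_comm x l]

lemma ch_neg_right (k x : Fin n → ZMod p) : ch k (-x) = (starRingEnd ℂ) (ch k x) := by
  unfold ch; rw [dotProduct_neg, AddChar.map_neg_eq_conj]

lemma ch_neg_left (k x : Fin n → ZMod p) : ch (-k) x = (starRingEnd ℂ) (ch k x) := by
  rw [ch_comm, ch_neg_right, ch_comm]

lemma ch_zero_left (x : Fin n → ZMod p) : ch 0 x = 1 := by simp [ch]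
lemma ch_zero_right (x : Fin n → ZMod p) : ch x 0 = 1 := by simp [ch]

lemma ch_norm (k x : Fin n → ZMod p) : ‖ch k x‖ = 1 := by
  unfold ch; exact AddChar.norm_apply _ _

lemma ch_orth (k : Fin n → ZMod p) :
    ∑ x, ch k x = if k = 0 then (Fintype.card (Fin n → ZMod p) : ℂ) else 0 := by
  classical
  split_ifs with h
  · subst h; simp [ch_zero_left]
  · obtain ⟨i, hi⟩ := Function.ne_iff.1 h
    simp only [Pi.zero_apply] at hi
    let z : Fin n → ZMod p := Pi.single i 1
    have hz : ch k z ≠ 1 := by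
      unfold ch
      rw [dotProduct_single_one]
      intro h1
      exact hi (ZMod.injective_stdAddChar (by rw [h1, AddChar.map_zero_eq_one]))
    have h2 : ∑ x, ch k x = ch k z * ∑ x, ch k x := by
      rw [Finset.mul_sum, ← Equiv.sum_comp (Equiv.addLeft z)]
      simp [ch_add_right]
    have h3 : (ch k z - 1) * ∑ x, ch k x = 0 := by rw [sub_mul, ← h2]; ring
    exact (mul_eq_zero.1 h3).resolve_left (sub_ne_zero.2 hz)

noncomputable def fc (f : (Fin n → ZMod p) → ℝ) (k : Fin n → ZMod p) : ℂ :=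
  (Fintype.card (Fin n → ZMod p) : ℂ)⁻¹ * ∑ x, (f x : ℂ) * ch k (-x)

lemma card_ne : (Fintype.card (Fin n → ZMod p) : ℂ) ≠ 0 := by
  exact_mod_cast Fintype.card_ne_zero

lemma fc_inv (f : (Fin n → ZMod p) → ℝ) (y : Fin n → ZMod p) :
    (f y : ℂ) = ∑ k, fc f k * ch k y := by
  classical
  unfold fc
  have : ∀ k, (Fintype.card (Fin n → ZMod p) : ℂ)⁻¹ * (∑ x, (f x : ℂ) * ch k (-x)) * ch k y =
      ∑ x, (Fintype.card (Fin n → ZMod p) : ℂ)⁻¹ * (f x * ch (y - x) k) := by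
    intro k
    rw [mul_assoc, Finset.sum_mul, Finset.mul_sum]
    apply Finset.sum_congr rfl; intro x _
    rw [mul_assoc, ← ch_add_right, ch_comm k, neg_add_eq_sub]
  simp only [this]
  rw [Finset.sum_comm]
  simp only [← Finset.mul_sum, ch_orth, sub_eq_zero]
  simp only [mul_ite, mul_zero, Finset.sum_ite_eq, Finset.mem_univ, if_true]
  rw [mul_comm (f y : ℂ), inv_mul_cancel_left₀ card_ne]

lemma cor_ch (f : (Fin n → ZMod p) → ℝ) (q : (Fin n → ZMod p) → ℂ)
    (h : ∀ y, (f y : ℂ) = ∑ k, q k * ch k y) (t : Fin n → ZMod p) :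
    (cor f f t : ℂ) = ∑ k, (((Fintype.card (Fin n → ZMod p) : ℝ) * ‖q k‖ ^ 2 : ℝ) : ℂ) * ch k t := by
  classical
  have h' : ∀ y, (f y : ℂ) = ∑ k, (starRingEnd ℂ) (q k) * ch (-k) y := by
    intro y
    rw [← Complex.conj_ofReal, h, map_sum]
    simp [ch_neg_left]
  unfold cor
  push_cast
  have h1 : ∀ b, (f (t + b) : ℂ) * f b =
      ∑ k, ∑ l, (q k * (starRingEnd ℂ) (q l) * ch k t) * ch (k - l) b := by
    intro b
    rw [h, h', Finset.sum_mul_sum]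
    apply Finset.sum_congr rfl; intro k _
    apply Finset.sum_congr rfl; intro l _
    rw [ch_add_right, sub_eq_add_neg, ch_add_left]; ring
  simp only [h1]
  rw [Finset.sum_comm]
  apply Finset.sum_congr rfl; intro k _
  rw [Finset.sum_comm]
  simp only [← Finset.mul_sum, ch_orth, sub_eq_zero]
  simp only [mul_ite, mul_zero, Finset.sum_ite_eq, Finset.mem_univ, if_true]
  rw [Complex.mul_conj, Complex.normSq_eq_norm_sq]
  push_cast; ring

lemma parseval (f : (Fin n → ZMod p) → ℝ) (q : (Fin n → ZMod p) → ℂ)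
    (h : ∀ y, (f y : ℂ) = ∑ k, q k * ch k y) :
    ∑ y, f y ^ 2 = (Fintype.card (Fin n → ZMod p) : ℝ) * ∑ k, ‖q k‖ ^ 2 := by
  have := cor_ch f q h 0
  simp only [ch_zero_right, mul_one] at this
  rw [← Complex.ofReal_sum, Complex.ofReal_inj] at this
  rw [Finset.mul_sum, ← this]
  unfold cor
  simp [sq]

lemma rep4_cor_cor {H : Type*} [AddCommGroup H] [Fintype H] (f : H → ℝ) (s : H) :
    rep4 f f f f s = cor (cor f f) (cor f f) s := by
  rw [rep4_eq_cor]
  unfold cor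
  rw [← Equiv.sum_comp (Equiv.addLeft s)]
  simp

lemma bogo (f : (Fin n → ZMod p) → ℝ) (q : (Fin n → ZMod p) → ℂ)
    (h : ∀ y, (f y : ℂ) = ∑ k, q k * ch k y) (hf0 : ∀ y, 0 ≤ f y) (hf1 : ∀ y, f y ≤ 1)
    (a ε : ℝ) (ha : 0 ≤ a) (ha0 : a ≤ ‖q 0‖) (y : Fin n → ZMod p)
    (hy : ∀ k, ε ≤ ‖q k‖ → k ⬝ᵥ y = 0) :
    (Fintype.card (Fin n → ZMod p) : ℝ) ^ 3 * (a ^ 4 - ε ^ 2) ≤ rep4 f f f f y := by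
  classical
  set N : ℝ := (Fintype.card (Fin n → ZMod p) : ℝ) with hN
  have hN0 : 0 < N := by rw [hN]; exact_mod_cast Fintype.card_pos
  have h1 := cor_ch f q h
  have h2 := cor_ch (cor f f) _ h1 y
  rw [← rep4_cor_cor] at h2
  have hre : rep4 f f f f y = ∑ k, N ^ 3 * (‖q k‖ ^ 4 * (ch k y).re) := by
    have := congrArg Complex.re h2
    rw [Complex.ofReal_re, Complex.re_sum] at this
    rw [this]
    apply Finset.sum_congr rfl; intro k _
    rw [Complex.re_ofReal_mul, Complex.norm_real, Real.norm_eq_abs, sq_abs]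
    ring
  rw [hre, ← Finset.mul_sum]
  apply mul_le_mul_of_nonneg_left _ (by positivity)
  have hpar : ∑ k, ‖q k‖ ^ 2 ≤ 1 := by
    have := parseval f q h
    have h3 : ∑ y, f y ^ 2 ≤ N := by
      calc _ ≤ ∑ y : Fin n → ZMod p, (1:ℝ) := Finset.sum_le_sum fun y _ => by nlinarith [hf0 y, hf1 y]
        _ = N := by simp [hN]
    rw [this] at h3
    nlinarith
  have hterm : ∀ k, (if k = 0 then a ^ 4 else 0) - ε ^ 2 * ‖q k‖ ^ 2 ≤ ‖q k‖ ^ 4 * (ch k y).re := by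
    intro k
    have hq := norm_nonneg (q k)
    have e1 : 0 ≤ ε ^ 2 * ‖q k‖ ^ 2 := by positivity
    have e2 : 0 ≤ ‖q k‖ ^ 4 := by positivity
    split_ifs with hk
    · subst hk
      rw [ch_zero_left]
      have : a ^ 4 ≤ ‖q 0‖ ^ 4 := by gcongr
      simp; linarith
    · by_cases hε : ε ≤ ‖q k‖
      · have : ch k y = 1 := by unfold ch; rw [hy k hε]; simp
        rw [this]; simp; linarith
      · push Not at hε
        have h4 : ‖q k‖ ^ 2 ≤ ε ^ 2 := by gcongr
        have h5 : -1 ≤ (ch k y).re := by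
          have := Complex.abs_re_le_norm (ch k y)
          rw [ch_norm, abs_le] at this
          exact this.1
        have h6 : ‖q k‖ ^ 4 ≤ ε ^ 2 * ‖q k‖ ^ 2 := by
          calc _ = ‖q k‖ ^ 2 * ‖q k‖ ^ 2 := by ring
            _ ≤ _ := by gcongr
        nlinarith
  have hs := Finset.sum_le_sum (s := Finset.univ) fun k _ => hterm k
  rw [Finset.sum_sub_distrib, ← Finset.mul_sum] at hs
  simp only [Finset.sum_ite_eq', Finset.mem_univ, if_true] at hs
  nlinarith [sq_nonneg ε]

lemma rep4_ch (g : (Fin n → ZMod p) × (Fin n → ZMod p) → ℝ) (ρ : (Fin n → ZMod p) → ℝ)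
    (y : Fin n → ZMod p) (h : ∀ x, (ρ x : ℂ) = ∑ k, (g (x, k) : ℂ) * ch k y) (x : Fin n → ZMod p) :
    (rep4 ρ ρ ρ ρ x : ℂ) = ∑ k, (rep4 g g g g (x, k) : ℂ) * ch k y := by
  have h' : ∀ x, (ρ x : ℂ) = ∑ k, (g (x, k) : ℂ) * ch (-k) y := by
    intro x
    rw [← Complex.conj_ofReal, h, map_sum]
    simp [ch_neg_left]
  unfold rep4
  push_cast
  simp only [Fintype.sum_prod_type, Finset.sum_mul]
  symm
  rw [Finset.sum_comm]
  apply Finset.sum_congr rfl; intro x1 _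
  have : ∀ x2 x3 : Fin n → ZMod p, (ρ x1 : ℂ) * ρ x2 * ρ x3 * ρ (x1 + x2 - x3 - x) =
    ∑ k1, ∑ k2, ∑ k3, ∑ k4, (g (x1, k1) * ch k1 y) * (g (x2, k2) * ch k2 y) * (g (x3, k3) * ch (-k3) y) *
      (g (x1 + x2 - x3 - x, k4) * ch (-k4) y) := by
    intro x2 x3
    rw [h x1, h x2, h' x3, h' (x1 + x2 - x3 - x)]
    simp only [← Finset.mul_sum, ← Finset.sum_mul]
  simp only [this]
  rw [Finset.sum_comm]
  calc _ = ∑ k1, ∑ x2, ∑ k2, ∑ x3, ∑ k3, ∑ k, (g (x1, k1) : ℂ) * g (x2, k2) * g (x3, k3) *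
        g ((x1, k1) + (x2, k2) - (x3, k3) - (x, k)) * ch k y := by
        apply Finset.sum_congr rfl; intro k1 _
        rw [Finset.sum_comm]
        apply Finset.sum_congr rfl; intro x2 _
        rw [Finset.sum_comm]
        apply Finset.sum_congr rfl; intro k2 _
        rw [Finset.sum_comm]
        apply Finset.sum_congr rfl; intro x3 _
        rw [Finset.sum_comm]
    _ = ∑ k1, ∑ x2, ∑ k2, ∑ x3, ∑ k3, ∑ k4, ((g (x1, k1) : ℂ) * ch k1 y) * (g (x2, k2) * ch k2 y) * (g (x3, k3) * ch (-k3) y) *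
      (g (x1 + x2 - x3 - x, k4) * ch (-k4) y) := by
        apply Finset.sum_congr rfl; intro k1 _
        apply Finset.sum_congr rfl; intro x2 _
        apply Finset.sum_congr rfl; intro k2 _
        apply Finset.sum_congr rfl; intro x3 _
        apply Finset.sum_congr rfl; intro k3 _
        rw [← Equiv.sum_comp (Equiv.subLeft (k1 + k2 - k3))]
        apply Finset.sum_congr rfl; intro k4 _
        simp only [Equiv.subLeft_apply, Prod.mk_add_mk, Prod.mk_sub_mk, sub_sub_cancel]
        rw [show k1 + k2 - k3 - k4 = k1 + k2 + -k3 + -k4 by abel]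
        simp only [ch_add_left]
        ring
    _ = _ := by
        rw [Finset.sum_comm]
        apply Finset.sum_congr rfl; intro x2 _
        symm
        calc _ = ∑ k1, ∑ x3, ∑ k2, ∑ k3, ∑ k4, ((g (x1, k1) : ℂ) * ch k1 y) * (g (x2, k2) * ch k2 y) * (g (x3, k3) * ch (-k3) y) *
                (g (x1 + x2 - x3 - x, k4) * ch (-k4) y) := by rw [Finset.sum_comm]
          _ = _ := by
            apply Finset.sum_congr rfl; intro k1 _
            rw [Finset.sum_comm]

lemma codim_ker {ι : Type*} [Fintype ι] (v : ι → Fin n → ZMod p) :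
    ∃ V : Submodule (ZMod p) (Fin n → ZMod p), (∀ y, y ∈ V ↔ ∀ i, v i ⬝ᵥ y = 0) ∧
      n - Module.finrank (ZMod p) V ≤ Fintype.card ι := by
  let T : (Fin n → ZMod p) →ₗ[ZMod p] (ι → ZMod p) := Matrix.mulVecLin (Matrix.of v)
  refine ⟨LinearMap.ker T, fun y => ?_, ?_⟩
  · rw [LinearMap.mem_ker, funext_iff]; rfl
  · have h1 := LinearMap.finrank_range_add_finrank_ker T
    have h2 := Submodule.finrank_le (LinearMap.range T)
    simp only [Module.finrank_fintype_fun_eq_card, Fintype.card_fin] at h1 h2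
    omega

end

lemma num_bound (p : ℕ) (hp : p.Prime) (c R κ : ℝ) (hc : 0 < c) (hc1 : c ≤ 1) (hR : R = 128 / c ^ 16)
    (hκ : κ = 1 / (R ^ (203) * (p : ℝ) ^ (R ^ (920)))) (x : ℝ)
    (hx : x ≤ R ∨ x ≤ 2 * R / κ ∨ x ≤ (2 * R / κ) ^ 4 * (R * (2 * R / κ) ^ 4 / 4 + 1)) :
    x ≤ (p : ℝ) ^ Real.exp (14880 * (1 + Real.log c⁻¹) ^ (1:ℝ)) := by
  have hp2 : (2:ℝ) ≤ p := by exact_mod_cast hp.two_le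
  have hp0 : (0:ℝ) < p := by linarith
  have hR128 : 128 ≤ R := by
    rw [hR, le_div_iff₀ (by positivity)]
    have : c ^ 16 ≤ 1 := pow_le_one₀ hc.le hc1
    linarith
  have hR0 : 0 < R := by linarith
  have hR1 : 1 ≤ R := by linarith
  have hRp : R ≤ (p:ℝ) ^ R := by
    have h1 : 1 + R * 1 ≤ (1 + 1 : ℝ) ^ R := one_add_mul_self_le_rpow_one_add (by norm_num) hR1
    have h2 : (1 + 1 : ℝ) ^ R ≤ (p:ℝ) ^ R := Real.rpow_le_rpow (by norm_num) (by linarith) hR0.le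
    linarith
  have hE : R ^ 930 ≤ Real.exp (14880 * (1 + Real.log c⁻¹) ^ (1:ℝ)) := by
    rw [Real.rpow_one]
    have hl : Real.log 128 ≤ 16 := by
      rw [Real.log_le_iff_le_exp (by norm_num)]
      have h1 : (2:ℝ) ≤ Real.exp 1 := by linarith [Real.add_one_le_exp 1]
      have h2 : Real.exp 16 = Real.exp 1 ^ 16 := by rw [← Real.exp_nat_mul]; norm_num
      rw [h2]
      calc (128:ℝ) ≤ 2 ^ 16 := by norm_num
        _ ≤ _ := by gcongr
    have h3 : R ^ 930 = Real.exp (930 * Real.log R) := by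
      rw [← Real.exp_log (show 0 < R ^ 930 by positivity), Real.log_pow]; norm_num
    rw [h3]
    apply Real.exp_le_exp.2
    have h4 : Real.log R = Real.log 128 + 16 * Real.log c⁻¹ := by
      rw [hR, Real.log_div (by norm_num) (by positivity), Real.log_pow, Real.log_inv]; push_cast; ring
    rw [h4]; linarith
  have hpos : 0 < (p:ℝ) ^ (R ^ 920) := by positivity
  set P : ℝ := (p:ℝ) ^ (R ^ 920) with hP
  have hP1 : 1 ≤ P := Real.one_le_rpow (by linarith) (by positivity)
  have hm : 2 * R / κ = 2 * R ^ 204 * P := by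
    rw [hκ]; field_simp
  set m : ℝ := 2 * R / κ with hmd
  have hm1 : 1 ≤ m := by
    rw [hm]
    have : 1 ≤ R ^ 204 := one_le_pow₀ hR1
    nlinarith
  have hmR : R ≤ m := by
    rw [hm]
    have : R ≤ R ^ 204 := le_self_pow₀ hR1 (by norm_num)
    nlinarith
  have hm4 : 1 ≤ m ^ 4 := one_le_pow₀ hm1
  have hx' : x ≤ R * m ^ 8 := by
    have hbig : m ≤ R * m ^ 8 := by
      have h1 : m ≤ m ^ 8 := le_self_pow₀ hm1 (by norm_num)
      nlinarith
    rcases hx with h | h | h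
    · linarith
    · linarith
    · refine h.trans ?_
      have : R * m ^ 8 = m ^ 4 * (R * m ^ 4) := by ring
      rw [this]
      apply mul_le_mul_of_nonneg_left _ (by positivity)
      nlinarith
  have hfin : R * m ^ 8 ≤ (p:ℝ) ^ (R ^ 930) := by
    have h1 : R * m ^ 8 ≤ R ^ 1641 * P ^ 8 := by
      rw [hm]
      have h2 : R * (2 * R ^ 204 * P) ^ 8 = 2 ^ 8 * (R ^ 1633 * P ^ 8) := by ring
      have h3 : R ^ 1641 * P ^ 8 = R ^ 8 * (R ^ 1633 * P ^ 8) := by ring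
      rw [h2, h3]
      gcongr
      linarith
    refine h1.trans ?_
    have h4 : R ^ 1641 ≤ (p:ℝ) ^ (R * 1641) := by
      have : (p:ℝ) ^ (R * 1641) = ((p:ℝ) ^ R) ^ 1641 := by
        rw [Real.rpow_mul hp0.le, ← Real.rpow_natCast]; norm_num
      rw [this]
      gcongr
    have h5 : P ^ 8 = (p:ℝ) ^ (R ^ 920 * 8) := by
      rw [hP, Real.rpow_mul hp0.le, ← Real.rpow_natCast]; norm_num
    rw [h5]
    calc _ ≤ (p:ℝ) ^ (R * 1641) * (p:ℝ) ^ (R ^ 920 * 8) := by gcongr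
      _ = (p:ℝ) ^ (R * 1641 + R ^ 920 * 8) := by rw [Real.rpow_add hp0]
      _ ≤ _ := by
        apply Real.rpow_le_rpow_of_exponent_le (by linarith)
        have h6 : R ≤ R ^ 920 := le_self_pow₀ hR1 (by norm_num)
        have h7 : R ^ 930 = R ^ 10 * R ^ 920 := by ring
        have h8 : (128:ℝ) ^ 10 ≤ R ^ 10 := by gcongr
        have h9 : (0:ℝ) < R ^ 920 := by positivity
        have h10 : (128:ℝ) ^ 10 * R ^ 920 ≤ R ^ 10 * R ^ 920 := by gcongr
        rw [h7]
        norm_num at h10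
        linarith
  exact hx'.trans (hfin.trans (Real.rpow_le_rpow_of_exponent_le (by linarith) hE))

set_option maxHeartbeats 1000000 in
open Finset in
lemma main_aux (p n : ℕ) [Fact p.Prime] (A : Set ((Fin n → ZMod p) × (Fin n → ZMod p))) (c : ℝ)
    (hc : 0 < c) (hA : (Nat.card A : ℝ) = c * ((p : ℝ) ^ n) ^ 2) (R κ : ℝ) (hR : R = 128 / c ^ 16)
    (hκ : κ = 1 / (R ^ (203) * (p : ℝ) ^ (R ^ (920)))) :
    c ≤ 1 ∧ ∃ (U V : Submodule (ZMod p) (Fin n → ZMod p)) (m : ℕ)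
            (β : (Fin n → ZMod p) →ₗ[ZMod p] (Fin n → ZMod p) →ₗ[ZMod p] (Fin m → ZMod p)),
            {xy : (Fin n → ZMod p) × (Fin n → ZMod p) |
                xy.1 ∈ U ∧ xy.2 ∈ V ∧ β xy.1 xy.2 = 0} ⊆ rowQuad (colQuad (rowDiff A)) ∧
            ((n - Module.finrank (ZMod p) U : ℕ) : ℝ) ≤ R ∧
            ((n - Module.finrank (ZMod p) V : ℕ) : ℝ) ≤
              (2 * R / κ) ^ 4 * (R * (2 * R / κ) ^ 4 / 4 + 1) ∧
            (m : ℝ) ≤ 2 * R / κ := by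
  classical
  set N : ℝ := (Fintype.card (Fin n → ZMod p) : ℝ) with hN
  have hN0 : 0 < N := by rw [hN]; exact_mod_cast Fintype.card_pos
  have hNp : (p:ℝ) ^ n = N := by rw [hN]; simp [ZMod.card]
  rw [hNp] at hA
  -- slices
  let a : (Fin n → ZMod p) → (Fin n → ZMod p) → ℝ := fun x y => if (x, y) ∈ A then 1 else 0
  have ha0 : ∀ x y, 0 ≤ a x y := fun x y => by simp only [a]; split_ifs <;> simp
  have ha1 : ∀ x y, a x y ≤ 1 := fun x y => by simp only [a]; split_ifs <;> simp
  have hasq : ∀ x y, a x y ^ 2 = a x y := fun x y => by simp only [a]; split_ifs <;> simp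
  have hapos : ∀ x y, 0 < a x y → (x, y) ∈ A := fun x y h => by
    by_contra h'; simp [a, h'] at h
  have hsumA : ∑ x, ∑ y, a x y = c * N ^ 2 := by
    rw [← hA, ← Fintype.sum_prod_type' (f := a)]
    simp only [a, Prod.mk.eta, Finset.sum_boole]
    rw [Nat.card_eq_fintype_card, Fintype.card_subtype]
  have hcardG : ∑ x : (Fin n → ZMod p), (1:ℝ) = N := by simp [hN]
  let α : (Fin n → ZMod p) → ℝ := fun x => (∑ y, a x y) / N
  have hα0 : ∀ x, 0 ≤ α x := fun x => div_nonneg (Finset.sum_nonneg fun y _ => ha0 x y) hN0.le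
  have hα1 : ∀ x, α x ≤ 1 := fun x => by
    simp only [α]; rw [div_le_one hN0, ← hcardG]
    exact Finset.sum_le_sum fun y _ => ha1 x y
  have hsumα : ∑ x, α x = c * N := by
    simp only [α]; rw [← Finset.sum_div, hsumA]; field_simp
  have hc1 : c ≤ 1 := by
    have : ∑ x, α x ≤ ∑ x : (Fin n → ZMod p), (1:ℝ) := Finset.sum_le_sum fun x _ => hα1 x
    rw [hsumα, hcardG] at this
    nlinarith
  refine ⟨hc1, ?_⟩
  have hsumα2 : c ^ 2 * N ≤ ∑ x, α x ^ 2 := by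
    have h1 := sq_sum_le_card_mul_sum_sq (s := (univ : Finset (Fin n → ZMod p))) (f := α)
    rw [hsumα, card_univ] at h1
    change (c * N) ^ 2 ≤ N * ∑ x, α x ^ 2 at h1
    apply le_of_mul_le_mul_left _ hN0
    linarith
  let g : (Fin n → ZMod p) × (Fin n → ZMod p) → ℝ := fun s => ‖fc (a s.1) s.2‖ ^ 2
  have hg0 : ∀ s, 0 ≤ g s := fun s => sq_nonneg _
  have hgs : ∀ x, ∑ k, g (x, k) = α x := by
    intro x
    have := parseval (a x) (fc (a x)) (fc_inv (a x))
    simp only [hasq] at this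
    simp only [g, α]
    rw [eq_div_iff hN0.ne', this, mul_comm]
  have hgs1 : ∀ x, ∑ k, g (x, k) ≤ 1 := fun x => (hgs x).le.trans (hα1 x)
  have hg1 : ∀ s, g s ≤ 1 := fun s =>
    (Finset.single_le_sum (f := fun k => g (s.1, k)) (fun k _ => hg0 _) (mem_univ s.2)).trans (hgs1 s.1)
  have hgz : ∀ x, g (x, 0) = α x ^ 2 := by
    intro x
    have : fc (a x) 0 = ((α x : ℝ) : ℂ) := by
      simp only [fc, ch_zero_left, mul_one, α]
      push_cast
      rw [div_eq_inv_mul]; simp [hN]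
    simp only [g, this]
    rw [Complex.norm_real, Real.norm_eq_abs, sq_abs]
  -- first application
  set γ : ℝ := c ^ 8 / 2 with hγ
  have hγ0 : 0 < γ := by positivity
  let f1 : (Fin n → ZMod p) → ℝ := fun x => α x ^ 2
  have hf10 : ∀ x, 0 ≤ f1 x := fun x => sq_nonneg _
  have hf11 : ∀ x, f1 x ≤ 1 := fun x => pow_le_one₀ (hα0 x) (hα1 x)
  let Sp : Finset (Fin n → ZMod p) := {k | Real.sqrt γ ≤ ‖fc f1 k‖}
  have hSp : (#Sp : ℝ) * γ ≤ 1 := by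
    have h1 := parseval f1 (fc f1) (fc_inv f1)
    have h2 : ∑ y, f1 y ^ 2 ≤ N := by
      rw [← hcardG]; exact Finset.sum_le_sum fun y _ => pow_le_one₀ (hf10 y) (hf11 y)
    rw [h1] at h2
    have h3 : ∑ k, ‖fc f1 k‖ ^ 2 ≤ 1 := by
      change N * _ ≤ N at h2
      nlinarith
    refine le_trans ?_ h3
    rw [← nsmul_eq_mul]
    refine (Finset.card_nsmul_le_sum Sp (fun k => ‖fc f1 k‖ ^ 2) γ fun k hk => ?_).trans
      (Finset.sum_le_sum_of_subset_of_nonneg (subset_univ _) fun _ _ _ => sq_nonneg _)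
    have := (mem_filter.1 hk).2
    calc γ = Real.sqrt γ ^ 2 := (Real.sq_sqrt hγ0.le).symm
      _ ≤ _ := by gcongr
  obtain ⟨U, hU, hUc⟩ := codim_ker (p := p) (fun k : Sp => (k : (Fin n → ZMod p)))
  have hQ0 : ∀ x ∈ U, γ * N ^ 3 ≤ rep4 g g g g (x, 0) := by
    intro x hx
    have h1 := bogo f1 (fc f1) (fc_inv f1) hf10 hf11 (c ^ 2) (Real.sqrt γ) (by positivity) (by
      have : fc f1 0 = (((∑ x, α x ^ 2) / N : ℝ) : ℂ) := by
        simp only [fc, ch_zero_left, mul_one, f1]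
        push_cast
        rw [div_eq_inv_mul]; simp [hN]
      rw [this, Complex.norm_real, Real.norm_eq_abs]
      refine le_trans ?_ (le_abs_self _)
      rw [le_div_iff₀ hN0]; exact hsumα2) x (fun k hk => (hU x).1 hx ⟨k, by simp [Sp, hk]⟩)
    rw [Real.sq_sqrt hγ0.le] at h1
    have h2 : (c ^ 2) ^ 4 - γ = γ := by rw [hγ]; ring
    rw [h2] at h1
    change N ^ 3 * γ ≤ _ at h1
    rw [mul_comm]
    refine h1.trans ?_
    unfold rep4
    rw [Fintype.sum_prod_type]
    apply Finset.sum_le_sum; intro x1 _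
    refine le_trans ?_ (Finset.single_le_sum (f := fun k1 => ∑ s2, ∑ s3, g (x1, k1) * g s2 * g s3 * g ((x1, k1) + s2 - s3 - (x, 0)))
      (fun k1 _ => Finset.sum_nonneg fun s2 _ => Finset.sum_nonneg fun s3 _ =>
        mul_nonneg (mul_nonneg (mul_nonneg (hg0 _) (hg0 _)) (hg0 _)) (hg0 _)) (mem_univ 0))
    rw [Fintype.sum_prod_type]
    apply Finset.sum_le_sum; intro x2 _
    refine le_trans ?_ (Finset.single_le_sum (f := fun k2 => ∑ s3, g (x1, 0) * g (x2, k2) * g s3 * g ((x1, 0) + (x2, k2) - s3 - (x, 0)))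
      (fun k1 _ => Finset.sum_nonneg fun s3 _ =>
        mul_nonneg (mul_nonneg (mul_nonneg (hg0 _) (hg0 _)) (hg0 _)) (hg0 _)) (mem_univ 0))
    rw [Fintype.sum_prod_type]
    apply Finset.sum_le_sum; intro x3 _
    refine le_trans ?_ (Finset.single_le_sum (f := fun k3 => g (x1, 0) * g (x2, 0) * g (x3, k3) * g ((x1, 0) + (x2, 0) - (x3, k3) - (x, 0)))
      (fun k1 _ => mul_nonneg (mul_nonneg (mul_nonneg (hg0 _) (hg0 _)) (hg0 _)) (hg0 _)) (mem_univ 0))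
    simp only [Prod.mk_add_mk, Prod.mk_sub_mk, add_zero, sub_zero, hgz, f1]
    exact le_rfl
  -- the key structural step
  set θ : ℝ := γ ^ 2 / 2 with hθ
  have hθ0 : 0 < θ := by positivity
  have hγ1 : γ ≤ 1 := by
    have : c ^ 8 ≤ 1 := pow_le_one₀ hc.le hc1
    rw [hγ]; linarith
  have hθ1 : θ ≤ 1 := by
    have : γ ^ 2 ≤ 1 := pow_le_one₀ hγ0.le hγ1
    rw [hθ]; linarith
  obtain ⟨J, K, hJ, hK, hmain⟩ := key_fun (p := p) g θ R κ hθ0 hθ1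
    (by rw [hR, hθ, hγ]; field_simp; norm_num) hκ hg0 hg1 hgs1
  obtain ⟨V, hV, hVc⟩ := codim_ker (p := p) (fun i => ((Module.finBasis (ZMod p) K i : K) : (Fin n → ZMod p)))
  have hVK : ∀ y ∈ V, ∀ k ∈ K, k ⬝ᵥ y = 0 := by
    intro y hy k hk
    have h1 := (Module.finBasis (ZMod p) K).sum_repr ⟨k, hk⟩
    have h2 := congrArg (Subtype.val) h1
    simp only [AddSubmonoidClass.coe_finsetSum, Submodule.coe_smul] at h2
    rw [← h2, sum_dotProduct]
    apply Finset.sum_eq_zero; intro i _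
    rw [smul_dotProduct, (hV y).1 hy i, smul_zero]
  let β : (Fin n → ZMod p) →ₗ[ZMod p] (Fin n → ZMod p) →ₗ[ZMod p] (Fin (#J) → ZMod p) :=
    LinearMap.mk₂ (ZMod p) (fun x y j => ((J.equivFin.symm j : (Fin n → ZMod p) →ₗ[ZMod p] (Fin n → ZMod p)) x) ⬝ᵥ y)
      (by intros; ext; simp [add_dotProduct]) (by intros; ext; simp [smul_dotProduct])
      (by intros; ext; simp [dotProduct_add]) (by intros; ext; simp [dotProduct_smul])
  refine ⟨U, V, #J, β, ?_, ?_, ?_, hJ⟩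
  · rintro ⟨x, y⟩ ⟨hxU, hyV, hβ⟩
    simp only at hxU hyV hβ
    have hL : ∀ L ∈ J, (L x) ⬝ᵥ y = 0 := by
      intro L hLJ
      have := congrFun hβ (J.equivFin ⟨L, hLJ⟩)
      simpa [β] using this
    let r : (Fin n → ZMod p) → (Fin n → ZMod p) → ℝ := fun y x => cor (a x) (a x) y
    have hr0 : ∀ y x, 0 ≤ r y x := fun y x =>
      Finset.sum_nonneg fun z _ => mul_nonneg (ha0 _ _) (ha0 _ _)
    have hrN : ∀ y x, r y x ≤ N := fun y x => by
      rw [← hcardG]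
      exact Finset.sum_le_sum fun z _ => mul_le_one₀ (ha1 _ _) (ha0 _ _) (ha1 _ _)
    have hrpos : ∀ y x, 0 < r y x → (x, y) ∈ rowDiff A := by
      intro y x h
      obtain ⟨z, -, hz⟩ := Finset.exists_lt_of_sum_lt (s := univ) (f := fun _ : (Fin n → ZMod p) => (0:ℝ))
        (g := fun z => a x (y + z) * a x z) (by rw [Finset.sum_const_zero]; exact h)
      have h1 : 0 < a x (y + z) := pos_of_mul_pos_left hz (ha0 _ _)
      have h2 : 0 < a x z := pos_of_mul_pos_right hz (ha0 _ _)
      exact ⟨y + z, z, hapos _ _ h1, hapos _ _ h2, by simp⟩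
    let f : (Fin n → ZMod p) → ℝ := fun y => rep4 (fun x => r y x / N) (fun x => r y x / N) (fun x => r y x / N) (fun x => r y x / N) x / N ^ 3
    have hρ0 : ∀ y x, 0 ≤ r y x / N := fun y x => div_nonneg (hr0 y x) hN0.le
    have hρ1 : ∀ y x, r y x / N ≤ 1 := fun y x => (div_le_one hN0).2 (hrN y x)
    have hf0 : ∀ y, 0 ≤ f y := fun y => div_nonneg (Finset.sum_nonneg fun _ _ =>
      Finset.sum_nonneg fun _ _ => Finset.sum_nonneg fun _ _ =>
        mul_nonneg (mul_nonneg (mul_nonneg (hρ0 _ _) (hρ0 _ _)) (hρ0 _ _)) (hρ0 _ _)) (by positivity)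
    have hf1 : ∀ y, f y ≤ 1 := by
      intro y
      rw [div_le_one (by positivity)]
      refine (rep4_mono (hρ0 y) (hρ0 y) (hρ0 y) (hρ0 y) (hρ1 y) (hρ1 y) (hρ1 y) (hρ1 y) x).trans ?_
      rw [rep4_const1, hcardG, one_mul]
    have hfpos : ∀ y, 0 < f y → (x, y) ∈ colQuad (rowDiff A) := by
      intro y h
      have h' : 0 < rep4 (fun x => r y x / N) (fun x => r y x / N) (fun x => r y x / N) (fun x => r y x / N) x := by
        by_contra! h''
        exact absurd h (not_lt.2 (div_nonpos_of_nonpos_of_nonneg h'' (by positivity)))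
      unfold rep4 at h'
      obtain ⟨x1, -, h1⟩ := Finset.exists_lt_of_sum_lt (s := univ) (f := fun _ : (Fin n → ZMod p) => (0:ℝ)) (by simpa using h')
      obtain ⟨x2, -, h2⟩ := Finset.exists_lt_of_sum_lt (s := univ) (f := fun _ : (Fin n → ZMod p) => (0:ℝ)) (by simpa using h1)
      obtain ⟨x3, -, h3⟩ := Finset.exists_lt_of_sum_lt (s := univ) (f := fun _ : (Fin n → ZMod p) => (0:ℝ)) (by simpa using h2)
      have hp : ∀ x, r y x / N ≠ 0 → (x, y) ∈ rowDiff A := fun x hx =>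
        hrpos y x (lt_of_le_of_ne (hr0 y x) fun h => hx (by rw [← h, zero_div]))
      have h4 := h3.ne'
      simp only [mul_ne_zero_iff] at h4
      exact ⟨x1, x2, x3, _, hp _ h4.1.1.1, hp _ h4.1.1.2, hp _ h4.1.2, hp _ h4.2, by simp⟩
    have hfq : ∀ y, (f y : ℂ) = ∑ k, ((rep4 g g g g (x, k) / N ^ 3 : ℝ) : ℂ) * ch k y := by
      intro y
      have h1 := rep4_ch g (fun x => r y x / N) y (by
        intro x
        have := cor_ch (a x) (fc (a x)) (fc_inv (a x)) y
        simp only [r]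
        push_cast
        rw [this, Finset.sum_div]
        apply Finset.sum_congr rfl; intro k _
        change ((N * g (x, k) : ℝ) : ℂ) * _ / _ = _
        have : (N : ℂ) ≠ 0 := by exact_mod_cast hN0.ne'
        push_cast
        field_simp) x
      simp only [f]
      push_cast
      rw [h1, Finset.sum_div]
      apply Finset.sum_congr rfl; intro k _
      ring
    have hb := bogo f _ hfq hf0 hf1 γ θ hγ0.le (by
      rw [Complex.norm_real, Real.norm_eq_abs]
      refine le_trans ?_ (le_abs_self _)
      rw [le_div_iff₀ (by positivity)]
      exact hQ0 x hxU) y (by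
      intro k hk
      have hQnn : 0 ≤ rep4 g g g g (x, k) := Finset.sum_nonneg fun _ _ =>
        Finset.sum_nonneg fun _ _ => Finset.sum_nonneg fun _ _ =>
          mul_nonneg (mul_nonneg (mul_nonneg (hg0 _) (hg0 _)) (hg0 _)) (hg0 _)
      rw [Complex.norm_real, Real.norm_eq_abs, abs_of_nonneg (div_nonneg hQnn (by positivity)),
        le_div_iff₀ (by positivity)] at hk
      obtain ⟨L, hLJ, hLK⟩ := hmain x k hk
      have h1 := hVK y hyV _ hLK
      rw [sub_dotProduct, hL L hLJ, sub_zero] at h1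
      exact h1)
    have hpos : 0 < rep4 f f f f y := by
      refine lt_of_lt_of_le ?_ hb
      have : 0 < γ ^ 4 - θ ^ 2 := by
        rw [hθ]
        have : 0 < γ ^ 4 := by positivity
        nlinarith
      positivity
    unfold rep4 at hpos
    obtain ⟨y1, -, h1⟩ := Finset.exists_lt_of_sum_lt (s := univ) (f := fun _ : (Fin n → ZMod p) => (0:ℝ)) (by simpa using hpos)
    obtain ⟨y2, -, h2⟩ := Finset.exists_lt_of_sum_lt (s := univ) (f := fun _ : (Fin n → ZMod p) => (0:ℝ)) (by simpa using h1)
    obtain ⟨y3, -, h3⟩ := Finset.exists_lt_of_sum_lt (s := univ) (f := fun _ : (Fin n → ZMod p) => (0:ℝ)) (by simpa using h2)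
    have hp : ∀ y, f y ≠ 0 → (x, y) ∈ colQuad (rowDiff A) := fun y hy =>
      hfpos y (lt_of_le_of_ne (hf0 y) hy.symm)
    have h4 := h3.ne'
    simp only [mul_ne_zero_iff] at h4
    exact ⟨y1, y2, y3, _, hp _ h4.1.1.1, hp _ h4.1.1.2, hp _ h4.1.2, hp _ h4.2, by simp⟩
  · have h1 : ((n - Module.finrank (ZMod p) U : ℕ) : ℝ) ≤ #Sp := by
      simpa using (Nat.cast_le (α := ℝ)).2 hUc
    refine h1.trans ?_
    rw [hR, le_div_iff₀ (by positivity)]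
    have h2 : c ^ 16 ≤ c ^ 8 := pow_le_pow_of_le_one hc.le hc1 (by norm_num)
    have h3 : (0:ℝ) ≤ #Sp := Nat.cast_nonneg _
    have h4 : (#Sp : ℝ) * c ^ 16 ≤ #Sp * c ^ 8 := mul_le_mul_of_nonneg_left h2 h3
    rw [hγ] at hSp
    linarith
  · refine le_trans ?_ hK
    simpa using (Nat.cast_le (α := ℝ)).2 hVc

/-- **Bilinear Bogolyubov theorem.** If `A ⊆ 𝔽_pⁿ × 𝔽_pⁿ` has density `c`, then
`A⁽³⁾ = rowQuad (colQuad (rowDiff A))` contains `(U × V) ∩ B` where `U, V` are subspaces and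
`B` is the zero set of a bilinear map `β : (Fin n → ZMod p) × (Fin n → ZMod p) → W` with
`codim U, codim V, dim W ≤ p^(exp(C (1 + log c⁻¹)^C'))`. -/
theorem bilinear_bogolyubov :
    ∃ C C' : ℝ, 0 < C ∧ 0 < C' ∧
      ∀ (p n : ℕ), p.Prime →
        ∀ (A : Set ((Fin n → ZMod p) × (Fin n → ZMod p))) (c : ℝ), 0 < c →
          (Nat.card A : ℝ) = c * ((p : ℝ) ^ n) ^ 2 →
          ∃ (U V : Submodule (ZMod p) (Fin n → ZMod p)) (m : ℕ)
            (β : (Fin n → ZMod p) →ₗ[ZMod p] (Fin n → ZMod p) →ₗ[ZMod p] (Fin m → ZMod p)),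
            {xy : (Fin n → ZMod p) × (Fin n → ZMod p) |
                xy.1 ∈ U ∧ xy.2 ∈ V ∧ β xy.1 xy.2 = 0} ⊆ rowQuad (colQuad (rowDiff A)) ∧
            ((n - Module.finrank (ZMod p) U : ℕ) : ℝ) ≤
              (p : ℝ) ^ Real.exp (C * (1 + Real.log c⁻¹) ^ C') ∧
            ((n - Module.finrank (ZMod p) V : ℕ) : ℝ) ≤
              (p : ℝ) ^ Real.exp (C * (1 + Real.log c⁻¹) ^ C') ∧
            (m : ℝ) ≤ (p : ℝ) ^ Real.exp (C * (1 + Real.log c⁻¹) ^ C') := by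
  refine ⟨14880, 1, by norm_num, by norm_num, ?_⟩
  intro p n hp A c hc hA
  have : Fact p.Prime := ⟨hp⟩
  obtain ⟨hc1, U, V, m, β, h1, h2, h3, h4⟩ := main_aux p n A c hc hA _ _ rfl rfl
  refine ⟨U, V, m, β, h1, ?_, ?_, ?_⟩
  · exact num_bound p hp c _ _ hc hc1 rfl rfl _ (Or.inl h2)
  · exact num_bound p hp c _ _ hc hc1 rfl rfl _ (Or.inr (Or.inr h3))
  · exact num_bound p hp c _ _ hc hc1 rfl rfl _ (Or.inr (Or.inl h4))
end

section
/- Let $p$ be a prime, let $G = \mathbb{F}_p^n$, and let $A \subseteq G \times G$ be a set of density $c > 0$ such that for every $x \in G$ the row $A_{x\cdot}$ is either empty or a subspace of $G$, and for every $y \in G$ the column $A_{\cdot y}$ is either empty or a subspace of $G$. Then there exist absolute constants $C, C' > 0$ such that $A$ contains a set of the form $(U \times V) \cap \mathbf{B}$, where $U, V \leq G$ are subspaces and $\mathbf{B} = \{(x,y) \in G \times G : \beta(x,y) = 0\}$ for some bilinear map $\beta \colon G \times G \to W$ into an $\mathbb{F}_p$-vector space $W$, satisfying $\operatorname{codim}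 U, \operatorname{codim} V, \dim W \leq p^{\exp(C(1 + \log c^{-1})^{C'})}$. -/
open Classical in
theorem bb_near_subgroup {G : Type} [AddCommGroup G] [Fintype G] (S : Finset G)
    (hne : S.Nonempty) (hS : ∀ x ∈ S, -x ∈ S)
    (hpop : ∀ z, z ∉ S →
      (S.filter (fun x => z - x ∈ S)).card * (64 * Fintype.card G) ≤ S.card ^ 2) :
    ∃ H : AddSubgroup G, (∀ h ∈ H, h ∈ S) ∧ 7 * S.card ≤ 8 * Nat.card H := by
  have hNpos : 0 < Fintype.card G := Fintype.card_pos
  have hSpos : 0 < S.card := hne.card_pos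
  have hSN : S.card ≤ Fintype.card G := Finset.card_le_univ S
  let b : G → ℕ := fun x => (S.filter (fun y => x + y ∉ S)).card
  have hsum : (∑ x ∈ S, b x) * 64 ≤ S.card ^ 2 := by
    have h1 : ∑ x ∈ S, b x ≤ ∑ z ∈ Finset.univ.filter (fun z => z ∉ S),
        (S.filter (fun x => z - x ∈ S)).card := by
      simp only [b, Finset.card_filter]
      rw [Finset.sum_comm (s := Finset.univ.filter (fun z => z ∉ S)) (t := S)]
      apply Finset.sum_le_sum
      intro x hx
      rw [← Finset.card_filter, ← Finset.card_filter]
      apply Finset.card_le_card_of_injOn (fun y => x + y)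
      · intro y hy
        simp at hy ⊢
        tauto
      · intro y _ z _ h; simpa using h
    have h2 : (∑ z ∈ Finset.univ.filter (fun z => z ∉ S),
        (S.filter (fun x => z - x ∈ S)).card) * (64 * Fintype.card G)
          ≤ Fintype.card G * S.card ^ 2 := by
      rw [Finset.sum_mul]
      calc _ ≤ ∑ z ∈ Finset.univ.filter (fun z => z ∉ S), S.card ^ 2 := by
            apply Finset.sum_le_sum
            intro z hz
            exact hpop z (by simpa using hz)
        _ ≤ _ := by
            rw [Finset.sum_const, smul_eq_mul]
            exact Nat.mul_le_mul_right _ (Finset.card_le_univ _)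
    refine Nat.le_of_mul_le_mul_left ?_ hNpos
    calc _ = (∑ x ∈ S, b x) * (64 * Fintype.card G) := by ring
      _ ≤ _ := (Nat.mul_le_mul_right _ h1).trans h2
  let S' := S.filter (fun x => 8 * b x ≤ S.card)
  have hS'card : 7 * S.card ≤ 8 * S'.card := by
    have h1 : (S.filter (fun x => ¬ 8 * b x ≤ S.card)).card * S.card ≤ 8 * ∑ x ∈ S, b x := by
      rw [Finset.mul_sum, ← smul_eq_mul, ← Finset.sum_const]
      calc _ ≤ ∑ x ∈ S.filter (fun x => ¬ 8 * b x ≤ S.card), 8 * b x := by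
            apply Finset.sum_le_sum
            intro x hx
            simp only [Finset.mem_filter, not_le] at hx
            exact hx.2.le
        _ ≤ _ := Finset.sum_le_sum_of_subset (Finset.filter_subset _ _)
    have h2 : S'.card + (S.filter (fun x => ¬ 8 * b x ≤ S.card)).card = S.card :=
      Finset.card_filter_add_card_filter_not _
    have h3 : (S.filter (fun x => ¬ 8 * b x ≤ S.card)).card * 8 ≤ S.card := by
      refine Nat.le_of_mul_le_mul_left ?_ hSpos
      nlinarith
    omega
  have hbneg : ∀ x, b (-x) = b x := by
    intro x
    apply Finset.card_bij (fun y _ => -y)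
    · intro y hy
      simp only [Finset.mem_filter] at hy ⊢
      refine ⟨hS _ hy.1, fun h => hy.2 ?_⟩
      have := hS _ h
      rwa [neg_add, neg_neg] at this
    · intro y _ z _ h; simpa using h
    · intro z hz
      simp only [Finset.mem_filter] at hz
      refine ⟨-z, ?_, by simp⟩
      simp only [Finset.mem_filter]
      refine ⟨hS _ hz.1, fun h => hz.2 ?_⟩
      have := hS _ h
      rwa [neg_add, neg_neg, neg_neg] at this
  have hS'neg : ∀ x ∈ S', -x ∈ S' := by
    intro x hx
    simp only [S', Finset.mem_filter] at hx ⊢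
    rw [hbneg]
    exact ⟨hS _ hx.1, hx.2⟩
  have hS'S : ∀ x ∈ S', ∀ y ∈ S', x + y ∈ S := by
    intro x hx x' hx'
    by_contra hcon
    have h0 := hpop _ hcon
    have hx1 : 8 * b x ≤ S.card := (Finset.mem_filter.1 hx).2
    have hx2 : 8 * b (-x') ≤ S.card := (Finset.mem_filter.1 (hS'neg _ hx')).2
    have h1 : S.card ≤ b x + b (-x') + (S.filter (fun u => x + x' - u ∈ S)).card := by
      have hsub : S ⊆ (S.filter (fun y => x + y ∉ S)) ∪ (S.filter (fun y => -x' + y ∉ S)) ∪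
          (S.filter (fun y => x + y ∈ S ∧ -x' + y ∈ S)) := by
        intro y hy
        simp only [Finset.mem_union, Finset.mem_filter]
        tauto
      have h2 : (S.filter (fun y => x + y ∈ S ∧ -x' + y ∈ S)).card ≤
          (S.filter (fun u => x + x' - u ∈ S)).card := by
        apply Finset.card_le_card_of_injOn (fun y => x + y)
        · intro y hy
          simp only [Finset.coe_filter, Set.mem_ofPred_eq] at hy ⊢
          refine ⟨hy.2.1, ?_⟩
          have := hS _ hy.2.2
          rwa [show x + x' - (x + y) = -(-x' + y) by abel]
        · intro y _ z _ h; simpa using h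
      have h3 := Finset.card_le_card hsub
      have h4 := Finset.card_union_le ((S.filter (fun y => x + y ∉ S)) ∪ (S.filter (fun y => -x' + y ∉ S)))
          (S.filter (fun y => x + y ∈ S ∧ -x' + y ∈ S))
      have h5 := Finset.card_union_le (S.filter (fun y => x + y ∉ S)) (S.filter (fun y => -x' + y ∉ S))
      simp only [b]
      omega
    have h6 : 3 * S.card ≤ 4 * (S.filter (fun u => x + x' - u ∈ S)).card := by omega
    have h7 : 3 * S.card * (16 * Fintype.card G) ≤ S.card ^ 2 := by
      calc _ ≤ 4 * (S.filter (fun u => x + x' - u ∈ S)).card * (16 * Fintype.card G) :=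
            Nat.mul_le_mul_right _ h6
        _ = (S.filter (fun u => x + x' - u ∈ S)).card * (64 * Fintype.card G) := by ring
        _ ≤ _ := h0
    have h8 : S.card * S.card ≤ S.card * Fintype.card G := Nat.mul_le_mul_left _ hSN
    have h9 : 0 < S.card * Fintype.card G := Nat.mul_pos hSpos hNpos
    nlinarith
  have hS'pos : 0 < S'.card := by omega
  have hcnt : ∀ x ∈ S', ∀ y ∈ S',
      6 * S'.card ≤ 7 * (S'.filter (fun u => x + y + u ∈ S')).card := by
    intro x hx y hy
    have hsub : (S'.image (fun u => x + u)) ∪ (S'.image (fun u => -y + u)) ⊆ S := by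
      intro z hz
      simp only [Finset.mem_union, Finset.mem_image] at hz
      rcases hz with ⟨u, hu, rfl⟩ | ⟨u, hu, rfl⟩
      · exact hS'S _ hx _ hu
      · exact hS'S _ (hS'neg _ hy) _ hu
    have h1 := Finset.card_le_card hsub
    have h2 := Finset.card_union_add_card_inter (S'.image (fun u => x + u))
      (S'.image (fun u => -y + u))
    rw [Finset.card_image_of_injective _ (add_right_injective x),
      Finset.card_image_of_injective _ (add_right_injective (-y))] at h2
    have h3 : ((S'.image (fun u => x + u)) ∩ (S'.image (fun u => -y + u))).card ≤
        (S'.filter (fun u => x + y + u ∈ S')).card := by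
      apply Finset.card_le_card_of_injOn (fun z => -x + z)
      · intro z hz
        simp only [Finset.coe_inter, Finset.coe_image, Set.mem_inter_iff, Set.mem_image,
          Finset.mem_coe] at hz
        obtain ⟨⟨u, hu, rfl⟩, w, hw, hwu⟩ := hz
        have : x + y + u = w := by
          have h : w = y + (-y + w) := by abel
          rw [h, hwu]; abel
        simp only [Finset.coe_filter, Set.mem_ofPred_eq, neg_add_cancel_left]
        exact ⟨hu, by rwa [this]⟩
      · intro y _ z _ h; simpa using h
    omega
  let H : AddSubgroup G :=
    { carrier := {h | ∃ x ∈ S', ∃ y ∈ S', h = x + y}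
      zero_mem' := by
        obtain ⟨x, hx⟩ := Finset.card_pos.1 hS'pos
        exact ⟨x, hx, -x, hS'neg _ hx, by simp⟩
      neg_mem' := by
        rintro _ ⟨x, hx, y, hy, rfl⟩
        exact ⟨-x, hS'neg _ hx, -y, hS'neg _ hy, by abel⟩
      add_mem' := by
        rintro _ _ ⟨x, hx, y, hy, rfl⟩ ⟨x', hx', y', hy', rfl⟩
        have h1 := hcnt x hx y hy
        have h2 := hcnt (-x') (hS'neg _ hx') (-y') (hS'neg _ hy')
        have h3 : ((S'.filter (fun u => x + y + u ∈ S')) ∩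
            (S'.filter (fun u => -x' + -y' + u ∈ S'))).Nonempty := by
          rw [← Finset.card_pos]
          have h4 := Finset.card_union_add_card_inter (S'.filter (fun u => x + y + u ∈ S'))
            (S'.filter (fun u => -x' + -y' + u ∈ S'))
          have h5 : ((S'.filter (fun u => x + y + u ∈ S')) ∪
            (S'.filter (fun u => -x' + -y' + u ∈ S'))).card ≤ S'.card :=
            Finset.card_le_card (Finset.union_subset (Finset.filter_subset _ _)
              (Finset.filter_subset _ _))
          omega
        obtain ⟨u, hu⟩ := h3
        simp only [Finset.mem_inter, Finset.mem_filter] at hu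
        exact ⟨_, hu.1.2, _, hS'neg _ hu.2.2, by abel⟩ }
  refine ⟨H, ?_, ?_⟩
  · rintro _ ⟨x, hx, y, hy, rfl⟩
    exact hS'S _ hx _ hy
  · have h1 : S'.card ≤ Nat.card H := by
      obtain ⟨x, hx⟩ := Finset.card_pos.1 hS'pos
      rw [Nat.card_eq_fintype_card, ← Fintype.card_coe]
      apply Fintype.card_le_of_injective (fun y : S' => (⟨x + y, x, hx, y, y.2, rfl⟩ : H))
      intro y z h
      exact Subtype.ext (add_left_cancel (congrArg Subtype.val h))
    omega

open Classical in
theorem bb_count {p : ℕ} [Fact p.Prime] {G E : Type} [AddCommGroup G] [Fintype G]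
    [AddCommGroup E] [Module (ZMod p) E] [Finite E] (L : G → Submodule (ZMod p) E)
    (S : Finset G) (d Q : ℕ)
    (hpop : ∀ v : E, v ≠ 0 → (S.filter (fun x => v ∈ L x)).card * (Q * p ^ d) < Fintype.card G)
    (F : Submodule (ZMod p) E) (hF : Module.finrank (ZMod p) F ≤ d) :
    (S.filter (fun x => ¬ Disjoint (L x) F)).card * Q ≤ Fintype.card G := by
  have : Fintype E := Fintype.ofFinite E
  have hp : 0 < p := (Fact.out : p.Prime).pos
  have hcard : (Finset.univ.filter (fun v : E => v ∈ F ∧ v ≠ 0)).card ≤ p ^ d := by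
    have h1 : Nat.card F = p ^ Module.finrank (ZMod p) F := by
      have := Module.natCard_eq_pow_finrank (K := ZMod p) (V := F)
      simpa using this
    calc (Finset.univ.filter (fun v : E => v ∈ F ∧ v ≠ 0)).card
        ≤ (Finset.univ.filter (fun v : E => v ∈ F)).card := by
          apply Finset.card_le_card
          intro v; simp; tauto
      _ = Nat.card F := by
          rw [Nat.card_eq_fintype_card, Fintype.card_subtype]
      _ ≤ p ^ d := by rw [h1]; exact Nat.pow_le_pow_right hp hF
  have hsub : S.filter (fun x => ¬ Disjoint (L x) F) ⊆
      (Finset.univ.filter (fun v : E => v ∈ F ∧ v ≠ 0)).biUnion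
        (fun v => S.filter (fun x => v ∈ L x)) := by
    intro x hx
    simp only [Finset.mem_filter, Submodule.disjoint_def] at hx
    obtain ⟨hxS, hx⟩ := hx
    push Not at hx
    obtain ⟨v, hv1, hv2, hv3⟩ := hx
    simp only [Finset.mem_biUnion, Finset.mem_filter, Finset.mem_univ, true_and]
    exact ⟨v, ⟨hv2, hv3⟩, hxS, hv1⟩
  have h2 := (Finset.card_le_card hsub).trans Finset.card_biUnion_le
  have h3 : (∑ v ∈ Finset.univ.filter (fun v : E => v ∈ F ∧ v ≠ 0),
      (S.filter (fun x => v ∈ L x)).card) * (Q * p ^ d) ≤ p ^ d * Fintype.card G := by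
    rw [Finset.sum_mul]
    calc _ ≤ ∑ v ∈ Finset.univ.filter (fun v : E => v ∈ F ∧ v ≠ 0), Fintype.card G := by
          apply Finset.sum_le_sum
          intro v hv
          exact (hpop v (by simp at hv; exact hv.2)).le
      _ ≤ _ := by
          rw [Finset.sum_const, smul_eq_mul]
          exact Nat.mul_le_mul_right _ hcard
  have h4 : (S.filter (fun x => ¬ Disjoint (L x) F)).card * (Q * p ^ d) ≤ p ^ d * Fintype.card G :=
    (Nat.mul_le_mul_right _ h2).trans h3
  have h5 : 0 < p ^ d := by positivity
  refine Nat.le_of_mul_le_mul_left ?_ h5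
  linarith

open Classical in
theorem bb_avoid {p : ℕ} [Fact p.Prime] {G E : Type} [AddCommGroup G] [Fintype G]
    [AddCommGroup E] [Module (ZMod p) E] [Finite E] (L : G → Submodule (ZMod p) E)
    (d : ℕ)
    (hpop : ∀ v : E, v ≠ 0 →
      (Finset.univ.filter (fun x => v ∈ L x)).card * (8 * p ^ d) < Fintype.card G)
    (a : Fin 4 → G) (F : Fin 4 → Submodule (ZMod p) E)
    (hF : ∀ i, Module.finrank (ZMod p) (F i) ≤ d) :
    ∃ y, ∀ i, Disjoint (L (a i + y)) (F i) := by
  by_contra hcon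
  push Not at hcon
  have hsub : (Finset.univ : Finset G) ⊆ Finset.univ.biUnion
      (fun i : Fin 4 => Finset.univ.filter (fun y => ¬ Disjoint (L (a i + y)) (F i))) := by
    intro y _
    obtain ⟨i, hi⟩ := hcon y
    simp only [Finset.mem_biUnion, Finset.mem_filter, Finset.mem_univ, true_and]
    exact ⟨i, hi⟩
  have h2 := (Finset.card_le_card hsub).trans Finset.card_biUnion_le
  have h3 : ∀ i : Fin 4,
      (Finset.univ.filter (fun y => ¬ Disjoint (L (a i + y)) (F i))).card * 8
        ≤ Fintype.card G := by
    intro i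
    have h := bb_count L Finset.univ d 8 hpop (F i) (hF i)
    have he : (Finset.univ.filter (fun y => ¬ Disjoint (L (a i + y)) (F i))).card
        = (Finset.univ.filter (fun y => ¬ Disjoint (L y) (F i))).card := by
      apply Finset.card_bij (fun y _ => a i + y)
      · intro y hy; simpa using hy
      · intro y _ z _ h; simpa using h
      · intro z hz; exact ⟨-a i + z, by simpa using hz, by simp⟩
    rw [he]; exact h
  have hpos : 0 < Fintype.card G := Fintype.card_pos
  rw [Fin.sum_univ_four, Finset.card_univ] at h2
  have := h3 0; have := h3 1; have := h3 2; have := h3 3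
  omega

/-- the graph relation -/
def BRel {p : ℕ} {G E : Type} [AddCommGroup G]
    [AddCommGroup E] [Module (ZMod p) E] (L : G → Submodule (ZMod p) E) (x0 x : G) (m e : E) :
    Prop := e ∈ L x ∧ m + e ∈ L (x0 + x)

section
set_option linter.unusedSectionVars false
variable {p : ℕ} [Fact p.Prime] {G E : Type} [AddCommGroup G]
    [AddCommGroup E] [Module (ZMod p) E] [Finite E] {L : G → Submodule (ZMod p) E}
    (hadd : ∀ x y, L (x + y) ≤ L x ⊔ L y) (hneg : ∀ x, L (-x) = L x) {x0 : G}
    (hmax : ∀ x, Module.finrank (ZMod p) (L x) ≤ Module.finrank (ZMod p) (L x0))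

include hadd hneg in
theorem brel_exists {x : G} {m : E} (hm : m ∈ L x0) : ∃ e, BRel L x0 x m e := by
  have h := hadd (x0 + x) (-x)
  rw [hneg, add_neg_cancel_right] at h
  obtain ⟨a, ha, b, hb, hab⟩ := Submodule.mem_sup.1 (h hm)
  refine ⟨-b, neg_mem hb, ?_⟩
  rw [← hab]; simpa using ha

include hadd hneg in
theorem brel_surj {x : G} {e : E} (he : e ∈ L x) : ∃ m ∈ L x0, BRel L x0 x m e := by
  have h := hadd (x0 + x) (-x0)
  rw [hneg, add_neg_cancel_comm] at h
  obtain ⟨a, ha, b, hb, hab⟩ := Submodule.mem_sup.1 (h he)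
  refine ⟨-b, neg_mem hb, he, ?_⟩
  rw [← hab]; simpa [add_comm] using ha

include hadd hneg hmax in
theorem brel_unique {x : G} (hx : Disjoint (L x) (L x0)) {m e e' : E}
    (h : BRel L x0 x m e) (h' : BRel L x0 x m e') : e = e' := by
  have : FiniteDimensional (ZMod p) E := Module.Finite.of_finite
  have h1 : L (x0 + x) ⊔ L x = L x0 ⊔ L x := by
    apply le_antisymm
    · exact sup_le (hadd _ _) le_sup_right
    · refine sup_le ?_ le_sup_right
      have h := hadd (x0 + x) (-x)
      rwa [hneg, add_neg_cancel_right] at h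
  have h2 := Submodule.finrank_sup_add_finrank_inf_eq (L (x0 + x)) (L x)
  have h3 := Submodule.finrank_sup_add_finrank_inf_eq (L x0) (L x)
  rw [disjoint_comm, disjoint_iff] at hx
  rw [h1] at h2
  rw [hx, finrank_bot] at h3
  have h4 := hmax (x0 + x)
  have h5 : Module.finrank (ZMod p) ↥(L (x0 + x) ⊓ L x) = 0 := by omega
  rw [Submodule.finrank_eq_zero] at h5
  have h6 : e - e' ∈ L (x0 + x) ⊓ L x := by
    refine ⟨?_, sub_mem h.1 h'.1⟩
    have := sub_mem h.2 h'.2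
    simpa using this
  rw [h5, Submodule.mem_bot] at h6
  exact sub_eq_zero.1 h6

theorem brel_add {x : G} {m m' e e' : E}
    (h : BRel L x0 x m e) (h' : BRel L x0 x m' e') : BRel L x0 x (m + m') (e + e') :=
  ⟨add_mem h.1 h'.1, by have := add_mem h.2 h'.2; rwa [add_add_add_comm] at this⟩

theorem brel_smul {x : G} {m e : E} (a : ZMod p)
    (h : BRel L x0 x m e) : BRel L x0 x (a • m) (a • e) :=
  ⟨Submodule.smul_mem _ _ h.1, by have := Submodule.smul_mem _ a h.2; rwa [smul_add] at this⟩

theorem indep3 {A B C : Submodule (ZMod p) E} (h1 : Disjoint B A) (h2 : Disjoint C (A ⊔ B))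
    {a a' b b' c c' : E} (ha : a ∈ A) (ha' : a' ∈ A) (hb : b ∈ B) (hb' : b' ∈ B) (hc : c ∈ C)
    (hc' : c' ∈ C) (h : a + b + c = a' + b' + c') : a = a' ∧ b = b' ∧ c = c' := by
  have hc0 : c - c' = 0 := by
    apply Submodule.disjoint_def.1 h2 _ (sub_mem hc hc')
    have : c - c' = (a' - a) + (b' - b) := by
      rw [sub_eq_iff_eq_add]
      have : c = a' + b' + c' - (a + b) := by rw [← h]; abel
      rw [this]; abel
    rw [this]
    exact Submodule.add_mem_sup (sub_mem ha' ha) (sub_mem hb' hb)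
  have hcc := sub_eq_zero.1 hc0
  subst hcc
  have h' := add_right_cancel h
  have hb0 : b - b' = 0 := by
    apply Submodule.disjoint_def.1 h1 _ (sub_mem hb hb')
    have : b - b' = a' - a := by
      have : b = a' + b' - a := by rw [← h']; abel
      rw [this]; abel
    rw [this]
    exact sub_mem ha' ha
  have hbb := sub_eq_zero.1 hb0
  subst hbb
  exact ⟨add_right_cancel h', rfl, rfl⟩

include hadd hneg hmax in
theorem brel_sum {x y : G} (hx : Disjoint (L x) (L x0)) (hy : Disjoint (L y) (L x0 ⊔ L x))
    {m e f : E} (hm : m ∈ L x0) (h : BRel L x0 x m e) (h' : BRel L x0 y m f) :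
    BRel L x0 (x + y) m (e + f) := by
  obtain ⟨g, hg⟩ := brel_exists hadd hneg (x := x + y) hm
  obtain ⟨e', he', f', hf', hef⟩ := Submodule.mem_sup.1 (hadd _ _ hg.1)
  have hy0 : Disjoint (L y) (L x0) := hy.mono_right le_sup_left
  have hE : e' = e := by
    have h1 := hg.2
    rw [← add_assoc] at h1
    obtain ⟨a, ha, b, hb, hab⟩ := Submodule.mem_sup.1 (hadd _ _ h1)
    obtain ⟨m1, hm1, e1, he1, hme⟩ := Submodule.mem_sup.1 (hadd _ _ ha)
    have := indep3 hx hy hm hm1 he' he1 hf' hb (by rw [hme, hab, ← hef]; abel)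
    obtain ⟨r1, r2, r3⟩ := this
    subst r1 r2 r3
    refine brel_unique hadd hneg hmax hx (m := m) ⟨he', ?_⟩ h
    rwa [hme]
  have hF : f' = f := by
    have h1 := hg.2
    rw [add_comm x y, ← add_assoc] at h1
    obtain ⟨a, ha, b, hb, hab⟩ := Submodule.mem_sup.1 (hadd _ _ h1)
    obtain ⟨m1, hm1, e1, he1, hme⟩ := Submodule.mem_sup.1 (hadd _ _ ha)
    have := indep3 hx hy hm hm1 he' hb hf' he1 (by
      rw [add_right_comm, add_right_comm m1, hme, hab, ← hef]; abel)
    obtain ⟨r1, r2, r3⟩ := this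
    subst r1 r2 r3
    refine brel_unique hadd hneg hmax hy0 (m := m) ⟨hf', ?_⟩ h'
    rwa [hme]
  subst hE hF
  rwa [hef]
end

open Classical in
theorem bb_struct {p : ℕ} [Fact p.Prime] {G E : Type} [AddCommGroup G] [Module (ZMod p) G]
    [Fintype G] [AddCommGroup E] [Module (ZMod p) E] [Finite E] (L : G → Submodule (ZMod p) E)
    (hadd : ∀ x y, L (x + y) ≤ L x ⊔ L y) (hneg : ∀ x, L (-x) = L x) (s : ℕ)
    (hs : ∀ x, Module.finrank (ZMod p) (L x) ≤ s)
    (hpop : ∀ v : E, v ≠ 0 →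
      (Finset.univ.filter (fun x => v ∈ L x)).card * (8 * p ^ (2 * s + 1)) < Fintype.card G) :
    ∃ (t : ℕ) (Θ : G →ₗ[ZMod p] (Fin t → ZMod p) →ₗ[ZMod p] E), t ≤ s ∧
      ∀ x, L x ≤ LinearMap.range (Θ x) := by
  have : FiniteDimensional (ZMod p) E := Module.Finite.of_finite
  obtain ⟨x0, hmax⟩ : ∃ x0, ∀ x,
      Module.finrank (ZMod p) (L x) ≤ Module.finrank (ZMod p) (L x0) := by
    obtain ⟨x0, -, h⟩ := Finset.exists_max_image Finset.univ
      (fun x => Module.finrank (ZMod p) (L x)) ⟨0, Finset.mem_univ _⟩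
    exact ⟨x0, fun x => h x (Finset.mem_univ _)⟩
  have hav := bb_avoid L (2 * s + 1) hpop
  have hd1 : ∀ x, Module.finrank (ZMod p) (L x) ≤ 2 * s + 1 := fun x => by
    have := hs x; omega
  have hd2 : ∀ x y, Module.finrank (ZMod p) ↥(L x ⊔ L y) ≤ 2 * s + 1 := fun x y => by
    have := hs x; have := hs y
    have := Submodule.finrank_add_le_finrank_add_finrank (L x) (L y)
    omega
  -- θ
  have hex : ∀ x (m : L x0), ∃ e, BRel L x0 x m e := fun x m => brel_exists hadd hneg m.2
  choose θ hθ using hex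
  have hθadd : ∀ x y, Disjoint (L x) (L x0) → Disjoint (L y) (L x0 ⊔ L x) → ∀ m,
      θ (x + y) m = θ x m + θ y m := by
    intro x y hx hy m
    have hxy : Disjoint (L (x + y)) (L x0) := by
      rw [Submodule.disjoint_def]
      intro v hv hv0
      obtain ⟨a, ha, b, hb, hab⟩ := Submodule.mem_sup.1 (hadd _ _ hv)
      have := indep3 hx hy hv0 (zero_mem _) (zero_mem _) ha (zero_mem _) hb (by simp [hab])
      exact this.1
    exact brel_unique hadd hneg hmax hxy (hθ _ _)
      (brel_sum hadd hneg hmax hx hy m.2 (hθ _ _) (hθ _ _))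
  -- independence of the choice
  have hwd : ∀ x y z, Disjoint (L y) (L x0) → Disjoint (L (x + y)) (L x0) →
      Disjoint (L z) (L x0) → Disjoint (L (x + z)) (L x0) → ∀ m,
      θ (x + y) m - θ y m = θ (x + z) m - θ z m := by
    intro x y z hy hxy hz hxz m
    obtain ⟨w, hw⟩ := hav ![0, 0, x, x]
      ![L x0 ⊔ L (x + y), L x0 ⊔ L (x + z), L x0 ⊔ L y, L x0 ⊔ L z] (by
        intro i; fin_cases i <;> exact hd2 _ _)
    have w0 := hw 0; have w1 := hw 1; have w2 := hw 2; have w3 := hw 3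
    simp at w0 w1 w2 w3
    have e1 := hθadd (x + y) w hxy w0 m
    have e2 := hθadd (x + z) w hxz w1 m
    have e3 := hθadd y (x + w) hy w2 m
    have e4 := hθadd z (x + w) hz w3 m
    rw [show y + (x + w) = x + y + w by abel, e1] at e3
    rw [show z + (x + w) = x + z + w by abel, e2] at e4
    have f3 : θ (x + y) m - θ y m = θ (x + w) m - θ w m := by
      rw [sub_eq_sub_iff_add_eq_add, e3]; abel
    have f4 : θ (x + z) m - θ z m = θ (x + w) m - θ w m := by
      rw [sub_eq_sub_iff_add_eq_add, e4]; abel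
    rw [f3, f4]
  have hsel : ∀ x, ∃ y, Disjoint (L y) (L x0) ∧ Disjoint (L (x + y)) (L x0) := by
    intro x
    obtain ⟨w, hw⟩ := hav ![0, x, 0, 0] (fun _ => L x0) (fun _ => hd1 _)
    have w0 := hw 0; have w1 := hw 1
    simp at w0 w1
    exact ⟨w, w0, w1⟩
  choose yy hy1 hy2 using hsel
  let T : G → (L x0) → E := fun x m => θ (x + yy x) m - θ (yy x) m
  have hT : ∀ x y, Disjoint (L y) (L x0) → Disjoint (L (x + y)) (L x0) → ∀ m,
      T x m = θ (x + y) m - θ y m := fun x y h1 h2 m =>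
    hwd x (yy x) y (hy1 x) (hy2 x) h1 h2 m
  have hTx : ∀ x x' m, T (x + x') m = T x m + T x' m := by
    intro x x' m
    obtain ⟨y, hw⟩ := hav ![0, x, x' + x, 0] (fun _ => L x0) (fun _ => hd1 _)
    have w0 := hw 0; have w1 := hw 1; have w2 := hw 2
    simp at w0 w1 w2
    rw [add_assoc] at w2
    rw [hT x y w0 w1, hT x' (x + y) w1 w2,
      hT (x + x') y w0 (by rwa [show x + x' + y = x' + (x + y) by abel]),
      show x + x' + y = x' + (x + y) by abel]
    abel
  have hθm : ∀ x, Disjoint (L x) (L x0) → ∀ m m', θ x (m + m') = θ x m + θ x m' :=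
    fun x hx m m' => brel_unique hadd hneg hmax hx (hθ _ _) (brel_add (hθ _ _) (hθ _ _))
  have hθs : ∀ x, Disjoint (L x) (L x0) → ∀ (a : ZMod p) m, θ x (a • m) = a • θ x m :=
    fun x hx a m => brel_unique hadd hneg hmax hx (hθ _ _) (brel_smul a (hθ _ _))
  have hTm : ∀ x m m', T x (m + m') = T x m + T x m' := by
    intro x m m'
    simp only [T]
    rw [hθm _ (hy1 x), hθm _ (hy2 x)]; abel
  have hTs : ∀ x (a : ZMod p) m, T x (a • m) = a • T x m := by
    intro x a m
    simp only [T]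
    rw [hθs _ (hy1 x), hθs _ (hy2 x), smul_sub]
  let T1 : G → (L x0) →ₗ[ZMod p] E := fun x =>
    { toFun := T x, map_add' := hTm x, map_smul' := hTs x }
  let T2 : G →+ ((L x0) →ₗ[ZMod p] E) := AddMonoidHom.mk' T1 (by
    intro x y; ext m; exact hTx x y m)
  let Θ0 : G →ₗ[ZMod p] ((L x0) →ₗ[ZMod p] E) := AddMonoidHom.toZModLinearMap p T2
  have hΘ0 : ∀ x m, Θ0 x m = T x m := fun x m => rfl
  have hmain : ∀ x, L x ≤ LinearMap.range (Θ0 x) := by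
    intro x v hv
    have hF : Module.finrank (ZMod p) ↥((Submodule.span (ZMod p) {v}) ⊔ LinearMap.range (Θ0 x))
        ≤ 2 * s + 1 := by
      have h1 := Submodule.finrank_add_le_finrank_add_finrank
        (Submodule.span (ZMod p) {v}) (LinearMap.range (Θ0 x))
      have h2 := LinearMap.finrank_range_le (Θ0 x)
      have h3 : Module.finrank (ZMod p) (Submodule.span (ZMod p) {v}) ≤ 1 := by
        have := finrank_span_finset_le_card (R := ZMod p) ({v} : Finset E)
        rw [Finset.coe_singleton] at this
        simpa [Set.finrank] using this
      have h4 := hs x0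
      omega
    obtain ⟨y, hw⟩ := hav ![0, x, 0, 0]
      ![L x0, L x0, Submodule.span (ZMod p) {v} ⊔ LinearMap.range (Θ0 x), L x0] (by
        intro i; fin_cases i
        · exact hd1 _
        · exact hd1 _
        · exact hF
        · exact hd1 _)
    have w0 := hw 0; have w1 := hw 1; have w2 := hw 2
    simp only [Matrix.cons_val, zero_add] at w0 w1 w2
    have hv' := hadd (x + y) (-y)
    rw [hneg, add_neg_cancel_right] at hv'
    obtain ⟨a, ha, b, hb, hab⟩ := Submodule.mem_sup.1 (hv' hv)
    obtain ⟨m, hm, hma⟩ := brel_surj hadd hneg (x0 := x0) ha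
    have e1 : a = θ (x + y) ⟨m, hm⟩ := brel_unique hadd hneg hmax w1 hma (hθ _ ⟨m, hm⟩)
    have e2 := hT x y w0 w1 ⟨m, hm⟩
    have e3 : v - Θ0 x ⟨m, hm⟩ = θ y ⟨m, hm⟩ + b := by
      rw [hΘ0, e2, ← hab, e1]; abel
    have e4 : v - Θ0 x ⟨m, hm⟩ = 0 := by
      apply Submodule.disjoint_def.1 w2
      · rw [e3]; exact add_mem (hθ y ⟨m, hm⟩).1 hb
      · exact sub_mem (Submodule.mem_sup_left (Submodule.mem_span_singleton_self v))
          (Submodule.mem_sup_right (LinearMap.mem_range_self _ _))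
    exact ⟨_, (sub_eq_zero.1 e4).symm⟩
  let e := (Module.finBasis (ZMod p) (L x0)).equivFun
  refine ⟨Module.finrank (ZMod p) (L x0), Θ0.compr₂ LinearMap.id |>.compl₂ e.symm.toLinearMap,
    hs x0, ?_⟩
  intro x v hv
  obtain ⟨m, hm⟩ := hmain x hv
  exact ⟨e m, by simp [hm]⟩

open Classical in
theorem bb_nonpop {p : ℕ} [Fact p.Prime] {G E : Type} [AddCommGroup G] [Module (ZMod p) G]
    [Fintype G] [AddCommGroup E] [Module (ZMod p) E] [Finite E] (L : G → Submodule (ZMod p) E)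
    (hadd : ∀ x y, L (x + y) ≤ L x ⊔ L y) (hneg : ∀ x, L (-x) = L x) (s k : ℕ)
    (S : Finset G) (hS : ∀ x, x ∈ S ↔ Module.finrank (ZMod p) (L x) ≤ s)
    (hk : Fintype.card G ≤ p ^ k * S.card)
    (hpop : ∀ v : E, v ≠ 0 →
      (S.filter (fun x => v ∈ L x)).card * p ^ (2 * k + 2 * s + 6) < Fintype.card G) :
    ∃ (H : Submodule (ZMod p) G) (t : ℕ) (Θ : H →ₗ[ZMod p] (Fin t → ZMod p) →ₗ[ZMod p] E), t ≤ s ∧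
      (∀ x : H, L x ≤ LinearMap.range (Θ x)) ∧ Fintype.card G ≤ p ^ (k + 1) * Nat.card H := by
  have : FiniteDimensional (ZMod p) E := Module.Finite.of_finite
  have hp2 : 2 ≤ p := (Fact.out : p.Prime).two_le
  have hp6 : 64 ≤ p ^ 6 := by
    calc 64 = 2 ^ 6 := by norm_num
      _ ≤ p ^ 6 := Nat.pow_le_pow_left hp2 6
  have hNpos : 0 < Fintype.card G := Fintype.card_pos
  have hSpos : 0 < S.card := by
    rcases Nat.eq_zero_or_pos S.card with h | h
    · rw [h] at hk; omega
    · exact h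
  have hpk : 0 < p ^ k := by positivity
  have hpop1 : ∀ v : E, v ≠ 0 →
      (S.filter (fun x => v ∈ L x)).card * (p ^ (2 * k + 6) * p ^ (2 * s)) < Fintype.card G := by
    intro v hv
    have := hpop v hv
    rwa [← pow_add, show 2 * k + 6 + 2 * s = 2 * k + 2 * s + 6 by ring]
  obtain ⟨H0, hH0, hH0c⟩ := bb_near_subgroup S (Finset.card_pos.1 hSpos)
    (fun x hx => by rw [hS] at hx ⊢; rwa [hneg]) (by
      intro z hz
      by_cases hr : (S.filter (fun x => z - x ∈ S)).card = 0
      · rw [hr]; simp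
      have hd : Module.finrank (ZMod p) (L z) ≤ 2 * s := by
        obtain ⟨x, hx⟩ := Finset.card_pos.1 (Nat.pos_of_ne_zero hr)
        simp only [Finset.mem_filter, hS] at hx
        have h1 := hadd x (z - x)
        rw [add_sub_cancel] at h1
        have h2 := Submodule.finrank_mono h1
        have h3 := Submodule.finrank_add_le_finrank_add_finrank (L x) (L (z - x))
        omega
      have hcount := bb_count L S (2 * s) (p ^ (2 * k + 6)) hpop1 (L z) hd
      have hsub : S.filter (fun x => z - x ∈ S) ⊆ S.filter (fun x => ¬ Disjoint (L x) (L z)) := by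
        intro x hx
        simp only [Finset.mem_filter] at hx ⊢
        refine ⟨hx.1, fun hdis => hz ?_⟩
        rw [hS]
        have hx2 := (hS _).1 hx.2
        have h1 := hadd x (z - x)
        rw [add_sub_cancel] at h1
        have h2 := Submodule.finrank_mono (sup_le (le_sup_left : L x ≤ L x ⊔ L (z - x)) h1)
        have h3 := Submodule.finrank_add_le_finrank_add_finrank (L x) (L (z - x))
        have h4 := Submodule.finrank_sup_add_finrank_inf_eq (L x) (L z)
        rw [disjoint_iff.1 hdis, finrank_bot] at h4
        omega
      have h5 := (Nat.mul_le_mul_right (p ^ (2 * k + 6)) (Finset.card_le_card hsub)).trans hcount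
      set r := (S.filter (fun x => z - x ∈ S)).card
      refine Nat.le_of_mul_le_mul_left ?_ (by positivity : 0 < p ^ k * p ^ k)
      calc p ^ k * p ^ k * (r * (64 * Fintype.card G))
          ≤ p ^ k * p ^ k * (r * (p ^ 6 * Fintype.card G)) := by gcongr
        _ = (r * p ^ (2 * k + 6)) * Fintype.card G := by ring
        _ ≤ Fintype.card G * Fintype.card G := by gcongr
        _ ≤ (p ^ k * S.card) * (p ^ k * S.card) := by gcongr
        _ = _ := by ring)
  let H : Submodule (ZMod p) G := AddSubgroup.toZModSubmodule p H0
  have hHS : ∀ x : H, (x : G) ∈ S := fun x => hH0 _ x.2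
  have hHc : 7 * S.card ≤ 8 * Nat.card H := hH0c
  have hN1 : 7 * Fintype.card G ≤ 8 * (p ^ k * Nat.card H) := by nlinarith
  have hN2 : Fintype.card G ≤ p ^ (k + 1) * Nat.card H := by
    rw [pow_succ]
    nlinarith
  obtain ⟨t, Θ, ht, hΘ⟩ := bb_struct (fun x : H => L x) (fun x y => hadd x y)
    (fun x => hneg x) s (fun x => (hS _).1 (hHS x)) (by
      intro v hv
      have h1 := hpop v hv
      have h2 : (Finset.univ.filter (fun x : H => v ∈ L x)).card ≤
          (S.filter (fun x => v ∈ L x)).card := by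
        apply Finset.card_le_card_of_injOn (fun x : H => (x : G))
        · intro x hx
          simp at hx ⊢
          exact ⟨hHS x, hx⟩
        · intro x _ y _ h; exact Subtype.ext h
      rw [← Nat.card_eq_fintype_card (α := H)]
      set c := (Finset.univ.filter (fun x : H => v ∈ L x)).card
      refine lt_of_mul_lt_mul_left (a := p ^ (k + 1)) ?_ (Nat.zero_le _)
      refine lt_of_lt_of_le ?_ hN2
      refine lt_of_le_of_lt ?_ h1
      calc p ^ (k + 1) * (c * (8 * p ^ (2 * s + 1)))
          ≤ p ^ (k + 1) * (c * (p ^ 3 * p ^ (2 * s + 1))) := by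
            have : 8 ≤ p ^ 3 := by
              calc 8 = 2 ^ 3 := by norm_num
                _ ≤ p ^ 3 := Nat.pow_le_pow_left hp2 3
            gcongr
        _ = c * p ^ (k + 2 * s + 5) := by ring
        _ ≤ _ := by
            apply Nat.mul_le_mul h2
            apply Nat.pow_le_pow_right (by omega)
            omega)
  exact ⟨H, t, Θ, ht, hΘ, hN2⟩

open Classical in
theorem bb_core {p : ℕ} [Fact p.Prime] {G : Type} [AddCommGroup G] [Module (ZMod p) G]
    [Fintype G] : ∀ (s k : ℕ) (E : Type) [AddCommGroup E] [Module (ZMod p) E] [Finite E]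
    (L : G → Submodule (ZMod p) E)
    (_ : ∀ x y, L (x + y) ≤ L x ⊔ L y) (_ : ∀ x, L (-x) = L x)
    (_ : Fintype.card G ≤ p ^ k *
      (Finset.univ.filter (fun x => Module.finrank (ZMod p) (L x) ≤ s)).card),
    ∃ (H : Submodule (ZMod p) G) (W : Submodule (ZMod p) E) (t : ℕ)
      (Θ : H →ₗ[ZMod p] (Fin t → ZMod p) →ₗ[ZMod p] E), t ≤ s ∧
      Module.finrank (ZMod p) W ≤ s ∧
      (∀ x : H, L x ≤ W ⊔ LinearMap.range (Θ x)) ∧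
      Fintype.card G ≤ p ^ (2 ^ s * (k + 2 * s + 4)) * Nat.card H := by
  have hp1 : 1 ≤ p := (Fact.out : p.Prime).one_le
  have hnp : ∀ (s k : ℕ) (E : Type) [AddCommGroup E] [Module (ZMod p) E] [Finite E]
    (L : G → Submodule (ZMod p) E)
    (_ : ∀ x y, L (x + y) ≤ L x ⊔ L y) (_ : ∀ x, L (-x) = L x)
    (_ : Fintype.card G ≤ p ^ k *
      (Finset.univ.filter (fun x => Module.finrank (ZMod p) (L x) ≤ s)).card)
    (_ : ∀ v : E, v ≠ 0 →
      ((Finset.univ.filter (fun x => Module.finrank (ZMod p) (L x) ≤ s)).filter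
        (fun x => v ∈ L x)).card * p ^ (2 * k + 2 * s + 6) < Fintype.card G),
    ∃ (H : Submodule (ZMod p) G) (W : Submodule (ZMod p) E) (t : ℕ)
      (Θ : H →ₗ[ZMod p] (Fin t → ZMod p) →ₗ[ZMod p] E), t ≤ s ∧
      Module.finrank (ZMod p) W ≤ s ∧
      (∀ x : H, L x ≤ W ⊔ LinearMap.range (Θ x)) ∧
      Fintype.card G ≤ p ^ (2 ^ s * (k + 2 * s + 4)) * Nat.card H := by
    intro s k E _ _ _ L hadd hneg hk hpop
    obtain ⟨H, t, Θ, h1, h2, h3⟩ := bb_nonpop L hadd hneg s k _ (by simp) hk hpop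
    refine ⟨H, ⊥, t, Θ, h1, by simp, fun x => by simpa using h2 x, h3.trans ?_⟩
    apply Nat.mul_le_mul_right
    apply Nat.pow_le_pow_right hp1
    have : 1 ≤ 2 ^ s := Nat.one_le_two_pow
    nlinarith
  intro s
  induction s with
  | zero =>
    intro k E _ _ _ L hadd hneg hk
    have : FiniteDimensional (ZMod p) E := Module.Finite.of_finite
    apply hnp 0 k E L hadd hneg hk
    intro v hv
    have : ((Finset.univ.filter (fun x => Module.finrank (ZMod p) (L x) ≤ 0)).filter
        (fun x => v ∈ L x)) = ∅ := by
      rw [Finset.eq_empty_iff_forall_notMem]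
      intro x hx
      simp only [Finset.mem_filter, Finset.mem_univ, true_and, Nat.le_zero,
        Submodule.finrank_eq_zero] at hx
      rw [hx.1, Submodule.mem_bot] at hx
      exact hv hx.2
    rw [this]
    simpa using Fintype.card_pos
  | succ s ih =>
    intro k E _ _ _ L hadd hneg hk
    have : FiniteDimensional (ZMod p) E := Module.Finite.of_finite
    by_cases hpop : ∀ v : E, v ≠ 0 →
      ((Finset.univ.filter (fun x => Module.finrank (ZMod p) (L x) ≤ s + 1)).filter
        (fun x => v ∈ L x)).card * p ^ (2 * k + 2 * (s + 1) + 6) < Fintype.card G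
    · exact hnp (s + 1) k E L hadd hneg hk hpop
    push Not at hpop
    obtain ⟨v, hv, hpv⟩ := hpop
    let W0 := Submodule.span (ZMod p) {v}
    have hsub : ((Finset.univ.filter (fun x => Module.finrank (ZMod p) (L x) ≤ s + 1)).filter
        (fun x => v ∈ L x)) ⊆
        Finset.univ.filter (fun x => Module.finrank (ZMod p) ((L x).map W0.mkQ) ≤ s) := by
      intro x hx
      simp only [Finset.mem_filter, Finset.mem_univ, true_and] at hx ⊢
      have h1 := LinearMap.finrank_range_add_finrank_ker (W0.mkQ.domRestrict (L x))
      rw [LinearMap.range_domRestrict] at h1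
      have h2 : 0 < Module.finrank (ZMod p) (LinearMap.ker (W0.mkQ.domRestrict (L x))) := by
        rw [Nat.pos_iff_ne_zero, Ne, Submodule.finrank_eq_zero]
        intro h
        have h3 : (⟨v, hx.2⟩ : L x) ∈ LinearMap.ker (W0.mkQ.domRestrict (L x)) := by
          rw [LinearMap.mem_ker, LinearMap.domRestrict_apply, Submodule.mkQ_apply,
            Submodule.Quotient.mk_eq_zero]
          exact Submodule.mem_span_singleton_self v
        rw [h, Submodule.mem_bot] at h3
        exact hv (congrArg Subtype.val h3)
      omega
    have : Finite (E ⧸ W0) := Finite.of_surjective _ W0.mkQ_surjective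
    obtain ⟨H, W', t, Θ', ht, hW', hΘ', hc⟩ := ih (2 * k + 2 * (s + 1) + 6) (E ⧸ W0)
      (fun x => (L x).map W0.mkQ)
      (fun x y => by rw [← Submodule.map_sup]; exact Submodule.map_mono (hadd x y))
      (fun x => by simp only [hneg])
      (by
        rw [mul_comm]
        exact hpv.trans (Nat.mul_le_mul_right _ (Finset.card_le_card hsub)))
    obtain ⟨σ, hσ⟩ := W0.mkQ.exists_rightInverse_of_surjective W0.range_mkQ
    have hσ' : ∀ u, W0.mkQ (σ u) = u := fun u => by
      have := LinearMap.congr_fun hσ u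
      simpa using this
    refine ⟨H, W0 ⊔ W'.map σ, t, Θ'.compr₂ σ, by omega, ?_, ?_, ?_⟩
    · have h1 := Submodule.finrank_add_le_finrank_add_finrank W0 (W'.map σ)
      have h2 := Submodule.finrank_map_le σ W'
      have h3 : Module.finrank (ZMod p) W0 ≤ 1 := by
        have := finrank_span_finset_le_card (R := ZMod p) ({v} : Finset E)
        rw [Finset.coe_singleton] at this
        simpa [Set.finrank] using this
      omega
    · intro x u hu
      obtain ⟨w, hw, z, ⟨m, rfl⟩, hwz⟩ := Submodule.mem_sup.1 (hΘ' x (Submodule.mem_map_of_mem hu))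
      have h1 : u - (σ w + σ (Θ' x m)) ∈ W0 := by
        rw [← Submodule.Quotient.mk_eq_zero, ← Submodule.mkQ_apply, map_sub, map_add, hσ', hσ',
          hwz, sub_self]
      have h2 : u = ((u - (σ w + σ (Θ' x m))) + σ w) + σ (Θ' x m) := by abel
      rw [h2]
      refine Submodule.add_mem_sup (Submodule.add_mem_sup h1 (Submodule.mem_map_of_mem hw)) ?_
      exact ⟨m, by simp⟩
    · refine hc.trans (le_of_eq ?_)
      congr 2
      ring

theorem bb_num (p : ℕ) (hp : 2 ≤ p) (c : ℝ) (hc : 0 < c) (hc1 : c ≤ 1) :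
    ∃ s : ℕ, 2 ≤ c * (p : ℝ) ^ (s + 1) ∧
      ((2 ^ s * (4 * s + 6) : ℕ) : ℝ) ≤ (p : ℝ) ^ Real.exp (5 * (1 + Real.log c⁻¹) ^ (1 : ℝ)) := by
  have hp' : (2 : ℝ) ≤ p := by exact_mod_cast hp
  set u := Real.log c⁻¹ with hu
  have hci : 1 ≤ c⁻¹ := (one_le_inv₀ hc).2 hc1
  have hu0 : 0 ≤ u := Real.log_nonneg hci
  have hl := Real.log_two_gt_d9
  refine ⟨⌈u / Real.log 2⌉₊, ?_, ?_⟩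
  · set s := ⌈u / Real.log 2⌉₊
    have h1 : u / Real.log 2 ≤ s := Nat.le_ceil _
    rw [div_le_iff₀ (by linarith)] at h1
    have h2 : c⁻¹ ≤ 2 ^ s := by
      rw [← Real.log_le_log_iff (by positivity) (by positivity), Real.log_pow]
      exact h1
    have h3 : (2 : ℝ) ^ (s + 1) ≤ (p : ℝ) ^ (s + 1) := by gcongr
    have h4 : 1 ≤ c * 2 ^ s := by
      have := mul_le_mul_of_nonneg_left h2 hc.le
      rwa [mul_inv_cancel₀ hc.ne'] at this
    calc (2 : ℝ) ≤ c * 2 ^ (s + 1) := by rw [pow_succ]; linarith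
      _ ≤ _ := by gcongr
  · have h1 : (⌈u / Real.log 2⌉₊ : ℝ) < u / Real.log 2 + 1 := Nat.ceil_lt_add_one (by positivity)
    set s := ⌈u / Real.log 2⌉₊
    have h2 : u / Real.log 2 ≤ 1.5 * u := by
      rw [div_le_iff₀ (by linarith)]
      nlinarith
    have hs : (s : ℝ) ≤ 1.5 * u + 1 := by linarith
    rw [Real.rpow_one]
    have hy : (Real.exp (5 * (1 + u))) / 2 ≤ (p : ℝ) ^ Real.exp (5 * (1 + u)) := by
      set y := Real.exp (5 * (1 + u)) with hy
      have hypos : 0 < y := Real.exp_pos _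
      calc y / 2 ≤ Real.log 2 * y + 1 := by nlinarith
        _ ≤ Real.exp (Real.log 2 * y) := Real.add_one_le_exp _
        _ = (2 : ℝ) ^ y := by rw [Real.rpow_def_of_pos (by norm_num)]
        _ ≤ (p : ℝ) ^ y := by gcongr
    refine le_trans ?_ hy
    have e1 : (2 : ℝ) ≤ Real.exp 1 := by have := Real.exp_one_gt_d9; linarith
    have e2 : (2 : ℝ) ^ s ≤ Real.exp s := by
      calc (2 : ℝ) ^ s ≤ (Real.exp 1) ^ s := by gcongr
        _ = Real.exp s := by rw [← Real.exp_nat_mul, mul_one]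
    have e3 : (s : ℝ) + 1 ≤ Real.exp s := Real.add_one_le_exp _
    have e4 : (12 : ℝ) ≤ Real.exp 3 := by
      have : Real.exp 3 = Real.exp 1 ^ 3 := by rw [← Real.exp_nat_mul]; norm_num
      rw [this]
      have h := Real.exp_one_gt_d9
      have : (2.7 : ℝ) ^ 3 ≤ Real.exp 1 ^ 3 := by gcongr; linarith
      norm_num at this ⊢
      linarith
    have e5 : Real.exp (2 * s + 3) ≤ Real.exp (5 * (1 + u)) := by
      apply Real.exp_le_exp.2; linarith
    have e6 : Real.exp (2 * s + 3) = Real.exp s * Real.exp s * Real.exp 3 := by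
      rw [← Real.exp_add, ← Real.exp_add]; congr 1; ring
    have e7 : (2 : ℝ) ^ s * (4 * s + 6) ≤ Real.exp s * (6 * Real.exp s) := by
      gcongr
      linarith
    push_cast
    have e8 : 0 < Real.exp s * Real.exp s := by positivity
    nlinarith

open Classical in
theorem bb_count_rows {p n : ℕ} [Fact p.Prime]
    (A : Set ((Fin n → ZMod p) × (Fin n → ZMod p)))
    (X : Submodule (ZMod p) (Fin n → ZMod p))
    (R : X → Submodule (ZMod p) (Fin n → ZMod p))
    (hX : ∀ x y, (x, y) ∈ A → x ∈ X)
    (hR : ∀ (x : X) y, ((x : Fin n → ZMod p), y) ∈ A ↔ y ∈ R x) (s : ℕ) :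
    Nat.card A * p ^ (s + 1) ≤ (Finset.univ.filter (fun x : X =>
      Module.finrank (ZMod p) (R x).dualAnnihilator ≤ s)).card * (p ^ n * p ^ (s + 1))
        + p ^ n * p ^ n := by
  have hp1 : 1 ≤ p := (Fact.out : p.Prime).one_le
  have hcR : ∀ F : Submodule (ZMod p) (Fin n → ZMod p),
      Nat.card F = p ^ Module.finrank (ZMod p) F := fun F => by
    have := Module.natCard_eq_pow_finrank (K := ZMod p) (V := F)
    simpa using this
  have h1 : Nat.card A ≤ ∑ x : X, Nat.card (R x) := by
    rw [← Nat.card_sigma]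
    apply Nat.card_le_card_of_injective (fun a : A =>
      (⟨⟨a.1.1, hX a.1.1 a.1.2 a.2⟩, ⟨a.1.2, (hR ⟨a.1.1, hX a.1.1 a.1.2 a.2⟩ _).1 a.2⟩⟩ :
        Σ x : X, R x))
    rintro ⟨⟨a, b⟩, h⟩ ⟨⟨a', b'⟩, h'⟩ he
    simp only [Sigma.mk.injEq, Subtype.mk.injEq] at he
    obtain ⟨rfl, he⟩ := he
    simpa using he
  have hann : ∀ x : X, Module.finrank (ZMod p) (R x) +
      Module.finrank (ZMod p) (R x).dualAnnihilator = n := fun x => by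
    have := Subspace.finrank_add_finrank_dualAnnihilator_eq (R x)
    simpa using this
  have h2 : ∀ x : X, Nat.card (R x) * p ^ (s + 1) ≤
      (if Module.finrank (ZMod p) (R x).dualAnnihilator ≤ s then p ^ n * p ^ (s + 1) else 0)
        + p ^ n := by
    intro x
    have h3 := hann x
    rw [hcR]
    split_ifs with h
    · refine le_trans ?_ (Nat.le_add_right _ _)
      gcongr
      omega
    · rw [← pow_add, zero_add]
      apply Nat.pow_le_pow_right hp1
      omega
  calc Nat.card A * p ^ (s + 1) ≤ (∑ x : X, Nat.card (R x)) * p ^ (s + 1) :=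
        Nat.mul_le_mul_right _ h1
    _ ≤ ∑ x : X, ((if Module.finrank (ZMod p) (R x).dualAnnihilator ≤ s
          then p ^ n * p ^ (s + 1) else 0) + p ^ n) := by
        rw [Finset.sum_mul]; exact Finset.sum_le_sum (fun x _ => h2 x)
    _ ≤ _ := by
        rw [Finset.sum_add_distrib, ← Finset.sum_filter, Finset.sum_const, Finset.sum_const,
          smul_eq_mul, smul_eq_mul, Finset.card_univ]
        gcongr
        rw [← Nat.card_eq_fintype_card, hcR]
        apply Nat.pow_le_pow_right hp1
        have := Submodule.finrank_le X
        simpa using this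

/-- **Bilinear Bogolyubov for sets whose rows and columns are subspaces.**
If `A ⊆ 𝔽_pⁿ × 𝔽_pⁿ` has density `c` and every row `A_{x·}` and every column `A_{·y}` is
either empty or a subspace, then `A` itself contains `(U × V) ∩ B` where `U, V` are subspaces
and `B` is the zero set of a bilinear map `β : G × G → W` with
`codim U, codim V, dim W ≤ p^(exp(C (1 + log c⁻¹)^C'))`. -/
theorem bilinear_bogolyubov_bisubspace :
    ∃ C C' : ℝ, 0 < C ∧ 0 < C' ∧
      ∀ (p n : ℕ), p.Prime →
        ∀ (A : Set ((Fin n → ZMod p) × (Fin n → ZMod p))) (c : ℝ), 0 < c →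
          (Nat.card A : ℝ) = c * ((p : ℝ) ^ n) ^ 2 →
          (∀ x : Fin n → ZMod p,
            {y : Fin n → ZMod p | (x, y) ∈ A} = ∅ ∨
              ∃ Wx : Submodule (ZMod p) (Fin n → ZMod p),
                {y : Fin n → ZMod p | (x, y) ∈ A} = (Wx : Set (Fin n → ZMod p))) →
          (∀ y : Fin n → ZMod p,
            {x : Fin n → ZMod p | (x, y) ∈ A} = ∅ ∨
              ∃ Wy : Submodule (ZMod p) (Fin n → ZMod p),
                {x : Fin n → ZMod p | (x, y) ∈ A} = (Wy : Set (Fin n → ZMod p))) →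
          ∃ (U V : Submodule (ZMod p) (Fin n → ZMod p)) (m : ℕ)
            (β : (Fin n → ZMod p) →ₗ[ZMod p] (Fin n → ZMod p) →ₗ[ZMod p] (Fin m → ZMod p)),
            {xy : (Fin n → ZMod p) × (Fin n → ZMod p) |
                xy.1 ∈ U ∧ xy.2 ∈ V ∧ β xy.1 xy.2 = 0} ⊆ A ∧
            ((n - Module.finrank (ZMod p) U : ℕ) : ℝ) ≤
              (p : ℝ) ^ Real.exp (C * (1 + Real.log c⁻¹) ^ C') ∧
            ((n - Module.finrank (ZMod p) V : ℕ) : ℝ) ≤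
              (p : ℝ) ^ Real.exp (C * (1 + Real.log c⁻¹) ^ C') ∧
            (m : ℝ) ≤ (p : ℝ) ^ Real.exp (C * (1 + Real.log c⁻¹) ^ C') := by
  classical
  refine ⟨5, 1, by norm_num, by norm_num, ?_⟩
  intro p n hp A c hc hcard hrow hcol
  have : Fact p.Prime := ⟨hp⟩
  have hp1 : 1 ≤ p := hp.one_le
  have hpn : (0 : ℝ) < (p : ℝ) ^ n := by have := hp.pos; positivity
  have hcR : ∀ F : Submodule (ZMod p) (Fin n → ZMod p),
      Nat.card F = p ^ Module.finrank (ZMod p) F := fun F => by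
    have := Module.natCard_eq_pow_finrank (K := ZMod p) (V := F)
    simpa using this
  have hc1 : c ≤ 1 := by
    have h1 : Nat.card A ≤ Nat.card ((Fin n → ZMod p) × (Fin n → ZMod p)) :=
      Nat.card_le_card_of_injective _ Subtype.val_injective
    have h2 : Nat.card ((Fin n → ZMod p) × (Fin n → ZMod p)) = (p ^ n) ^ 2 := by
      rw [Nat.card_prod, Nat.card_eq_fintype_card]
      simp [sq]
    rw [h2] at h1
    have h3 : (Nat.card A : ℝ) ≤ ((p : ℝ) ^ n) ^ 2 := by exact_mod_cast h1
    rw [hcard] at h3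
    by_contra hcon
    push Not at hcon
    have : 0 < ((p : ℝ) ^ n) ^ 2 := by positivity
    nlinarith
  obtain ⟨s, hs1, hs2⟩ := bb_num p hp.two_le c hc hc1
  have hrow0 : ∀ x y, (x, y) ∈ A → (x, (0 : Fin n → ZMod p)) ∈ A := by
    intro x y hxy
    rcases hrow x with h | ⟨F, hF⟩
    · exact absurd (show y ∈ {y | (x, y) ∈ A} from hxy) (by rw [h]; simp)
    · have : (0 : Fin n → ZMod p) ∈ {y | (x, y) ∈ A} := by rw [hF]; exact zero_mem F
      exact this
  have hcolF : ∀ x y, (x, y) ∈ A → ∃ F : Submodule (ZMod p) (Fin n → ZMod p),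
      ∀ z, (z, y) ∈ A ↔ z ∈ F := by
    intro x y hxy
    rcases hcol y with h | ⟨F, hF⟩
    · exact absurd (show x ∈ {x | (x, y) ∈ A} from hxy) (by rw [h]; simp)
    · refine ⟨F, fun z => ?_⟩
      rw [← SetLike.mem_coe, ← hF]; rfl
  have hrowF : ∀ x y, (x, y) ∈ A → ∃ F : Submodule (ZMod p) (Fin n → ZMod p),
      ∀ z, (x, z) ∈ A ↔ z ∈ F := by
    intro x y hxy
    rcases hrow x with h | ⟨F, hF⟩
    · exact absurd (show y ∈ {y | (x, y) ∈ A} from hxy) (by rw [h]; simp)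
    · refine ⟨F, fun z => ?_⟩
      rw [← SetLike.mem_coe, ← hF]; rfl
  have hAne : ∃ x y, (x, y) ∈ A := by
    by_contra hcon
    push Not at hcon
    have : A = ∅ := by
      ext ⟨x, y⟩
      simpa using hcon x y
    rw [this] at hcard
    simp at hcard
    rcases hcard with h | h
    · exact hc.ne' h
    · exact hp.pos.ne' h.1
  obtain ⟨x1, y1, hxy1⟩ := hAne
  obtain ⟨X, hX⟩ := hcolF x1 0 (hrow0 _ _ hxy1)
  have hRex : ∀ x : X, ∃ F : Submodule (ZMod p) (Fin n → ZMod p),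
      ∀ z, ((x : Fin n → ZMod p), z) ∈ A ↔ z ∈ F := fun x => hrowF x 0 ((hX _).2 x.2)
  choose R hR using hRex
  let L : X → Submodule (ZMod p) (Module.Dual (ZMod p) (Fin n → ZMod p)) :=
    fun x => (R x).dualAnnihilator
  have hLadd : ∀ x y, L (x + y) ≤ L x ⊔ L y := by
    intro x y
    simp only [L]
    rw [← Subspace.dualAnnihilator_inf_eq]
    apply Submodule.dualAnnihilator_anti
    rintro z ⟨hz1, hz2⟩
    have h1 := (hR x z).2 hz1
    have h2 := (hR y z).2 hz2
    obtain ⟨F, hF⟩ := hcolF _ _ h1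
    rw [← hR]
    exact (hF _).2 (add_mem ((hF _).1 h1) ((hF _).1 h2))
  have hLneg : ∀ x, L (-x) = L x := by
    intro x
    simp only [L]
    congr 1
    have key : ∀ x : X, R x ≤ R (-x) := by
      intro x z hz
      have h1 := (hR x z).2 hz
      obtain ⟨F, hF⟩ := hcolF _ _ h1
      rw [← hR]
      exact (hF _).2 (neg_mem ((hF _).1 h1))
    apply le_antisymm
    · have := key (-x); rwa [neg_neg] at this
    · exact key x
  have hfinD : Finite (Module.Dual (ZMod p) (Fin n → ZMod p)) :=
    Finite.of_injective (fun f => (f : (Fin n → ZMod p) → ZMod p)) DFunLike.coe_injective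
  set S := Finset.univ.filter (fun x : X => Module.finrank (ZMod p) (L x) ≤ s) with hS
  have hcount := bb_count_rows A X R (fun x y h => (hX x).1 (hrow0 _ _ h)) hR s
  change Nat.card A * p ^ (s + 1) ≤ S.card * (p ^ n * p ^ (s + 1)) + p ^ n * p ^ n at hcount
  have hdens : p ^ n ≤ p ^ (s + 1) * S.card := by
    have h1 : (Nat.card A : ℝ) * (p : ℝ) ^ (s + 1) ≤
        S.card * ((p : ℝ) ^ n * (p : ℝ) ^ (s + 1)) + (p : ℝ) ^ n * (p : ℝ) ^ n := by
      exact_mod_cast hcount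
    rw [hcard] at h1
    have h2 : (p : ℝ) ^ n ≤ (p : ℝ) ^ (s + 1) * S.card := by
      have h3 : 2 * ((p : ℝ) ^ n) ^ 2 ≤ c * (p : ℝ) ^ (s + 1) * ((p : ℝ) ^ n) ^ 2 := by gcongr
      refine le_of_mul_le_mul_left ?_ hpn
      nlinarith
    exact_mod_cast h2
  have hXn : Module.finrank (ZMod p) X ≤ n := by
    have := Submodule.finrank_le X
    simpa using this
  have hXcard : Fintype.card X ≤ p ^ n := by
    rw [← Nat.card_eq_fintype_card, hcR]
    exact Nat.pow_le_pow_right hp1 hXn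
  obtain ⟨H, W, t, Θ, ht, hW, hΘ, hHc⟩ := bb_core s (s + 1)
    (Module.Dual (ZMod p) (Fin n → ZMod p)) L hLadd hLneg (hXcard.trans hdens)
  let ι : H →ₗ[ZMod p] (Fin n → ZMod p) := X.subtype ∘ₗ H.subtype
  have hι : Function.Injective ι := fun x y h => Subtype.ext (Subtype.ext h)
  obtain ⟨π, hπ⟩ := ι.exists_leftInverse_of_injective (LinearMap.ker_eq_bot.2 hι)
  have hπ' : ∀ x, π (ι x) = x := fun x => by
    have := LinearMap.congr_fun hπ x
    simpa using this
  let β : (Fin n → ZMod p) →ₗ[ZMod p] (Fin n → ZMod p) →ₗ[ZMod p] (Fin t → ZMod p) :=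
    LinearMap.mk₂ (ZMod p) (fun x y i => Θ (π x) (Pi.single i 1) y)
      (by intro x x' y; ext i; simp) (by intro a x y; ext i; simp)
      (by intro x y y'; ext i; simp) (by intro a x y; ext i; simp)
  have hsle : s ≤ 2 ^ s * (4 * s + 6) := by
    have : 1 ≤ 2 ^ s := Nat.one_le_two_pow
    nlinarith
  refine ⟨LinearMap.range ι, W.dualCoannihilator, t, β, ?_, ?_, ?_, ?_⟩
  · rintro ⟨x, y⟩ ⟨⟨h, rfl⟩, hy, hβ⟩
    simp only at hy hβ
    change (((h : X) : Fin n → ZMod p), y) ∈ A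
    rw [hR, ← Subspace.forall_mem_dualAnnihilator_apply_eq_zero_iff]
    intro f hf
    obtain ⟨w, hw, z, ⟨m, rfl⟩, rfl⟩ := Submodule.mem_sup.1 (hΘ h hf)
    rw [Submodule.mem_dualCoannihilator] at hy
    rw [LinearMap.add_apply, hy w hw, zero_add]
    have hz : ∀ i, Θ h (Pi.single i 1) y = 0 := by
      intro i
      have := congrFun hβ i
      simpa [β, hπ'] using this
    have hlin : (LinearMap.applyₗ y) ∘ₗ (Θ h) = 0 := by
      apply LinearMap.pi_ext'
      intro i
      ext
      simpa using hz i
    exact LinearMap.congr_fun hlin m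
  · refine le_trans ?_ hs2
    rw [Nat.cast_le, LinearMap.finrank_range_of_inj hι]
    have h1 : Nat.card H = p ^ Module.finrank (ZMod p) H := by
      have := Module.natCard_eq_pow_finrank (K := ZMod p) (V := H)
      simpa using this
    have h2 : S.card ≤ Fintype.card X := Finset.card_le_univ _
    have h3 : p ^ n ≤ p ^ ((s + 1) + (2 ^ s * (s + 1 + 2 * s + 4) +
        Module.finrank (ZMod p) H)) := by
      rw [pow_add, pow_add _ (2 ^ s * (s + 1 + 2 * s + 4)), ← h1]
      exact hdens.trans (Nat.mul_le_mul_left _ (h2.trans hHc))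
    have h4 := (Nat.pow_le_pow_iff_right hp.one_lt).1 h3
    have : 1 ≤ 2 ^ s := Nat.one_le_two_pow
    have h5 : (s + 1) + 2 ^ s * (s + 1 + 2 * s + 4) ≤ 2 ^ s * (4 * s + 6) := by nlinarith
    omega
  · refine le_trans ?_ hs2
    rw [Nat.cast_le]
    have h1 := Subspace.finrank_add_finrank_dualCoannihilator_eq W
    rw [Module.finrank_fin_fun] at h1
    omega
  · refine le_trans ?_ hs2
    rw [Nat.cast_le]
    omega
end

section
/- Let $p$ be a prime, $G = \mathbb{F}_p^n$, $N = |G|$. Let $S \subseteq G$ have size $cN$ with $c > 0$, and let $\mathbf{B} \subseteq G \times G$ be the bilinear Bohr variety defined by the $k$ biaffine maps $\beta_i(x,y) = x \cdot \alpha_i(y)$, $i = 1, \dots, k$, where each $\alpha_i \colon G \to G$ is an affine map; that is, $\mathbf{B} = \{(x,y) : x \cdot \alpha_i(y) = 0 \text{ for all } i \in [k]\}$. For $x \in G$, let $\mathbf{r}(x) = |\{y \in S : (x,y) \in \mathbf{B}\}|$, and let $X = \{x \in G : \mathbf{r}(x) \geq \frac{c}{2p^k}N\}$. Then $X$ contains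 a subspace $V \leq G$ of codimension at most $p^k(k + 4c^{-1}p^{2k})$. -/
open Matrix in
lemma bohr_orth {p m : ℕ} [Fact p.Prime] (z : Fin m → ZMod p) :
    ∑ l : Fin m → ZMod p, (ZMod.stdAddChar (l ⬝ᵥ z) : ℂ) = if z = 0 then (p : ℂ) ^ m else 0 := by
  classical
  split_ifs with h
  · subst h
    simp [ZMod.card]
  · obtain ⟨i, hi⟩ : ∃ i, z i ≠ 0 := by
      by_contra! hh
      exact h (funext hh)
    let φ : (Fin m → ZMod p) →+ ZMod p :=
      { toFun := fun l => l ⬝ᵥ z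
        map_zero' := by simp
        map_add' := fun a b => by simp [add_dotProduct] }
    let χ : AddChar (Fin m → ZMod p) ℂ := (ZMod.stdAddChar (N := p)).compAddMonoidHom φ
    have hχ : χ ≠ 0 := by
      intro h0
      have h1 : χ (Pi.single i (z i)⁻¹) = 1 := by rw [h0]; simp
      have h2 : χ (Pi.single i (z i)⁻¹) = ZMod.stdAddChar (1 : ZMod p) := by
        simp [χ, φ, hi]
      have h3 : (ZMod.stdAddChar (1 : ZMod p) : ℂ) = ZMod.stdAddChar (0 : ZMod p) := by
        rw [← h2, h1]; simp
      exact one_ne_zero (ZMod.injective_stdAddChar h3)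
    have := AddChar.sum_eq_zero_iff_ne_zero.2 hχ
    simpa [χ, φ] using this

open Matrix in
lemma bohr_parseval {p n : ℕ} [Fact p.Prime] (S : Finset (Fin n → ZMod p)) :
    ∑ l : Fin n → ZMod p, ‖∑ y ∈ S, (ZMod.stdAddChar (l ⬝ᵥ y) : ℂ)‖ ^ 2
      = (p : ℝ) ^ n * S.card := by
  classical
  have h : ∀ l : Fin n → ZMod p,
      ((‖∑ y ∈ S, (ZMod.stdAddChar (l ⬝ᵥ y) : ℂ)‖ ^ 2 : ℝ) : ℂ)
      = ∑ y ∈ S, ∑ y' ∈ S, (ZMod.stdAddChar (l ⬝ᵥ (y - y')) : ℂ) := by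
    intro l
    push_cast
    rw [← Complex.mul_conj', map_sum, Finset.sum_mul_sum]
    refine Finset.sum_congr rfl fun y _ => Finset.sum_congr rfl fun y' _ => ?_
    rw [dotProduct_sub, sub_eq_add_neg, AddChar.map_add_eq_mul, AddChar.map_neg_eq_conj]
  have : ((∑ l : Fin n → ZMod p, ‖∑ y ∈ S, (ZMod.stdAddChar (l ⬝ᵥ y) : ℂ)‖ ^ 2 : ℝ) : ℂ)
      = ((p : ℝ) ^ n * S.card : ℝ) := by
    rw [Complex.ofReal_sum, Finset.sum_congr rfl fun l _ => h l, Finset.sum_comm]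
    have : ∀ y ∈ S, ∑ l : Fin n → ZMod p, ∑ y' ∈ S, (ZMod.stdAddChar (l ⬝ᵥ (y - y')) : ℂ)
        = (p : ℂ) ^ n := by
      intro y hy
      rw [Finset.sum_comm]
      simp_rw [bohr_orth, sub_eq_zero]
      simp [hy]
    rw [Finset.sum_congr rfl this]
    simp [mul_comm]
  exact_mod_cast this

open Matrix

/-- **Bilinear Bohr varieties generate structure.** Let `S ⊆ G = 𝔽_pⁿ` have size `cN` and let
`B = {(x,y) : x · αᵢ(y) = 0 for all i ∈ [k]}` for affine maps `αᵢ(y) = Lᵢ y + aᵢ`. Let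
`r(x) = #{y ∈ S : (x,y) ∈ B}` and `X = {x : r(x) ≥ (c/(2pᵏ)) N}`. Then `X` contains a
subspace `V` of codimension at most `pᵏ(k + 4c⁻¹p²ᵏ)`. -/
theorem bohr_variety_generates_structure
    {p n : ℕ} [Fact p.Prime] (k : ℕ)
    (α : Fin k → ((Fin n → ZMod p) →ₗ[ZMod p] (Fin n → ZMod p)) × (Fin n → ZMod p))
    (S : Finset (Fin n → ZMod p)) (c : ℝ) (hc : 0 < c)
    (hS : (S.card : ℝ) = c * (p : ℝ) ^ n) :
    ∃ V : Submodule (ZMod p) (Fin n → ZMod p),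
      (V : Set (Fin n → ZMod p)) ⊆
        {x : Fin n → ZMod p |
          (c / (2 * (p : ℝ) ^ k)) * (p : ℝ) ^ n ≤
            (Nat.card {y : Fin n → ZMod p // y ∈ S ∧
              ∀ i : Fin k, (∑ j, x j * ((α i).1 y + (α i).2) j : ZMod p) = 0} : ℝ)} ∧
      ((n - Module.finrank (ZMod p) V : ℕ) : ℝ) ≤
        (p : ℝ) ^ k * ((k : ℝ) + 4 * c⁻¹ * (p : ℝ) ^ (2 * k)) := by
  classical
  have hp : (0 : ℝ) < p := by exact_mod_cast (Fact.out : p.Prime).pos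
  set f : (Fin n → ZMod p) → ℂ := fun l => ∑ y ∈ S, (ZMod.stdAddChar (l ⬝ᵥ y) : ℂ) with hf
  set E : ℝ := c / (2 * (p : ℝ) ^ k) * (p : ℝ) ^ n with hE
  have hE0 : 0 < E := by positivity
  set T : Finset (Fin n → ZMod p) := Finset.univ.filter fun l => l ≠ 0 ∧ E ≤ ‖f l‖ with hT
  have hTcard : (T.card : ℝ) ≤ 4 * c⁻¹ * (p : ℝ) ^ (2 * k) := by
    have h1 : (T.card : ℝ) * E ^ 2 ≤ (p : ℝ) ^ n * S.card := by
      rw [← bohr_parseval S, ← nsmul_eq_mul]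
      refine (Finset.card_nsmul_le_sum T (fun l => ‖f l‖ ^ 2) _ ?_).trans ?_
      · intro l hl
        have := (Finset.mem_filter.1 hl).2.2
        exact pow_le_pow_left₀ hE0.le this 2
      · exact Finset.sum_le_sum_of_subset_of_nonneg (Finset.subset_univ _)
          fun _ _ _ => by positivity
    rw [hS] at h1
    have h2 : 4 * c⁻¹ * (p : ℝ) ^ (2 * k) * E ^ 2 = (p : ℝ) ^ n * (c * (p : ℝ) ^ n) := by
      rw [hE]; field_simp; ring
    rw [← h2] at h1
    exact le_of_mul_le_mul_right h1 (by positivity)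
  have hη : ∀ l : T, ∃ e : Fin n → ZMod p, l.1 ⬝ᵥ e ≠ 0 := by
    intro l
    by_contra! hh
    exact (Finset.mem_filter.1 l.2).2.1 (dotProduct_eq_zero _ hh)
  choose η hη using hη
  let M : (Fin k → ZMod p) → Matrix (Fin n) (Fin n) (ZMod p) :=
    fun l => ∑ i, l i • LinearMap.toMatrix' (α i).1
  have hM : ∀ l y, (M l) *ᵥ y = ∑ i, l i • (α i).1 y := by
    intro l y
    simp only [M, sum_mulVec, smul_mulVec, LinearMap.toMatrix'_mulVec]
  let U : Matrix (Fin k ⊕ ((Fin k → ZMod p) × T)) (Fin n) (ZMod p) :=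
    Matrix.of (Sum.elim (fun i => (α i).2) (fun q => M q.1 *ᵥ η q.2))
  refine ⟨LinearMap.ker U.mulVecLin, ?_, ?_⟩
  · intro x hx
    have hx' : U *ᵥ x = 0 := by simpa using hx
    have ha : ∀ i, x ⬝ᵥ (α i).2 = 0 := by
      intro i
      rw [dotProduct_comm]
      exact congrFun hx' (Sum.inl i)
    have hb : ∀ l t, (x ᵥ* M l) ⬝ᵥ η t = 0 := by
      intro l t
      rw [← dotProduct_mulVec, dotProduct_comm]
      exact congrFun hx' (Sum.inr (l, t))
    set R : Finset (Fin n → ZMod p) := S.filter fun y =>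
      (fun i => x ⬝ᵥ ((α i).1 y + (α i).2)) = (0 : Fin k → ZMod p) with hR
    have hcard : Nat.card {y : Fin n → ZMod p // y ∈ S ∧
              ∀ i : Fin k, (∑ j, x j * ((α i).1 y + (α i).2) j : ZMod p) = 0} = R.card := by
      rw [Nat.card_eq_fintype_card, Fintype.card_subtype]
      congr 1
      ext y
      simp [hR, funext_iff, dotProduct]
    rw [Set.mem_setOf_eq, hcard]
    have key : ((p : ℂ) ^ k * R.card) = ∑ l : Fin k → ZMod p, f (x ᵥ* M l) := by
      simp only [hf]
      rw [Finset.sum_comm]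
      have : ∀ y ∈ S, ∑ l : Fin k → ZMod p, (ZMod.stdAddChar ((x ᵥ* M l) ⬝ᵥ y) : ℂ)
          = if (fun i => x ⬝ᵥ ((α i).1 y + (α i).2)) = (0 : Fin k → ZMod p)
            then (p : ℂ) ^ k else 0 := by
        intro y _
        rw [← bohr_orth]
        refine Finset.sum_congr rfl fun l _ => ?_
        congr 1
        rw [← dotProduct_mulVec, hM, dotProduct_sum]
        simp only [dotProduct_add, ha, add_zero, dotProduct_smul]
        rfl
      rw [Finset.sum_congr rfl this, ← Finset.sum_filter, Finset.sum_const, nsmul_eq_mul, mul_comm]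
    have f0 : f 0 = S.card := by simp [hf]
    have hre : ∀ l, -E ≤ (f (x ᵥ* M l)).re := by
      intro l
      by_cases h0 : x ᵥ* M l = 0
      · rw [h0, f0, Complex.natCast_re]
        have : (0 : ℝ) ≤ S.card := by positivity
        linarith
      · have hn : ‖f (x ᵥ* M l)‖ < E := by
          by_contra! hh
          have hm : x ᵥ* M l ∈ T := by simp [hT, h0, hh]
          exact hη ⟨_, hm⟩ (hb l ⟨_, hm⟩)
        have := (abs_le.1 (Complex.abs_re_le_norm (f (x ᵥ* M l)))).1
        linarith
    have key2 : (p : ℝ) ^ k * R.card = ∑ l : Fin k → ZMod p, (f (x ᵥ* M l)).re := by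
      rw [← Complex.re_sum, ← key]
      have : ((p : ℂ) ^ k * R.card) = (((p : ℝ) ^ k * R.card : ℝ) : ℂ) := by push_cast; rfl
      rw [this, Complex.ofReal_re]
    have h3 : (S.card : ℝ) - (p : ℝ) ^ k * E ≤ (p : ℝ) ^ k * R.card := by
      rw [key2, ← Finset.add_sum_erase _ _ (Finset.mem_univ (0 : Fin k → ZMod p))]
      have hM0 : M 0 = 0 := by simp [M]
      rw [hM0, vecMul_zero, f0, Complex.natCast_re]
      have := Finset.card_nsmul_le_sum (Finset.univ.erase (0 : Fin k → ZMod p))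
        (fun l => (f (x ᵥ* M l)).re) (-E) (fun l _ => hre l)
      rw [nsmul_eq_mul] at this
      have hc' : ((Finset.univ.erase (0 : Fin k → ZMod p)).card : ℝ) ≤ (p : ℝ) ^ k := by
        have h := Finset.card_erase_le (s := Finset.univ) (a := (0 : Fin k → ZMod p))
        have h' : (Finset.univ : Finset (Fin k → ZMod p)).card = p ^ k := by
          simp [ZMod.card]
        rw [h'] at h
        exact_mod_cast h
      nlinarith
    have h4 : (p : ℝ) ^ k * E = S.card - (p : ℝ) ^ k * E := by
      rw [hS, hE]; field_simp; ring
    rw [← h4] at h3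
    exact le_of_mul_le_mul_left h3 (by positivity)
  · have h1 := LinearMap.finrank_range_add_finrank_ker U.mulVecLin
    have h2 := Submodule.finrank_le (LinearMap.range U.mulVecLin)
    simp only [Module.finrank_fintype_fun_eq_card, Fintype.card_sum, Fintype.card_prod,
      Fintype.card_fin, Fintype.card_fun, ZMod.card, Fintype.card_coe] at h1 h2
    have h3 : n - Module.finrank (ZMod p) (LinearMap.ker U.mulVecLin) ≤ k + p ^ k * T.card := by
      omega
    have h4 : ((n - Module.finrank (ZMod p) (LinearMap.ker U.mulVecLin) : ℕ) : ℝ)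
        ≤ k + (p : ℝ) ^ k * T.card := by exact_mod_cast h3
    have h5 : (1 : ℝ) ≤ (p : ℝ) ^ k :=
      one_le_pow₀ (by exact_mod_cast (Fact.out : p.Prime).one_le)
    have h6 : (0 : ℝ) ≤ k := by positivity
    have h7 := mul_le_mul_of_nonneg_left hTcard (by positivity : (0 : ℝ) ≤ (p : ℝ) ^ k)
    nlinarith
end

section
/- Let $p$ be a prime and $a, b \in \mathbb{N}$, and set $K = (2p)^{\frac{1}{2}(a+1)^2 b}$. Let $X, Y, Z$ be finite-dimensional $\mathbb{F}_p$-vector spaces and let $\beta \colon X \times Y \to Z$ be a bilinear map such that the image $\{\beta(x,y) : x \in X, y \in Y\}$ contains at least $K$ linearly independent vectors. Then there exists $x \in X$ such that the linear map $\beta_{x\cdot} \colon Y \to Z$, $y \mapsto \beta(x,y)$, has rank at least $a$, or there exists $y \in Y$ such that the linear map $\beta_{\cdot y} \colon X \to Z$, $x \mapsto \beta(x,y)$, has rank at least $b$. -/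
universe u v

open Module in
theorem rb_step {F : Type*} [Field F] {Y Z : Type*} [AddCommGroup Y] [Module F Y] [FiniteDimensional F Y]
    [AddCommGroup Z] [Module F Z] [FiniteDimensional F Z] (f g : Y →ₗ[F] Z) (s : ℕ)
    (hf : finrank F (LinearMap.range f) = s + 1)
    (hg : finrank F (LinearMap.range g) ≤ s + 1)
    (hfg : finrank F (LinearMap.range (f + g)) ≤ s + 1) :
    finrank F (LinearMap.range ((LinearMap.range f).mkQ ∘ₗ g ∘ₗ (LinearMap.ker f).subtype)) ≤ s := by
  by_contra! hc
  set N := LinearMap.ker f with hN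
  set U := LinearMap.range f with hU
  set V := LinearMap.range (g ∘ₗ N.subtype) with hV
  have e1 : LinearMap.range (U.mkQ ∘ₗ g ∘ₗ N.subtype) = V.map U.mkQ := by
    rw [LinearMap.range_comp]
  rw [e1] at hc
  have h1 : finrank F (V.map U.mkQ) ≤ finrank F V := Submodule.finrank_map_le _ _
  have hVg : V = LinearMap.range g := by
    apply Submodule.eq_of_le_of_finrank_le (LinearMap.range_comp_le_range _ _)
    change _ ≤ finrank F V
    omega
  have hVfg : V = LinearMap.range (f + g) := by
    apply Submodule.eq_of_le_of_finrank_le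
    · rintro _ ⟨y, rfl⟩
      refine ⟨y.1, ?_⟩
      have : f y.1 = 0 := y.2
      simp [this]
    · omega
  have hUV : U ≤ V := by
    rintro _ ⟨y, rfl⟩
    have a1 : (f + g) y ∈ V := hVfg ▸ ⟨y, rfl⟩
    have a2 : g y ∈ V := hVg ▸ ⟨y, rfl⟩
    have := V.sub_mem a1 a2
    simpa using this
  have hUV2 : U = V := Submodule.eq_of_le_of_finrank_le hUV (by rw [hVg]; omega)
  rw [← hUV2, Submodule.mkQ_map_self] at hc
  simp at hc

open Module in
theorem rb_main {F : Type*} [Field F] {X : Type*} [AddCommGroup X] [Module F X] [FiniteDimensional F X]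
    (c : ℕ) (s : ℕ) : ∀ {Y : Type u} {Z : Type v} [AddCommGroup Y] [Module F Y] [FiniteDimensional F Y]
    [AddCommGroup Z] [Module F Z] [FiniteDimensional F Z] (β : X →ₗ[F] Y →ₗ[F] Z)
    (_ : ∀ x, finrank F (LinearMap.range (β x)) ≤ s)
    (_ : ∀ y, finrank F (LinearMap.range (β.flip y)) ≤ c),
    finrank F (Submodule.span F {z | ∃ x y, z = β x y}) ≤ s ^ 2 * (c + 1) := by
  induction s with
  | zero =>
    intro Y Z _ _ _ _ _ _ β h1 h2
    have : Submodule.span F {z | ∃ x y, z = β x y} = ⊥ := by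
      rw [Submodule.span_eq_bot]
      rintro _ ⟨x, y, rfl⟩
      have h := Submodule.finrank_eq_zero.1 (Nat.le_zero.1 (h1 x))
      rw [LinearMap.range_eq_bot] at h
      simp [h]
    rw [this]; simp
  | succ s ih =>
    intro Y Z _ _ _ _ _ _ β h1 h2
    by_cases hs : ∀ x, finrank F (LinearMap.range (β x)) ≤ s
    · refine (ih β hs h2).trans ?_
      gcongr; omega
    push Not at hs
    obtain ⟨x0, hx0⟩ := hs
    have hx0' : finrank F (LinearMap.range (β x0)) = s + 1 := le_antisymm (h1 x0) hx0
    set U := LinearMap.range (β x0) with hU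
    set N := LinearMap.ker (β x0) with hN
    let β' : X →ₗ[F] N →ₗ[F] (Z ⧸ U) := (β.compl₂ N.subtype).compr₂ U.mkQ
    have hb' : ∀ x (y : N), β' x y = U.mkQ (β x y) := fun _ _ => rfl
    have key := ih β' (fun x => rb_step (β x0) (β x) s hx0' (h1 x) (by rw [← map_add]; exact h1 _))
      (fun y => by
        have : LinearMap.range (β'.flip y) = (LinearMap.range (β.flip y.1)).map U.mkQ := by
          rw [← LinearMap.range_comp]; rfl
        rw [this]
        exact (Submodule.finrank_map_le _ _).trans (h2 _))
    obtain ⟨C, hC⟩ := Submodule.exists_isCompl N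
    have hCr : finrank F C = s + 1 := by
      have q1 := Submodule.finrank_add_eq_of_isCompl hC
      have q2 := LinearMap.finrank_range_add_finrank_ker (β x0)
      rw [← hU, ← hN] at q2
      omega
    let b := Module.finBasisOfFinrankEq F C hCr
    set SN := Submodule.span F {z | ∃ x, ∃ y : N, z = β x y} with hSN
    set T : Submodule F Z := ⨆ i, LinearMap.range (β.flip (b i : Y)) with hT
    have hTr : finrank F T ≤ (s + 1) * c := by
      have : ∀ t : Finset (Fin (s+1)), finrank F (t.sup fun i => LinearMap.range (β.flip (b i : Y)) : Submodule F Z) ≤ t.card * c := by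
        intro t
        induction t using Finset.induction_on with
        | empty => simp
        | insert i t hi iht =>
          rw [Finset.sup_insert, Finset.card_insert_of_notMem hi]
          refine (Submodule.finrank_add_le_finrank_add_finrank _ _).trans ?_
          have := h2 (b i : Y)
          linarith
      have h3 := this Finset.univ
      rw [Finset.sup_univ_eq_iSup] at h3
      simpa using h3
    have hmap : SN.map U.mkQ = Submodule.span F {z | ∃ x y, z = β' x y} := by
      rw [hSN, Submodule.map_span]
      congr 1
      ext z
      constructor
      · rintro ⟨_, ⟨x, y, rfl⟩, rfl⟩
        exact ⟨x, y, rfl⟩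
      · rintro ⟨x, y, rfl⟩
        exact ⟨_, ⟨x, y, rfl⟩, rfl⟩
    rw [← hmap] at key
    have hSNr : finrank F SN ≤ finrank F (SN.map U.mkQ) + (s + 1) := by
      have q := LinearMap.finrank_range_add_finrank_ker (U.mkQ.domRestrict SN)
      have r1 : LinearMap.range (U.mkQ.domRestrict SN) = SN.map U.mkQ := by
        rw [LinearMap.range_domRestrict]
      have r2 : finrank F (LinearMap.ker (U.mkQ.domRestrict SN)) ≤ finrank F U := by
        rw [← Submodule.finrank_map_subtype_eq SN]
        apply Submodule.finrank_mono
        rintro _ ⟨z, hz, rfl⟩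
        have : U.mkQ z.1 = 0 := hz
        simpa using this
      rw [r1] at q
      omega
    have hle : Submodule.span F {z | ∃ x y, z = β x y} ≤ SN ⊔ T := by
      rw [Submodule.span_le]
      rintro _ ⟨x, y, rfl⟩
      have hy : y ∈ N ⊔ C := by rw [hC.sup_eq_top]; trivial
      obtain ⟨n, hn, d, hd, rfl⟩ := Submodule.mem_sup.1 hy
      rw [map_add]
      refine Submodule.add_mem_sup (Submodule.subset_span ⟨x, ⟨n, hn⟩, rfl⟩) ?_
      have hd' := congrArg Subtype.val (b.sum_repr ⟨d, hd⟩)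
      simp only [Submodule.coe_sum, Submodule.coe_smul] at hd'
      rw [← hd', map_sum]
      refine Submodule.sum_mem _ fun i _ => ?_
      rw [map_smul]
      refine Submodule.smul_mem _ _ (Submodule.mem_iSup_of_mem i ⟨x, rfl⟩)
    calc _ ≤ finrank F (SN ⊔ T : Submodule F Z) := Submodule.finrank_mono hle
      _ ≤ finrank F SN + finrank F T := Submodule.finrank_add_le_finrank_add_finrank _ _
      _ ≤ s ^ 2 * (c + 1) + (s + 1) + (s + 1) * c := by omega
      _ ≤ _ := by nlinarith [Nat.zero_le (s * (c+1))]

/-- **Ramsey-like theorem for bilinear maps.** Let `K = (2p)^{(a+1)²b/2}`. If a bilinear map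
`β : X × Y → Z` of finite-dimensional `𝔽_p`-vector spaces has at least `K` linearly
independent vectors in its image, then some `β_{x·}` has rank at least `a` or some `β_{·y}`
has rank at least `b`. -/
theorem ramsey_bilinear
    {p : ℕ} [Fact p.Prime] (a b : ℕ)
    {X Y Z : Type*} [AddCommGroup X] [Module (ZMod p) X] [FiniteDimensional (ZMod p) X]
    [AddCommGroup Y] [Module (ZMod p) Y] [FiniteDimensional (ZMod p) Y]
    [AddCommGroup Z] [Module (ZMod p) Z] [FiniteDimensional (ZMod p) Z]
    (β : X →ₗ[ZMod p] Y →ₗ[ZMod p] Z)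
    (h : ∃ (m : ℕ) (v : Fin m → Z),
      ((2 * p : ℝ)) ^ ((((a + 1) ^ 2 * b : ℕ) : ℝ) / 2) ≤ (m : ℝ) ∧
      LinearIndependent (ZMod p) v ∧
      ∀ i : Fin m, ∃ (x : X) (y : Y), v i = β x y) :
    (∃ x : X, a ≤ Module.finrank (ZMod p) (LinearMap.range (β x))) ∨
    (∃ y : Y, b ≤ Module.finrank (ZMod p) (LinearMap.range (β.flip y))) := by
  obtain ⟨m, v, hm, hv, hvi⟩ := h
  by_contra! hcon
  obtain ⟨ha, hb⟩ := hcon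
  have ha0 := ha 0
  have hb0 := hb 0
  obtain ⟨s, rfl⟩ : ∃ s, a = s + 1 := ⟨a - 1, by omega⟩
  obtain ⟨c, rfl⟩ : ∃ c, b = c + 1 := ⟨b - 1, by omega⟩
  have key := rb_main c s β (fun x => Nat.lt_succ_iff.1 (ha x)) (fun y => Nat.lt_succ_iff.1 (hb y))
  have h1 : m ≤ s ^ 2 * (c + 1) := by
    refine le_trans ?_ key
    have h2 := finrank_span_eq_card hv
    rw [Fintype.card_fin] at h2
    rw [← h2]
    apply Submodule.finrank_mono
    apply Submodule.span_mono
    rintro _ ⟨i, rfl⟩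
    exact hvi i
  set n := (s + 1 + 1) ^ 2 * (c + 1) with hn
  have h3 : m ≤ n := h1.trans (by rw [hn]; gcongr; omega)
  have hp : (2 : ℝ) ≤ p := by exact_mod_cast (Fact.out : p.Prime).two_le
  have h4 : (2 : ℝ) ^ n ≤ (2 * p : ℝ) ^ ((n : ℝ) / 2) := by
    calc (2 : ℝ) ^ n = ((2 : ℝ) ^ (2 : ℝ)) ^ ((n : ℝ) / 2) := by
          rw [← Real.rpow_mul (by norm_num), ← Real.rpow_natCast]
          congr 1; ring
      _ ≤ _ := by
          apply Real.rpow_le_rpow (by positivity) _ (by positivity)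
          norm_num; linarith
  have h5 : (n : ℝ) < 2 ^ n := by exact_mod_cast Nat.lt_two_pow_self
  have h6 : (m : ℝ) ≤ n := by exact_mod_cast h3
  linarith
end
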